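/- arXiv:1410.3392 — 6 statements merged into one kernel-verified Lean document; each statement's English description precedes it below -/
import Mathlib

section
/- Let v : (0,1) → ℝ be differentiable with E := 2π ∫₀¹ r v′(r)² dr < ∞ and ∫₀¹ v(r)² · r/(1−r²)² dr < ∞. Then for every r ∈ (0,1), |v(r)| ≤ (E/(4π))^{1/2} · ((1−r²)/r)^{1/2}. (This is the radial estimate |u(x)| ≤ ‖u‖ (4π)^{−1/2} (1−|x|²)^{1/2} |x|^{−1/2} for radial functions u in H¹ of the hyperbolic disc.) -/
open MeasureTheory Real Set

noncomputable section

/-- The logarithm is bounded by the hyperbolic sine of itself. -/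
theorem neg_log_le_one_sub_sq_div {r : ℝ} (hr0 : 0 < r) (hr1 : r < 1) :
    -log r ≤ (1 - r ^ 2) / (2 * r) := by
  have hinv : 0 < r⁻¹ := inv_pos.2 hr0
  have hlog : 0 ≤ log r⁻¹ := log_nonneg ((one_le_inv₀ hr0).2 hr1.le)
  have h := self_le_sinh_iff.2 hlog
  rw [sinh_log hinv, log_inv] at h
  convert h using 1
  field_simp

/-- A function with finite hyperbolic weighted `L²` integral comes arbitrarily close to `0`
near the boundary point `1`. -/
theorem exists_abs_lt_of_integrableOn_hyperbolic {v : ℝ → ℝ}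
    (h : IntegrableOn (fun r => (v r) ^ 2 * r / (1 - r ^ 2) ^ 2) (Ioo 0 1) volume)
    {r ε : ℝ} (hr0 : 0 < r) (hr1 : r < 1) (hε : 0 < ε) :
    ∃ t ∈ Ioo r 1, |v t| < ε := by
  by_contra! hbig
  have hint : IntegrableOn (fun x : ℝ => (x - 1)⁻¹) (Ioo r 1) volume := by
    refine Integrable.mono' ((h.mono_set (Ioo_subset_Ioo_left hr0.le)).const_mul (4 / (ε ^ 2 * r)))
      (by fun_prop) ?_
    filter_upwards [ae_restrict_mem measurableSet_Ioo] with x hx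
    have hx0 : 0 < x := hr0.trans hx.1
    have hx1 : 0 < 1 - x := sub_pos.2 hx.2
    have hsq : ε ^ 2 ≤ v x ^ 2 := by
      rw [← sq_abs (v x)]
      exact pow_le_pow_left₀ hε.le (hbig x hx) 2
    have hprod : ε ^ 2 * r ≤ v x ^ 2 * x := by
      have := hx.1.le
      gcongr
    have hden : (1 - x ^ 2) ^ 2 ≤ 4 * (1 - x) := by
      have h1 : (1 + x) ^ 2 ≤ 4 := by nlinarith [hx.2]
      have h2 : (1 - x) ^ 2 ≤ 1 - x := by nlinarith
      calc (1 - x ^ 2) ^ 2 = (1 + x) ^ 2 * (1 - x) ^ 2 := by ring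
        _ ≤ 4 * (1 - x) := by gcongr
    have hpos : 0 < (1 - x ^ 2) ^ 2 := by
      have : 0 < 1 - x ^ 2 := by nlinarith
      positivity
    rw [norm_inv, norm_eq_abs, abs_sub_comm, abs_of_pos hx1, div_mul_div_comm, inv_eq_one_div,
      div_le_div_iff₀ hx1 (by positivity), one_mul]
    calc ε ^ 2 * r * (1 - x ^ 2) ^ 2 ≤ v x ^ 2 * x * (4 * (1 - x)) := by gcongr
      _ = 4 * (v x ^ 2 * x) * (1 - x) := by ring
  rw [← intervalIntegrable_iff_integrableOn_Ioo_of_le hr1.le, intervalIntegrable_sub_inv_iff]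
    at hint
  rcases hint with h | h
  · exact hr1.ne h
  · exact h right_mem_uIcc

/-- A weighted Young inequality for increments of a function with finite radial energy. -/
theorem two_mul_sub_le_energy_add_sq_mul_log {v : ℝ → ℝ} (hv : DifferentiableOn ℝ v (Ioo 0 1))
    (h : IntegrableOn (fun r => r * (deriv v r) ^ 2) (Ioo 0 1) volume)
    {r t : ℝ} (hr : 0 < r) (hrt : r ≤ t) (ht : t < 1) (c : ℝ) :
    2 * c * (v t - v r) ≤
      (∫ s in Ioo (0 : ℝ) 1, s * (deriv v s) ^ 2) + c ^ 2 * log (t / r) := by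
  have hsub : Ioo r t ⊆ Ioo 0 1 := Ioo_subset_Ioo hr.le ht.le
  have henergy : IntervalIntegrable (fun s => s * (deriv v s) ^ 2) volume r t :=
    (intervalIntegrable_iff_integrableOn_Ioo_of_le hrt).2 (h.mono_set hsub)
  have hinv : IntervalIntegrable (fun s : ℝ => c ^ 2 * s⁻¹) volume r t := by
    refine (intervalIntegral.intervalIntegrable_inv (fun x hx => ?_) continuousOn_id).const_mul _
    rw [uIcc_of_le hrt] at hx
    exact (hr.trans_le hx.1).ne'
  have hderiv : IntervalIntegrable (deriv v) volume r t := by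
    rw [intervalIntegrable_iff_integrableOn_Ioo_of_le hrt]
    refine Integrable.mono' (((h.mono_set hsub).const_mul r⁻¹).add
      (integrableOn_const (C := (1 : ℝ)) (by simp)))
      (measurable_deriv v).aestronglyMeasurable ?_
    filter_upwards [ae_restrict_mem measurableSet_Ioo] with x hx
    have hx1 : 1 ≤ r⁻¹ * x := by
      rw [inv_mul_eq_div, one_le_div hr]
      exact hx.1.le
    have hle : |deriv v x| ≤ deriv v x ^ 2 + 1 := by
      rw [← sq_abs]
      nlinarith [sq_nonneg (|deriv v x| - 1)]
    calc ‖deriv v x‖ ≤ 1 * deriv v x ^ 2 + 1 := by simpa using hle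
      _ ≤ r⁻¹ * x * deriv v x ^ 2 + 1 := by gcongr
      _ = r⁻¹ * (x * deriv v x ^ 2) + 1 := by ring
  have hftc : ∫ s in r..t, deriv v s = v t - v r := by
    refine intervalIntegral.integral_deriv_eq_sub (fun x hx => ?_) hderiv
    rw [uIcc_of_le hrt] at hx
    exact hv.differentiableAt (Ioo_mem_nhds (hr.trans_le hx.1) (hx.2.trans_lt ht))
  have hyoung : ∫ s in r..t, 2 * c * deriv v s ≤
      ∫ s in r..t, (s * (deriv v s) ^ 2 + c ^ 2 * s⁻¹) := by
    refine intervalIntegral.integral_mono_on hrt (hderiv.const_mul _) (henergy.add hinv)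
      fun s hs => ?_
    have hs0 : 0 < s := hr.trans_le hs.1
    have hsq : s * deriv v s ^ 2 + c ^ 2 * s⁻¹ - 2 * c * deriv v s =
        s⁻¹ * (s * deriv v s - c) ^ 2 := by
      field_simp
      ring
    have : 0 ≤ s⁻¹ * (s * deriv v s - c) ^ 2 := by positivity
    linarith
  rw [intervalIntegral.integral_const_mul, hftc, intervalIntegral.integral_add henergy hinv,
    intervalIntegral.integral_const_mul, integral_inv_of_pos hr (hr.trans_le hrt),
    intervalIntegral.integral_of_le hrt, integral_Ioc_eq_integral_Ioo] at hyoung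
  have hmono : ∫ s in Ioo r t, s * (deriv v s) ^ 2 ≤ ∫ s in Ioo 0 1, s * (deriv v s) ^ 2 := by
    refine setIntegral_mono_set h ?_ hsub.eventuallyLE
    filter_upwards [ae_restrict_mem measurableSet_Ioo] with x hx
    exact mul_nonneg hx.1.le (sq_nonneg _)
  linarith

/-- Radial estimate for radial `H¹`-functions on the hyperbolic disc, in
Euclidean polar coordinates: if `v : (0,1) → ℝ` is the radial profile, with
finite Dirichlet energy `E = 2π ∫₀¹ r v'(r)² dr` and finite weighted `L²`
integral `∫₀¹ v(r)² r/(1-r²)² dr`, then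
`|v r| ≤ (E/(4π))^(1/2) ((1-r²)/r)^(1/2)` for all `r ∈ (0,1)`. -/
theorem stmt1 (v : ℝ → ℝ) (hv : DifferentiableOn ℝ v (Ioo 0 1))
    (h1 : IntegrableOn (fun r => r * (deriv v r) ^ 2) (Ioo 0 1) volume)
    (h2 : IntegrableOn (fun r => (v r) ^ 2 * r / (1 - r ^ 2) ^ 2) (Ioo 0 1) volume) :
    ∀ r ∈ Ioo (0 : ℝ) 1,
      |v r| ≤ Real.sqrt ((2 * π * ∫ s in Ioo (0 : ℝ) 1, s * (deriv v s) ^ 2) / (4 * π)) *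
        Real.sqrt ((1 - r ^ 2) / r) := by
  rintro r ⟨hr0, hr1⟩
  set I := ∫ s in Ioo (0 : ℝ) 1, s * (deriv v s) ^ 2
  set M := (1 - r ^ 2) / (2 * r) with hM
  have hMpos : 0 < M := div_pos (by nlinarith) (by positivity)
  have hbound (c : ℝ) : -(2 * c * v r) ≤ I + c ^ 2 * M := by
    refine le_of_forall_pos_le_add fun δ hδ => ?_
    obtain ⟨t, ht, hvt⟩ := exists_abs_lt_of_integrableOn_hyperbolic h2 hr0 hr1
      (show 0 < δ / (2 * |c| + 1) by positivity)
    have hinc := two_mul_sub_le_energy_add_sq_mul_log hv h1 hr0 ht.1.le ht.2 c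
    have hlog : log (t / r) ≤ M := by
      rw [log_div (hr0.trans ht.1).ne' hr0.ne']
      linarith [log_nonpos (hr0.trans ht.1).le ht.2.le, neg_log_le_one_sub_sq_div hr0 hr1]
    have hmul : c ^ 2 * log (t / r) ≤ c ^ 2 * M := by gcongr
    have hsmall : -(2 * c * v t) ≤ δ := by
      rw [lt_div_iff₀ (by positivity)] at hvt
      calc -(2 * c * v t) ≤ |2 * c * v t| := neg_le_abs _
        _ = |v t| * (2 * |c|) := by
          rw [abs_mul, abs_mul, abs_two]
          ring
        _ ≤ δ := by linarith [abs_nonneg (v t)]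
    linarith
  have hsq : v r ^ 2 ≤ I * M := by
    have h := hbound (-(v r / M))
    rw [← div_le_iff₀ hMpos]
    have e1 : -(2 * -(v r / M) * v r) = 2 * (v r ^ 2 / M) := by ring
    have e2 : (-(v r / M)) ^ 2 * M = v r ^ 2 / M := by
      field_simp
    linarith
  rw [← sqrt_mul' _ (div_nonneg (by nlinarith) hr0.le)]
  refine abs_le_sqrt (hsq.trans_eq ?_)
  rw [hM]
  field_simp
  ring
end
end

section
/- Let u : (0,∞) → ℝ be differentiable with ∫₀^∞ sinh(s) · u′(s)² ds < ∞ and ∫₀^∞ u(s)² sinh(s) ds < ∞. Then for every t > 0, |u(t)| ≤ (∫₀^∞ sinh(s) u′(s)² ds)^{1/2} · (sinh t)^{−1/2}. -/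
open MeasureTheory Real Set

noncomputable section

/-- If `f` is differentiable on `(0, ∞)`, its oscillation on `[t, T]` is controlled by the weighted
energy `∫ sinh · (f')²` and the weight `1 / sinh t`, for every splitting parameter `c > 0`. -/
lemma two_mul_sub_le_energy (f : ℝ → ℝ) (hf : DifferentiableOn ℝ f (Ioi 0))
    (hE : IntegrableOn (fun s => Real.sinh s * (deriv f s) ^ 2) (Ioi 0) volume)
    {t T c : ℝ} (ht : 0 < t) (htT : t ≤ T) (hc : 0 < c) :
    2 * (f T - f t) ≤
      c⁻¹ * (∫ s in Ioi (0 : ℝ), Real.sinh s * (deriv f s) ^ 2) + c * (Real.sinh t)⁻¹ := by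
  have hpos : ∀ s, t ≤ s → 0 < Real.sinh s := fun s hs => Real.sinh_pos_iff.2 (ht.trans_le hs)
  have hder : ∀ s, t ≤ s → HasDerivAt (fun x => 2 * f x + c * (Real.sinh x)⁻¹)
      (2 * deriv f s + c * (-Real.cosh s / Real.sinh s ^ 2)) s := fun s hs =>
    ((((hf s (ht.trans_le hs)).differentiableAt
      (Ioi_mem_nhds (ht.trans_le hs))).hasDerivAt).const_mul 2).add
      (((Real.hasDerivAt_sinh s).inv (hpos s hs).ne').const_mul c)
  have hsub : Icc t T ⊆ Ioi 0 := fun s hs => ht.trans_le hs.1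
  have key := intervalIntegral.sub_le_integral_of_hasDeriv_right_of_le htT
    (fun s hs => (hder s hs.1).continuousAt.continuousWithinAt)
    (fun s hs => (hder s hs.1.le).hasDerivWithinAt)
    ((hE.mono_set hsub).const_mul c⁻¹) (fun s hs => by
      have hs0 := hpos s hs.1.le
      have hcosh : (Real.sinh s)⁻¹ ≤ Real.cosh s / Real.sinh s ^ 2 := by
        rw [inv_eq_one_div, div_le_div_iff₀ hs0 (by positivity)]
        nlinarith [Real.sinh_lt_cosh s]
      have hmul := mul_le_mul_of_nonneg_left hcosh hc.le
      have hsq : 0 ≤ c⁻¹ * Real.sinh s * (deriv f s - c * (Real.sinh s)⁻¹) ^ 2 := by positivity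
      have hexp : c⁻¹ * Real.sinh s * (deriv f s - c * (Real.sinh s)⁻¹) ^ 2 =
          c⁻¹ * (Real.sinh s * deriv f s ^ 2) - 2 * deriv f s + c * (Real.sinh s)⁻¹ := by
        field_simp
        ring
      rw [neg_div, mul_neg]
      linarith)
  rw [intervalIntegral.integral_of_le htT, integral_const_mul] at key
  have hmono : ∫ s in Ioc t T, Real.sinh s * (deriv f s) ^ 2 ≤
      ∫ s in Ioi (0 : ℝ), Real.sinh s * (deriv f s) ^ 2 :=
    setIntegral_mono_set hE
      ((ae_restrict_iff' measurableSet_Ioi).2 (.of_forall fun s hs =>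
        mul_nonneg (Real.sinh_pos_iff.2 hs).le (sq_nonneg _)))
      (Ioc_subset_Icc_self.trans hsub).eventuallyLE
  have := mul_le_mul_of_nonneg_left hmono (inv_pos.2 hc).le
  have : 0 ≤ c * (Real.sinh T)⁻¹ := mul_nonneg hc.le (inv_pos.2 (hpos T htT)).le
  linarith

/-- A function in `L²(sinh)` takes arbitrarily small values on every half-line. -/
lemma exists_abs_lt_of_integrableOn_sq_mul_sinh (u : ℝ → ℝ)
    (h : IntegrableOn (fun s => (u s) ^ 2 * Real.sinh s) (Ioi 0) volume)
    {t ε : ℝ} (ht : 0 < t) (hε : 0 < ε) : ∃ T, t ≤ T ∧ |u T| < ε := by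
  by_contra! hlow
  have hst : 0 < Real.sinh t := Real.sinh_pos_iff.2 ht
  have hconst : IntegrableOn (fun _ : ℝ => ε ^ 2 * Real.sinh t) (Ioi t) volume := by
    refine Integrable.mono' (h.mono_set (Ioi_subset_Ioi ht.le)) aestronglyMeasurable_const
      ((ae_restrict_iff' measurableSet_Ioi).2 (.of_forall fun s hs => ?_))
    rw [Real.norm_of_nonneg (by positivity)]
    have hs' : t ≤ s := le_of_lt hs
    have hsq : ε ^ 2 ≤ u s ^ 2 := by
      rw [← sq_abs (u s)]
      exact pow_le_pow_left₀ hε.le (hlow s hs') 2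
    exact mul_le_mul hsq (Real.sinh_le_sinh.2 hs') hst.le (sq_nonneg _)
  rw [integrableOn_const_iff] at hconst
  rcases hconst with h0 | hfin
  · exact (mul_pos (pow_pos hε 2) hst).ne' (by simpa using h0)
  · simp at hfin

/-- Decay estimate for radial functions on the hyperbolic plane in geodesic
polar coordinates: if `u : (0,∞) → ℝ` is differentiable with
`∫₀^∞ sinh(s) u'(s)² ds < ∞` and `∫₀^∞ u(s)² sinh(s) ds < ∞`, then for every
`t > 0`, `|u t| ≤ (∫₀^∞ sinh(s) u'(s)² ds)^(1/2) (sinh t)^(-1/2)`. -/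
theorem stmt2 (u : ℝ → ℝ) (hu : DifferentiableOn ℝ u (Ioi 0))
    (h1 : IntegrableOn (fun s => Real.sinh s * (deriv u s) ^ 2) (Ioi 0) volume)
    (h2 : IntegrableOn (fun s => (u s) ^ 2 * Real.sinh s) (Ioi 0) volume) :
    ∀ t : ℝ, 0 < t →
      |u t| ≤ Real.sqrt (∫ s in Ioi (0 : ℝ), Real.sinh s * (deriv u s) ^ 2) /
        Real.sqrt (Real.sinh t) := by
  intro t ht
  have hst : 0 < Real.sinh t := Real.sinh_pos_iff.2 ht
  rcases (abs_nonneg (u t)).eq_or_lt with h0 | hpos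
  · rw [← h0]
    positivity
  set E := ∫ s in Ioi (0 : ℝ), Real.sinh s * (deriv u s) ^ 2 with hEdef
  have hc : 0 < |u t| * Real.sinh t := mul_pos hpos hst
  have hbound : 2 * |u t| ≤
      (|u t| * Real.sinh t)⁻¹ * E + |u t| * Real.sinh t * (Real.sinh t)⁻¹ := by
    refine le_of_forall_pos_le_add fun ε hε => ?_
    obtain ⟨T, hT, huT⟩ := exists_abs_lt_of_integrableOn_sq_mul_sinh u h2 ht (half_pos hε)
    have hup := two_mul_sub_le_energy u hu h1 ht hT hc
    have hdown := two_mul_sub_le_energy (fun s => -u s) hu.neg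
      (by simpa only [deriv.fun_neg, neg_sq] using h1) ht hT hc
    simp only [deriv.fun_neg, neg_sq] at hdown
    rw [← hEdef] at hup hdown
    obtain ⟨hl, hr⟩ := abs_lt.1 huT
    rcases abs_cases (u t) with ⟨h, -⟩ | ⟨h, -⟩ <;> linarith
  rw [mul_assoc, mul_inv_cancel₀ hst.ne', mul_one] at hbound
  have hle : |u t| ≤ (|u t| * Real.sinh t)⁻¹ * E := by linarith
  rw [inv_mul_eq_div, le_div_iff₀ hc] at hle
  rw [le_div_iff₀ (Real.sqrt_pos.2 hst)]
  refine Real.le_sqrt_of_sq_le ?_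
  rw [mul_pow, Real.sq_sqrt hst.le]
  linarith
end
end

section
/- Let λ > 0 and let h : [0,∞) → ℝ be continuous, differentiable on (0,∞), with h(t) > 0 and h′(t) ≥ h(t)/t for all t > 0. Then there exists a constant C > 0 such that for every t ≥ 0, ∫₀^t h(s)(e^{λs²} − 1) ds ≤ C · h(t)(e^{λt²} − 1). (In particular, setting f(t) = h(t)(e^{λt²} − 1) and F(t) = ∫₀^t f(s) ds, one has F(t) ≤ C f(t) for all t ≥ 0, which is condition (C3) of a function of critical growth.) -/
open MeasureTheory Real Set intervalIntegral

noncomputable section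

/-- If `λ > 0` and `h : [0,∞) → ℝ` is continuous, differentiable on `(0,∞)`,
positive and satisfying `h'(t) ≥ h(t)/t` on `(0,∞)`, then the primitive
`F(t) = ∫₀^t h(s)(e^{λs²} - 1) ds` satisfies `F(t) ≤ C h(t)(e^{λt²} - 1)` for
some constant `C > 0` and all `t ≥ 0`: condition (C3) of critical growth. -/
theorem stmt6 (lam : ℝ) (hlam : 0 < lam) (h : ℝ → ℝ)
    (hcont : ContinuousOn h (Ici 0))
    (hdiff : DifferentiableOn ℝ h (Ioi 0))
    (hpos : ∀ t : ℝ, 0 < t → 0 < h t)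
    (hmono : ∀ t : ℝ, 0 < t → h t / t ≤ deriv h t) :
    ∃ C : ℝ, 0 < C ∧ ∀ t : ℝ, 0 ≤ t →
      (∫ s in (0 : ℝ)..t, h s * (Real.exp (lam * s ^ 2) - 1))
        ≤ C * (h t * (Real.exp (lam * t ^ 2) - 1)) := by
  refine ⟨1 / (2 * lam) + 1, by positivity, fun t ht => ?_⟩
  set C : ℝ := 1 / (2 * lam) + 1 with hC
  have hcont' : ContinuousOn h (Icc 0 t) := hcont.mono Icc_subset_Ici_self
  have hf : ContinuousOn (fun s => h s * (Real.exp (lam * s ^ 2) - 1)) (Icc 0 t) :=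
    hcont'.mul (by fun_prop)
  have hderiv : ∀ s ∈ Ioo 0 t,
      HasDerivWithinAt (fun s => C * (h s * (Real.exp (lam * s ^ 2) - 1)))
        (C * (deriv h s * (Real.exp (lam * s ^ 2) - 1)
          + h s * (Real.exp (lam * s ^ 2) * (lam * (2 * s))))) (Ioi s) s := by
    intro s hs
    have hh : HasDerivAt h (deriv h s) s :=
      (hdiff.differentiableAt (Ioi_mem_nhds hs.1)).hasDerivAt
    have he : HasDerivAt (fun s : ℝ => Real.exp (lam * s ^ 2) - 1)
        (Real.exp (lam * s ^ 2) * (lam * (2 * s))) s := by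
      simpa using (((hasDerivAt_pow 2 s).const_mul lam).exp).sub_const 1
    exact ((hh.mul he).const_mul C).hasDerivWithinAt
  have hle : ∀ s ∈ Ioo 0 t, h s * (Real.exp (lam * s ^ 2) - 1) ≤
      C * (deriv h s * (Real.exp (lam * s ^ 2) - 1)
        + h s * (Real.exp (lam * s ^ 2) * (lam * (2 * s)))) := by
    intro s ⟨hs, _⟩
    have hE : 0 ≤ Real.exp (lam * s ^ 2) - 1 := by
      have := Real.one_le_exp (show 0 ≤ lam * s ^ 2 by positivity)
      linarith
    have hCs : 1 ≤ C * (1 / s + lam * (2 * s)) := by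
      have : C * (1 / s + lam * (2 * s)) - 1 =
          (1 / (2 * lam) + 1 + 2 * lam * s ^ 2 + (s ^ 2 - s)) / s := by
        rw [hC]; field_simp; ring
      have hnum : 0 ≤ 1 / (2 * lam) + 1 + 2 * lam * s ^ 2 + (s ^ 2 - s) := by
        have h1 : 0 ≤ 1 / (2 * lam) := by positivity
        have h2 : 0 ≤ 2 * lam * s ^ 2 := by positivity
        nlinarith [sq_nonneg (s - 1 / 2)]
      have := div_nonneg hnum hs.le
      linarith
    have hhs := (hpos s hs).le
    calc h s * (Real.exp (lam * s ^ 2) - 1)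
        ≤ h s * (Real.exp (lam * s ^ 2) - 1) * (C * (1 / s + lam * (2 * s))) :=
          le_mul_of_one_le_right (mul_nonneg hhs hE) hCs
      _ = C * (h s / s * (Real.exp (lam * s ^ 2) - 1)
            + h s * ((Real.exp (lam * s ^ 2) - 1) * (lam * (2 * s)))) := by ring
      _ ≤ _ := by
          gcongr
          · exact hmono s hs
          · linarith
  have key := integral_le_sub_of_hasDeriv_right_of_le ht (hf.const_mul C) hderiv
    hf.integrableOn_Icc hle
  simpa using key
end
end

section
/- Let f be a function of critical growth on 𝔹² and let u be an H¹_R(𝔹²)-function. Then ∫_B F(x,u(x)) dv_g < ∞. -/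
open MeasureTheory Real Set Filter

noncomputable section

/-- Points of the plane. -/
abbrev Pt := EuclideanSpace ℝ (Fin 2)

/-- The open unit disc `B = {x ∈ ℝ² : |x| < 1}`. -/
def B : Set Pt := Metric.ball 0 1

/-- The density of the hyperbolic volume measure `dv_g = (2/(1-|x|²))² dx`. -/
def dens (x : Pt) : ℝ := (2 / (1 - ‖x‖ ^ 2)) ^ 2

/-- Integral with respect to the hyperbolic volume measure on `B`. -/
def hInt (φ : Pt → ℝ) : ℝ := ∫ x in B, φ x * dens x

/-- Integrability with respect to the hyperbolic volume measure on `B`. -/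
def HIntegrable (φ : Pt → ℝ) : Prop := IntegrableOn (fun x => φ x * dens x) B volume

/-- The squared Euclidean Dirichlet norm `‖u‖² = ∫_B |∇u|² dx` (which equals the
hyperbolic Dirichlet energy by conformal invariance). -/
def enormSq (u : Pt → ℝ) : ℝ := ∫ x in B, ‖gradient u x‖ ^ 2

/-- `u` is an `H¹(𝔹²)`-function: differentiable on `B`, with finite Dirichlet
energy and finite hyperbolic `L²` norm. -/
def IsH1 (u : Pt → ℝ) : Prop :=
  DifferentiableOn ℝ u B ∧
  IntegrableOn (fun x => ‖gradient u x‖ ^ 2) B volume ∧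
  HIntegrable (fun x => (u x) ^ 2)

/-- `u` is an `H¹_R(𝔹²)`-function: an `H¹(𝔹²)`-function which is radial. -/
def IsH1R (u : Pt → ℝ) : Prop :=
  IsH1 u ∧ ∀ x y : Pt, ‖x‖ = ‖y‖ → u x = u y

/-- The nonlinearity `f(x,t) = h(x,t)(e^{λt²} - 1)`. -/
def fn (lam : ℝ) (h : Pt → ℝ → ℝ) (x : Pt) (t : ℝ) : ℝ :=
  h x t * (Real.exp (lam * t ^ 2) - 1)

/-- The primitive `F(x,t) = ∫₀^t f(x,s) ds`. -/
def Fn (lam : ℝ) (h : Pt → ℝ → ℝ) (x : Pt) (t : ℝ) : ℝ :=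
  ∫ s in (0 : ℝ)..t, fn lam h x s

/-- The functional `I_λ(u) = (1/2)∫_B f(x,u)u dv_g - ∫_B F(x,u) dv_g`. -/
def Ilam (lam : ℝ) (h : Pt → ℝ → ℝ) (u : Pt → ℝ) : ℝ :=
  (1 / 2) * hInt (fun x => fn lam h x (u x) * u x) - hInt (fun x => Fn lam h x (u x))

/-- `f(x,t) = h(x,t)(e^{λt²} - 1)` is a function of critical growth on `𝔹²`. -/
structure CriticalGrowth (lam : ℝ) (h : Pt → ℝ → ℝ) : Prop where
  lam_pos : 0 < lam
  h_C1 : ContDiff ℝ 1 (Function.uncurry h)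
  f_pos : ∀ x ∈ B, ∀ t : ℝ, 0 < t → 0 < fn lam h x t
  f_odd : ∀ x ∈ B, ∀ t : ℝ, fn lam h x (-t) = -fn lam h x t
  /-- (C1), first part: `h` is bounded on `B × [-L, L]` for every `L > 0`. -/
  h_bdd : ∀ L : ℝ, 0 < L → ∃ C : ℝ, ∀ x ∈ B, ∀ t : ℝ, |t| ≤ L → |h x t| ≤ C
  /-- (C1), second part: `sup_{x ∈ B} |h(x,t)| ≤ C tᵃ` near `t = 0`. -/
  h_zero : ∃ a C δ : ℝ, 0 < a ∧ 0 < C ∧ 0 < δ ∧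
    ∀ x ∈ B, ∀ t : ℝ, 0 < t → t < δ → |h x t| ≤ C * t ^ a
  /-- (C2): `∂f/∂t (x,t) > f(x,t)/t` for `t > 0`. -/
  f_super : ∀ x ∈ B, ∀ t : ℝ, 0 < t → fn lam h x t / t < deriv (fun s => fn lam h x s) t
  /-- (C3): `F(x,t) ≤ M₁(g(x) + f(x,t))` with `0 ≤ g ∈ L¹(B, dv_g)`. -/
  F_bound : ∃ M₁ : ℝ, 0 < M₁ ∧ ∃ g : Pt → ℝ, (∀ x, 0 ≤ g x) ∧ HIntegrable g ∧
    ∀ x ∈ B, ∀ t : ℝ, 0 < t → Fn lam h x t ≤ M₁ * (g x + fn lam h x t)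
  /-- (C4), first part: `inf_{x ∈ K} h(x,t) e^{εt²} → ∞` as `t → ∞`,
  for every compact `K ⊆ B`. -/
  h_inf : ∀ ε : ℝ, 0 < ε → ∀ K : Set Pt, K ⊆ B → IsCompact K →
    ∀ c : ℝ, ∃ T : ℝ, ∀ t : ℝ, T ≤ t → ∀ x ∈ K, c ≤ h x t * Real.exp (ε * t ^ 2)
  /-- (C4), second part: `sup_{x ∈ B} h(x,t) e^{-εt²} → 0` as `t → ∞`. -/
  h_sup : ∀ ε : ℝ, 0 < ε → ∀ c : ℝ, 0 < c → ∃ T : ℝ, ∀ t : ℝ, T ≤ t → ∀ x ∈ B,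
    h x t * Real.exp (-ε * t ^ 2) < c

/-- A nonlinearity of critical growth is quadratically bounded on bounded sets of values. -/
theorem CriticalGrowth.abs_fn_le {lam : ℝ} {h : Pt → ℝ → ℝ} (hf : CriticalGrowth lam h)
    {L : ℝ} (hL : 0 < L) :
    ∃ K : ℝ, 0 ≤ K ∧ ∀ x ∈ B, ∀ t : ℝ, |t| ≤ L → |fn lam h x t| ≤ K * t ^ 2 := by
  obtain ⟨C, hC⟩ := hf.h_bdd L hL
  have hlam := hf.lam_pos
  refine ⟨|C| * (lam * Real.exp (lam * L ^ 2)), by positivity, fun x hx t ht => ?_⟩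
  have h_nonneg : 0 ≤ lam * t ^ 2 := by positivity
  have h_sq : t ^ 2 ≤ L ^ 2 := sq_le_sq' (abs_le.mp ht).1 (abs_le.mp ht).2
  have h_exp : |Real.exp (lam * t ^ 2) - 1| ≤ lam * Real.exp (lam * L ^ 2) * t ^ 2 := by
    rw [abs_of_nonneg (by linarith [Real.add_one_le_exp (lam * t ^ 2)])]
    have h_neg := Real.add_one_le_exp (-(lam * t ^ 2))
    have h_mul : Real.exp (lam * t ^ 2) * Real.exp (-(lam * t ^ 2)) = 1 := by
      rw [← Real.exp_add]; simp
    have h_mono : Real.exp (lam * t ^ 2) ≤ Real.exp (lam * L ^ 2) :=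
      Real.exp_le_exp.mpr (by gcongr)
    nlinarith [mul_le_mul_of_nonneg_left h_neg (Real.exp_pos (lam * t ^ 2)).le,
      mul_le_mul_of_nonneg_left h_mono h_nonneg]
  calc |fn lam h x t| = |h x t| * |Real.exp (lam * t ^ 2) - 1| := abs_mul _ _
    _ ≤ |C| * (lam * Real.exp (lam * L ^ 2) * t ^ 2) := by
        exact mul_le_mul ((hC x hx t ht).trans (le_abs_self C)) h_exp (abs_nonneg _) (abs_nonneg _)
    _ = _ := by ring

/-- The primitive of a nonlinearity of critical growth is quadratically bounded on bounded sets
of values. -/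
theorem CriticalGrowth.abs_Fn_le {lam : ℝ} {h : Pt → ℝ → ℝ} (hf : CriticalGrowth lam h)
    {L : ℝ} (hL : 0 < L) :
    ∃ K : ℝ, 0 ≤ K ∧ ∀ x ∈ B, ∀ t : ℝ, |t| ≤ L → |Fn lam h x t| ≤ K * t ^ 2 := by
  obtain ⟨K, hK, hfK⟩ := hf.abs_fn_le hL
  refine ⟨K * L, by positivity, fun x hx t ht => ?_⟩
  have h_int : |Fn lam h x t| ≤ K * t ^ 2 * |t - 0| := by
    refine intervalIntegral.norm_integral_le_of_norm_le_const (f := fn lam h x) fun s hs => ?_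
    have hst : |s| ≤ |t| := by
      have := abs_sub_left_of_mem_uIcc (uIoc_subset_uIcc hs)
      simpa using this
    calc ‖fn lam h x s‖ ≤ K * s ^ 2 := hfK x hx s (hst.trans ht)
      _ ≤ K * t ^ 2 := by gcongr K * ?_; exact sq_le_sq.mpr hst
  calc |Fn lam h x t| ≤ K * t ^ 2 * |t - 0| := h_int
    _ ≤ K * t ^ 2 * L := by rw [sub_zero]; gcongr
    _ = _ := by ring

theorem CriticalGrowth.continuous_Fn {lam : ℝ} {h : Pt → ℝ → ℝ} (hf : CriticalGrowth lam h) :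
    Continuous fun p : Pt × ℝ => Fn lam h p.1 p.2 := by
  have hh := hf.h_C1.continuous
  refine intervalIntegral.continuous_parametric_intervalIntegral_of_continuous
    (f := fun (p : Pt × ℝ) s => fn lam h p.1 s) ?_ continuous_snd
  have h_comp : Continuous fun q : (Pt × ℝ) × ℝ => h q.1.1 q.2 :=
    hh.comp (by fun_prop : Continuous fun q : (Pt × ℝ) × ℝ => (q.1.1, q.2))
  unfold fn
  simp only [Function.uncurry_def]
  fun_prop

/-- At a nonzero point of the disc, the profile `s ↦ u (s • e)` of a radial function is
differentiable, with derivative bounded by the gradient. -/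
theorem radial_profile_deriv {u : Pt → ℝ} (hd : DifferentiableOn ℝ u B)
    (hr : ∀ x y : Pt, ‖x‖ = ‖y‖ → u x = u y) {e : Pt} (he : ‖e‖ = 1) {x : Pt} (hx : x ∈ B)
    (hx0 : x ≠ 0) :
    DifferentiableAt ℝ (fun s : ℝ => u (s • e)) ‖x‖ ∧
      |deriv (fun s : ℝ => u (s • e)) ‖x‖| ≤ ‖gradient u x‖ := by
  have hnx : 0 < ‖x‖ := norm_pos_iff.mpr hx0
  have hux : DifferentiableAt ℝ u x := hd.differentiableAt (Metric.isOpen_ball.mem_nhds hx)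
  set d : Pt := ‖x‖⁻¹ • x with hd_def
  have hdn : ‖d‖ = 1 := by
    rw [hd_def, norm_smul, norm_inv, norm_norm, inv_mul_cancel₀ hnx.ne']
  have hxd : ‖x‖ • d = x := by rw [hd_def, smul_smul, mul_inv_cancel₀ hnx.ne', one_smul]
  have h_line : HasDerivAt (fun s : ℝ => s • d) d ‖x‖ := by
    simpa using (hasDerivAt_id ‖x‖).smul_const d
  have h_fderiv : HasFDerivAt u (fderiv ℝ u x) (‖x‖ • d) := by
    rw [hxd]; exact hux.hasFDerivAt
  have h_eq : (fun s : ℝ => u (s • e)) = fun s : ℝ => u (s • d) := by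
    funext s
    exact hr _ _ (by rw [norm_smul, norm_smul, he, hdn])
  have h_deriv : HasDerivAt (fun s : ℝ => u (s • e)) (fderiv ℝ u x d) ‖x‖ := by
    rw [h_eq]; exact h_fderiv.comp_hasDerivAt _ h_line
  refine ⟨h_deriv.differentiableAt, ?_⟩
  rw [h_deriv.deriv, gradient, LinearIsometryEquiv.norm_map]
  simpa [hdn] using (fderiv ℝ u x).le_opNorm d

/-- The profile of a radial function of finite Dirichlet energy has square integrable derivative
away from the origin. -/
theorem integrableOn_sq_deriv_radial_profile {u : Pt → ℝ} (hd : DifferentiableOn ℝ u B)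
    (hg : IntegrableOn (fun x => ‖gradient u x‖ ^ 2) B volume)
    (hr : ∀ x y : Pt, ‖x‖ = ‖y‖ → u x = u y) {e : Pt} (he : ‖e‖ = 1) :
    IntegrableOn (fun r => deriv (fun s : ℝ => u (s • e)) r ^ 2) (Ioo (1 / 2) 1) volume := by
  set v : ℝ → ℝ := fun s => u (s • e) with hv
  set φ : ℝ → ℝ := (Ioo (0 : ℝ) 1).indicator fun r => deriv v r ^ 2 with hφ
  have hφ_meas : Measurable φ := ((measurable_deriv v).pow_const 2).indicator measurableSet_Ioo
  have h_radial : Integrable (fun x : Pt => φ ‖x‖) volume := by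
    refine Integrable.mono' (hg.integrable_indicator Metric.isOpen_ball.measurableSet)
      (hφ_meas.comp measurable_norm).aestronglyMeasurable (Eventually.of_forall fun x => ?_)
    by_cases hx : ‖x‖ ∈ Ioo (0 : ℝ) 1
    · have hxB : x ∈ B := mem_ball_zero_iff.mpr hx.2
      have h_le := (radial_profile_deriv hd hr he hxB (norm_pos_iff.mp hx.1)).2
      rw [hφ, indicator_of_mem hx, indicator_of_mem hxB, norm_pow, Real.norm_eq_abs]
      gcongr
    · rw [hφ, indicator_of_notMem hx, norm_zero]
      exact indicator_nonneg (fun _ _ => by positivity) _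
  have h_polar := (integrable_fun_norm_addHaar (volume : Measure Pt)).mp h_radial
  have h_half : IntegrableOn (fun r => 2 * (r * φ r)) (Ioo (1 / 2) 1) volume := by
    refine IntegrableOn.mono_set ?_ (fun r hr' => ?_ : Ioo (1 / 2 : ℝ) 1 ⊆ Ioi 0)
    · simpa [IntegrableOn] using h_polar.const_mul 2
    · exact lt_trans (by norm_num) hr'.1
  refine Integrable.mono' h_half ((measurable_deriv v).pow_const 2).aestronglyMeasurable ?_
  filter_upwards [ae_restrict_mem measurableSet_Ioo] with r hr'
  have hr0 : r ∈ Ioo (0 : ℝ) 1 := ⟨lt_trans (by norm_num) hr'.1, hr'.2⟩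
  rw [hφ, indicator_of_mem hr0, norm_pow, Real.norm_eq_abs, sq_abs]
  nlinarith [hr'.1, sq_nonneg (deriv v r)]

/-- A radial differentiable function of finite Dirichlet energy is bounded on the disc. -/
theorem bounded_of_radial {u : Pt → ℝ} (hd : DifferentiableOn ℝ u B)
    (hg : IntegrableOn (fun x => ‖gradient u x‖ ^ 2) B volume)
    (hr : ∀ x y : Pt, ‖x‖ = ‖y‖ → u x = u y) :
    ∃ L : ℝ, 0 < L ∧ ∀ x ∈ B, |u x| ≤ L := by
  obtain ⟨e, he⟩ : ∃ e : Pt, ‖e‖ = 1 := ⟨EuclideanSpace.single 0 1, by simp⟩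
  set v : ℝ → ℝ := fun s => u (s • e) with hv
  have h_sq : IntegrableOn (fun r => deriv v r ^ 2) (Ioo (1 / 2) 1) volume :=
    integrableOn_sq_deriv_radial_profile hd hg hr he
  have h_dom : IntegrableOn (fun r => 1 + deriv v r ^ 2) (Ioo (1 / 2) 1) volume :=
    (integrableOn_const (by simp)).add h_sq
  have h_norm_le : ∀ r, ‖deriv v r‖ ≤ 1 + deriv v r ^ 2 := fun r => by
    rw [Real.norm_eq_abs]
    nlinarith [sq_abs (deriv v r), sq_nonneg (|deriv v r| - 1), abs_nonneg (deriv v r)]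
  have h_int : IntegrableOn (deriv v) (Ioo (1 / 2) 1) volume :=
    Integrable.mono' h_dom (measurable_deriv v).aestronglyMeasurable
      (Eventually.of_forall h_norm_le)
  have h_sub : Metric.closedBall (0 : Pt) (1 / 2) ⊆ B :=
    Metric.closedBall_subset_ball (by norm_num)
  obtain ⟨C, hC⟩ := (isCompact_closedBall (0 : Pt) (1 / 2)).exists_bound_of_continuousOn
    (hd.continuousOn.mono h_sub)
  have h_nonneg : 0 ≤ ∫ r in Ioo (1 / 2 : ℝ) 1, 1 + deriv v r ^ 2 :=
    integral_nonneg fun r => by positivity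
  refine ⟨|C| + (∫ r in Ioo (1 / 2 : ℝ) 1, 1 + deriv v r ^ 2) + 1, by positivity,
    fun x hx => ?_⟩
  by_cases hxs : ‖x‖ ≤ 1 / 2
  · have := hC x (mem_closedBall_zero_iff.mpr hxs)
    rw [Real.norm_eq_abs] at this
    linarith [le_abs_self C]
  push Not at hxs
  have hx1 : ‖x‖ < 1 := mem_ball_zero_iff.mp hx
  have h_diff : ∀ s ∈ uIcc (1 / 2) ‖x‖, HasDerivAt v (deriv v s) s := fun s hs => by
    rw [uIcc_of_le hxs.le] at hs
    have hs0 : 0 < s := lt_of_lt_of_le (by norm_num) hs.1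
    have hns : ‖s • e‖ = s := by rw [norm_smul, he, mul_one, Real.norm_of_nonneg hs0.le]
    have := (radial_profile_deriv hd hr he (x := s • e)
      (mem_ball_zero_iff.mpr (by rw [hns]; exact hs.2.trans_lt hx1))
      (norm_pos_iff.mp (by rwa [hns]))).1
    rw [hns] at this
    exact this.hasDerivAt
  have h_ioc : Ioc (1 / 2) ‖x‖ ⊆ Ioo (1 / 2 : ℝ) 1 := fun s hs => ⟨hs.1, hs.2.trans_lt hx1⟩
  have h_ftc := intervalIntegral.integral_eq_sub_of_hasDerivAt h_diff
    ((intervalIntegrable_iff_integrableOn_Ioc_of_le hxs.le).mpr (h_int.mono_set h_ioc))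
  have h_vx : v ‖x‖ = u x := hr _ _ (by simp [norm_smul, he])
  have h_half : |v (1 / 2)| ≤ C := hC _ (mem_closedBall_zero_iff.mpr (by simp [norm_smul, he]))
  have h_le : |v ‖x‖ - v (1 / 2)| ≤ ∫ r in Ioo (1 / 2 : ℝ) 1, 1 + deriv v r ^ 2 := by
    rw [← h_ftc, intervalIntegral.integral_of_le hxs.le]
    calc |∫ r in Ioc (1 / 2) ‖x‖, deriv v r| ≤ ∫ r in Ioc (1 / 2) ‖x‖, 1 + deriv v r ^ 2 :=
          norm_integral_le_of_norm_le (h_dom.mono_set h_ioc) (Eventually.of_forall h_norm_le)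
      _ ≤ _ := setIntegral_mono_set h_dom (Eventually.of_forall fun r => by positivity)
          h_ioc.eventuallyLE
  rw [← h_vx]
  linarith [abs_sub_abs_le_abs_sub (v ‖x‖) (v (1 / 2)), le_abs_self C]

/-- If `f` is a function of critical growth on `𝔹²` and `u ∈ H¹_R(𝔹²)`, then
`∫_B F(x,u(x)) dv_g < ∞`. -/
theorem stmt10 (lam : ℝ) (h : Pt → ℝ → ℝ) (hf : CriticalGrowth lam h)
    (u : Pt → ℝ) (hu : IsH1R u) :
    HIntegrable (fun x => Fn lam h x (u x)) := by
  obtain ⟨⟨hd, hg, hL2⟩, hr⟩ := hu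
  obtain ⟨L, hL, huL⟩ := bounded_of_radial hd hg hr
  obtain ⟨K, hK, hFK⟩ := hf.abs_Fn_le hL
  have hB : MeasurableSet B := Metric.isOpen_ball.measurableSet
  have h_cont : ContinuousOn (fun x => Fn lam h x (u x)) B :=
    hf.continuous_Fn.comp_continuousOn (continuousOn_id.prodMk hd.continuousOn)
  have h_dens : Measurable dens := by unfold dens; fun_prop
  refine Integrable.mono' (hL2.const_mul K)
    ((h_cont.aestronglyMeasurable hB).mul h_dens.aestronglyMeasurable) ?_
  filter_upwards [ae_restrict_mem hB] with x hx
  have h_nonneg : 0 ≤ dens x := sq_nonneg _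
  rw [norm_mul, Real.norm_eq_abs, Real.norm_of_nonneg h_nonneg, ← mul_assoc]
  gcongr
  exact hFK x hx (u x) (huL x hx)
end
end

section
/- Let f be a function of critical growth on 𝔹² and let u be an H¹(𝔹²)-function. Then for every p ∈ [1,∞), ∫_B |f(x,u(x))|^p dv_g < ∞. -/
open MeasureTheory Real Set Filter

noncomputable section

theorem exists_abs_lt_of_lintegral_ne_top {r x ε : ℝ} (hx : 0 ≤ x) (hxr : x < r) (hε : 0 < ε)
    (w : ℝ → ℝ)
    (hw : ∫⁻ s in Ioo x r, ENNReal.ofReal (w s ^ 2 * (2 / (r ^ 2 - s ^ 2)) ^ 2) ≠ ⊤) :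
    ∃ z ∈ Ioo x r, |w z| < ε := by
  by_contra! hcon
  have hr : 0 < r := hx.trans_lt hxr
  have key : ∀ s ∈ Ioo x r,
      ε ^ 2 / r ^ 3 * (r - s)⁻¹ ≤ w s ^ 2 * (2 / (r ^ 2 - s ^ 2)) ^ 2 := by
    intro s hs
    have h1 : 0 < r - s := by linarith [hs.2]
    have h2 : 0 < r + s := by linarith [hs.1]
    have h3 : ε ^ 2 ≤ w s ^ 2 := by
      rw [← sq_abs (w s)]
      exact pow_le_pow_left₀ hε.le (hcon s hs) 2
    have h4 : 1 / (r * (r - s)) ≤ 2 / (r ^ 2 - s ^ 2) := by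
      rw [show r ^ 2 - s ^ 2 = (r - s) * (r + s) by ring, div_le_div_iff₀ (by positivity)
        (by positivity)]
      nlinarith [hs.2]
    have h5 : 1 / (r ^ 3 * (r - s)) ≤ (1 / (r * (r - s))) ^ 2 := by
      rw [div_pow, one_pow]
      apply one_div_le_one_div_of_le (by positivity)
      have : r - s ≤ r := by linarith [hs.1]
      calc (r * (r - s)) ^ 2 = r ^ 2 * (r - s) * (r - s) := by ring
        _ ≤ r ^ 2 * (r - s) * r := by gcongr
        _ = _ := by ring
    calc ε ^ 2 / r ^ 3 * (r - s)⁻¹ = ε ^ 2 * (1 / (r ^ 3 * (r - s))) := by field_simp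
      _ ≤ w s ^ 2 * (2 / (r ^ 2 - s ^ 2)) ^ 2 := by
        gcongr
        exact h5.trans (pow_le_pow_left₀ (by positivity) h4 2)
  have hint : IntegrableOn (fun s => (s - r)⁻¹) (Ioo x r) := by
    have hI : IntegrableOn (fun s => ε ^ 2 / r ^ 3 * (r - s)⁻¹) (Ioo x r) := by
      refine ⟨by fun_prop, ?_⟩
      rw [hasFiniteIntegral_iff_ofReal]
      · refine lt_of_le_of_lt (setLIntegral_mono' measurableSet_Ioo fun s hs => ?_)
          (lt_top_iff_ne_top.2 hw)
        exact ENNReal.ofReal_le_ofReal (key s hs)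
      · refine (ae_restrict_iff' measurableSet_Ioo).2 (Eventually.of_forall fun s hs => ?_)
        have : 0 < r - s := by linarith [hs.2]
        simp only [Pi.zero_apply]
        positivity
    refine (hI.const_mul (-(r ^ 3 / ε ^ 2))).congr (Eventually.of_forall fun s => ?_)
    have : (s - r)⁻¹ = -(r - s)⁻¹ := by rw [← neg_sub, inv_neg]
    simp only [this]
    field_simp
  have := (intervalIntegrable_iff_integrableOn_Ioo_of_le hxr.le).2 hint
  rw [intervalIntegrable_sub_inv_iff] at this
  rcases this with h | h
  · exact hxr.ne h
  · exact h right_mem_uIcc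

theorem ofReal_mul_abs_le_lintegral_deriv_of_nonneg {r x : ℝ} (hx : 0 ≤ x) (hxr : x < r)
    (w : ℝ → ℝ) (hd : ∀ s ∈ Ico x r, DifferentiableAt ℝ w s)
    (hw : ∫⁻ s in Ioo x r, ENNReal.ofReal (w s ^ 2 * (2 / (r ^ 2 - s ^ 2)) ^ 2) ≠ ⊤) :
    ENNReal.ofReal (2 / (r ^ 2 - x ^ 2) * |w x|) ≤
      ∫⁻ s in Ioo x r, ENNReal.ofReal (2 / (r ^ 2 - s ^ 2) * |deriv w s|) := by
  set g : ℝ → ℝ := fun s => 2 / (r ^ 2 - s ^ 2) * |deriv w s| with hg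
  by_cases htop : ∫⁻ s in Ioo x r, ENNReal.ofReal (g s) = ⊤
  · rw [htop]; exact le_top
  have hx2 : 0 < r ^ 2 - x ^ 2 := by nlinarith
  have hpos : ∀ s ∈ Ico x r, 0 < r ^ 2 - s ^ 2 := by
    intro s hs
    nlinarith [hs.1, hs.2]
  have hmono : ∀ s ∈ Ico x r, 2 / (r ^ 2 - x ^ 2) ≤ 2 / (r ^ 2 - s ^ 2) := by
    intro s hs
    apply div_le_div_of_nonneg_left (by norm_num) (hpos s hs)
    nlinarith [hs.1]
  have hg0 : ∀ s ∈ Ico x r, 0 ≤ g s := fun s hs =>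
    mul_nonneg (div_nonneg (by norm_num) (hpos s hs).le) (abs_nonneg _)
  have hae : 0 ≤ᵐ[volume.restrict (Ioo x r)] g :=
    (ae_restrict_iff' measurableSet_Ioo).2
      (Eventually.of_forall fun s hs => hg0 s (Ioo_subset_Ico_self hs))
  have hmeas : Measurable (deriv w) := measurable_deriv w
  have hgint : IntegrableOn g (Ioo x r) := by
    refine ⟨Measurable.aestronglyMeasurable (by fun_prop), ?_⟩
    rw [hasFiniteIntegral_iff_ofReal hae]
    exact lt_top_iff_ne_top.2 htop
  rw [← ofReal_integral_eq_lintegral_ofReal hgint hae]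
  apply ENNReal.ofReal_le_ofReal
  apply le_of_forall_pos_le_add
  intro ε hε
  set c := 2 / (r ^ 2 - x ^ 2) with hc
  have hc0 : 0 < c := by positivity
  obtain ⟨z, hz, hwz⟩ := exists_abs_lt_of_lintegral_ne_top hx hxr (div_pos hε hc0) w hw
  have hsub : Ioc x z ⊆ Ioo x r := fun s hs => ⟨hs.1, hs.2.trans_lt hz.2⟩
  have hdi : IntegrableOn (deriv w) (Ioc x z) := by
    refine Integrable.mono' ((hgint.mono_set hsub).const_mul c⁻¹)
      hmeas.aestronglyMeasurable ?_
    refine (ae_restrict_iff' measurableSet_Ioc).2 (Eventually.of_forall fun s hs => ?_)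
    rw [Real.norm_eq_abs, ← div_eq_inv_mul, le_div_iff₀ hc0, mul_comm]
    exact mul_le_mul_of_nonneg_right (hmono s (Ioo_subset_Ico_self (hsub hs))) (abs_nonneg _)
  have hii : IntervalIntegrable (deriv w) volume x z :=
    (intervalIntegrable_iff_integrableOn_Ioc_of_le hz.1.le).2 hdi
  have hftc := intervalIntegral.integral_eq_sub_of_hasDerivAt (f := w) (f' := deriv w)
    (a := x) (b := z) (fun s hs => by
      rw [uIcc_of_le hz.1.le] at hs
      exact (hd s ⟨hs.1, hs.2.trans_lt hz.2⟩).hasDerivAt) hii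
  have h1 : |w x| ≤ |w z| + ∫ s in Ioc x z, |deriv w s| := by
    have h2 := intervalIntegral.abs_integral_le_integral_abs (f := deriv w) (μ := volume) hz.1.le
    rw [hftc, intervalIntegral.integral_of_le hz.1.le, abs_sub_comm] at h2
    linarith [abs_sub_abs_le_abs_sub (w x) (w z)]
  have h3 : c * ∫ s in Ioc x z, |deriv w s| ≤ ∫ s in Ioo x r, g s := by
    rw [← integral_const_mul]
    calc ∫ s in Ioc x z, c * |deriv w s| ≤ ∫ s in Ioc x z, g s := by
          refine setIntegral_mono_on (hdi.abs.const_mul c) (hgint.mono_set hsub)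
            measurableSet_Ioc fun s hs => ?_
          exact mul_le_mul_of_nonneg_right (hmono s (Ioo_subset_Ico_self (hsub hs)))
            (abs_nonneg _)
      _ ≤ _ := setIntegral_mono_set hgint hae (Eventually.of_forall hsub)
  have h4 : c * |w z| ≤ ε := by
    rw [lt_div_iff₀ hc0] at hwz
    linarith
  calc c * |w x| ≤ c * (|w z| + ∫ s in Ioc x z, |deriv w s|) := by gcongr
    _ = c * |w z| + c * ∫ s in Ioc x z, |deriv w s| := by ring
    _ ≤ _ := by linarith

theorem ofReal_mul_abs_le_lintegral_deriv {r x : ℝ} (hx : x ∈ Ioo (-r) r)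
    (w : ℝ → ℝ) (hd : ∀ s ∈ Ioo (-r) r, DifferentiableAt ℝ w s)
    (hw : ∫⁻ s in Ioo (-r) r, ENNReal.ofReal (w s ^ 2 * (2 / (r ^ 2 - s ^ 2)) ^ 2) ≠ ⊤) :
    ENNReal.ofReal (2 / (r ^ 2 - x ^ 2) * |w x|) ≤
      ∫⁻ s in Ioo (-r) r, ENNReal.ofReal (2 / (r ^ 2 - s ^ 2) * |deriv w s|) := by
  have hr : 0 < r := by linarith [hx.1, hx.2]
  rcases le_total 0 x with h0 | h0
  · have hsub : Ioo x r ⊆ Ioo (-r) r := Ioo_subset_Ioo_left hx.1.le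
    refine (ofReal_mul_abs_le_lintegral_deriv_of_nonneg h0 hx.2 w
      (fun s hs => hd s ⟨by linarith [hs.1], hs.2⟩)
      (ne_top_of_le_ne_top hw (lintegral_mono_set hsub))).trans (lintegral_mono_set hsub)
  · have hrefl : ∀ F : ℝ → ENNReal,
        ∫⁻ s in Ioo (-r) r, F (-s) = ∫⁻ s in Ioo (-r) r, F s := by
      intro F
      have := (Measure.measurePreserving_neg (volume : Measure ℝ)).setLIntegral_comp_preimage_emb
        (MeasurableEquiv.neg ℝ).measurableEmbedding F (Ioo (-r) r)
      simpa using this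
    have hsub : Ioo (-x) r ⊆ Ioo (-r) r := Ioo_subset_Ioo_left (by linarith [hx.2])
    have hw' : ∫⁻ s in Ioo (-r) r,
        ENNReal.ofReal (w (-s) ^ 2 * (2 / (r ^ 2 - s ^ 2)) ^ 2) ≠ ⊤ := by
      rw [← hrefl] at hw
      simpa only [neg_sq] using hw
    have := (ofReal_mul_abs_le_lintegral_deriv_of_nonneg (x := -x) (by linarith)
      (by linarith [hx.1]) (fun s => w (-s))
      (fun s hs => by
        refine DifferentiableAt.comp (g := w) (f := fun s => -s) s
          (hd (-s) ⟨by linarith [hs.2], by linarith [hs.1]⟩) (by fun_prop))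
      (ne_top_of_le_ne_top hw' (lintegral_mono_set hsub))).trans (lintegral_mono_set hsub)
    simp only [neg_neg, neg_sq, deriv_comp_neg, abs_neg] at this
    rw [← hrefl]
    simpa only [neg_sq] using this

theorem aemeasurable_indicator_ball_of_continuousOn {v : Pt → ℝ} (hv : ContinuousOn v B) :
    AEMeasurable (B.indicator fun x => ENNReal.ofReal (v x)) := by
  have hB : MeasurableSet B := measurableSet_ball
  exact (aemeasurable_indicator_iff hB).2 (hv.aemeasurable hB).ennreal_ofReal

theorem continuousOn_conformalFactor : ContinuousOn (fun x : Pt => 2 / (1 - ‖x‖ ^ 2)) B := by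
  refine ContinuousOn.div (by fun_prop) (by fun_prop) fun x hx => ?_
  have : ‖x‖ < 1 := by simpa [B] using hx
  nlinarith [norm_nonneg x]

theorem indicator_le_lintegral_line {v : Pt → ℝ} (hv : DifferentiableOn ℝ v B) {q e : Pt}
    (he : ‖e‖ = 1) (hqe : inner ℝ q e = 0)
    (hfin : ∫⁻ s : ℝ, B.indicator (fun y => ENNReal.ofReal (v y ^ 2 * dens y)) (q + s • e) ≠ ⊤)
    (x : ℝ) :
    B.indicator (fun y => ENNReal.ofReal (2 / (1 - ‖y‖ ^ 2) * |v y|)) (q + x • e) ≤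
      ∫⁻ s : ℝ, B.indicator
        (fun y => ENNReal.ofReal (2 / (1 - ‖y‖ ^ 2) * ‖fderiv ℝ v y‖)) (q + s • e) := by
  have hnorm : ∀ s : ℝ, ‖q + s • e‖ ^ 2 = ‖q‖ ^ 2 + s ^ 2 := by
    intro s
    rw [norm_add_sq_real, inner_smul_right, hqe, norm_smul, he, Real.norm_eq_abs]
    simp
  have hBiff : ∀ s : ℝ, q + s • e ∈ B ↔ ‖q‖ ^ 2 + s ^ 2 < 1 := by
    intro s
    rw [← hnorm, B, mem_ball_zero_iff, sq_lt_one_iff₀ (norm_nonneg _)]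
  by_cases hx : q + x • e ∈ B
  swap
  · simp [indicator_of_notMem hx]
  have hq : 0 < 1 - ‖q‖ ^ 2 := by nlinarith [(hBiff x).1 hx, sq_nonneg x]
  set r := √(1 - ‖q‖ ^ 2) with hr
  have hr2 : r ^ 2 = 1 - ‖q‖ ^ 2 := Real.sq_sqrt hq.le
  have hr0 : 0 < r := Real.sqrt_pos.2 hq
  have hIoo : ∀ s : ℝ, q + s • e ∈ B ↔ s ∈ Ioo (-r) r := by
    intro s
    rw [hBiff, mem_Ioo, ← abs_lt, ← sq_lt_sq₀ (abs_nonneg s) hr0.le, sq_abs, hr2]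
    constructor <;> intro h <;> linarith
  have hden : ∀ s : ℝ, 1 - ‖q + s • e‖ ^ 2 = r ^ 2 - s ^ 2 := by
    intro s
    rw [hnorm, hr2]; ring
  have hline : ∀ F : Pt → ENNReal, ∫⁻ s : ℝ, B.indicator F (q + s • e) =
      ∫⁻ s in Ioo (-r) r, F (q + s • e) := by
    intro F
    rw [← lintegral_indicator measurableSet_Ioo]
    congr 1
    ext s
    by_cases hs : q + s • e ∈ B
    · rw [indicator_of_mem hs, indicator_of_mem ((hIoo s).1 hs)]
    · rw [indicator_of_notMem hs, indicator_of_notMem (fun h => hs ((hIoo s).2 h))]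
  have hvd : ∀ s ∈ Ioo (-r) r, HasDerivAt (fun s : ℝ => v (q + s • e))
      (fderiv ℝ v (q + s • e) e) s := by
    intro s hs
    have h1 : HasFDerivAt v (fderiv ℝ v (q + s • e)) (q + s • e) :=
      (hv.differentiableAt (Metric.isOpen_ball.mem_nhds ((hIoo s).2 hs))).hasFDerivAt
    have h2 : HasDerivAt (fun s : ℝ => q + s • e) e s := by
      simpa using ((hasDerivAt_id s).smul_const e).const_add q
    exact h1.comp_hasDerivAt s h2
  rw [hline] at hfin ⊢
  rw [indicator_of_mem hx, hden]
  refine (ofReal_mul_abs_le_lintegral_deriv ((hIoo x).1 hx) (fun s => v (q + s • e))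
    (fun s hs => (hvd s hs).differentiableAt) ?_).trans ?_
  · simpa only [dens, hden] using hfin
  · refine setLIntegral_mono' measurableSet_Ioo fun s hs => ENNReal.ofReal_le_ofReal ?_
    rw [hden, (hvd s hs).deriv]
    have h3 : 0 ≤ r ^ 2 - s ^ 2 := by
      have := (hBiff s).1 ((hIoo s).2 hs)
      rw [hr2]; linarith
    refine mul_le_mul_of_nonneg_left ?_ (by positivity)
    simpa [he] using (fderiv ℝ v (q + s • e)).le_opNorm e

theorem measurePreserving_plane : MeasurePreserving (fun p : ℝ × ℝ =>
    (p.1 • EuclideanSpace.single 0 1 + p.2 • EuclideanSpace.single 1 1 : Pt)) := by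
  have h := (PiLp.volume_preserving_toLp (Fin 2)).comp
    ((volume_preserving_finTwoArrow ℝ).symm MeasurableEquiv.finTwoArrow)
  convert h using 1
  ext p i
  fin_cases i <;> simp

/-- The `L¹` Sobolev inequality of the hyperbolic disc. -/
theorem lintegral_sq_le_sq_lintegral_fderiv {v : Pt → ℝ} (hv : DifferentiableOn ℝ v B)
    (hfin : ∫⁻ x in B, ENNReal.ofReal (v x ^ 2 * dens x) ≠ ⊤) :
    ∫⁻ x in B, ENNReal.ofReal (v x ^ 2 * dens x) ≤
      (∫⁻ x in B, ENNReal.ofReal (2 / (1 - ‖x‖ ^ 2) * ‖fderiv ℝ v x‖)) ^ 2 := by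
  have hB : MeasurableSet B := measurableSet_ball
  set e₀ : Pt := EuclideanSpace.single 0 1 with he₀
  set e₁ : Pt := EuclideanSpace.single 1 1 with he₁
  have hn₀ : ‖e₀‖ = 1 := by simp [he₀]
  have hn₁ : ‖e₁‖ = 1 := by simp [he₁]
  have h01 : inner ℝ e₀ e₁ = 0 := by simp [he₀, he₁, EuclideanSpace.inner_single_left]
  set ψ : ℝ × ℝ → Pt := fun p => p.1 • e₀ + p.2 • e₁ with hψ
  have hψm : MeasurePreserving ψ := measurePreserving_plane
  set W : Pt → ENNReal := B.indicator fun y => ENNReal.ofReal (2 / (1 - ‖y‖ ^ 2) * |v y|)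
  set Φ : Pt → ENNReal := B.indicator fun y => ENNReal.ofReal (v y ^ 2 * dens y)
  set K : Pt → ENNReal :=
    B.indicator fun y => ENNReal.ofReal (2 / (1 - ‖y‖ ^ 2) * ‖fderiv ℝ v y‖)
  have hΦW : ∀ y, Φ y = W y * W y := by
    intro y
    by_cases hy : y ∈ B
    · have : 0 < 1 - ‖y‖ ^ 2 := by
        have : ‖y‖ < 1 := by simpa [B] using hy
        nlinarith [norm_nonneg y]
      simp only [Φ, W, indicator_of_mem hy]
      rw [← ENNReal.ofReal_mul (by positivity), dens, ← sq_abs (v y)]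
      congr 1
      ring
    · simp [Φ, W, indicator_of_notMem hy]
  have hΦ : AEMeasurable Φ := aemeasurable_indicator_ball_of_continuousOn
    ((hv.continuousOn.pow 2).mul (continuousOn_conformalFactor.pow 2))
  have hK : Measurable K := by
    refine Measurable.indicator (Measurable.ennreal_ofReal ?_) hB
    have := measurable_fderiv ℝ v
    fun_prop
  have hΦψ : AEMeasurable (fun p => Φ (ψ p)) (volume.prod volume) :=
    hΦ.comp_quasiMeasurePreserving hψm.quasiMeasurePreserving
  have hKψ : Measurable (fun p => K (ψ p)) := hK.comp hψm.measurable
  have hΦint : ∫⁻ p, Φ (ψ p) ∂(volume.prod volume) =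
      ∫⁻ x in B, ENNReal.ofReal (v x ^ 2 * dens x) := by
    rw [← lintegral_indicator hB]
    have h1 : AEMeasurable Φ (Measure.map ψ (volume.prod volume)) := by
      rwa [← Measure.volume_eq_prod, hψm.map_eq]
    rw [← lintegral_map' h1 hψm.measurable.aemeasurable, ← Measure.volume_eq_prod, hψm.map_eq]
  have hKint : ∫⁻ p, K (ψ p) ∂(volume.prod volume) =
      ∫⁻ x in B, ENNReal.ofReal (2 / (1 - ‖x‖ ^ 2) * ‖fderiv ℝ v x‖) := by
    rw [← lintegral_indicator hB]
    exact hψm.lintegral_comp hK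
  rw [← hΦint] at hfin
  rw [← hΦint, ← hKint]
  have hx : ∀ᵐ x : ℝ, ∀ y : ℝ, W (ψ (x, y)) ≤ ∫⁻ t, K (ψ (x, t)) := by
    have h1 := hfin
    rw [lintegral_prod _ hΦψ] at h1
    filter_upwards [ae_lt_top' hΦψ.lintegral_prod_right' h1] with x hx y
    have hq : inner ℝ (x • e₀) e₁ = 0 := by rw [inner_smul_left, h01, mul_zero]
    exact indicator_le_lintegral_line hv hn₁ hq hx.ne y
  have hy : ∀ᵐ y : ℝ, ∀ x : ℝ, W (ψ (x, y)) ≤ ∫⁻ s, K (ψ (s, y)) := by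
    have h1 := hfin
    rw [lintegral_prod_symm _ hΦψ] at h1
    filter_upwards [ae_lt_top' hΦψ.lintegral_prod_left' h1] with y hy x
    have h2 : ∀ s : ℝ, ψ (s, y) = y • e₁ + s • e₀ := fun s => add_comm _ _
    simp only [h2] at hy ⊢
    have hq : inner ℝ (y • e₁) e₀ = 0 := by
      rw [inner_smul_left, real_inner_comm, h01, mul_zero]
    exact indicator_le_lintegral_line hv hn₀ hq hy.ne x
  have hA : Measurable fun y : ℝ => ∫⁻ s : ℝ, K (ψ (s, y)) := hKψ.lintegral_prod_left'
  have hA' : Measurable fun x : ℝ => ∫⁻ t : ℝ, K (ψ (x, t)) := hKψ.lintegral_prod_right'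
  calc ∫⁻ p, Φ (ψ p) ∂(volume.prod volume) = ∫⁻ x, ∫⁻ y, Φ (ψ (x, y)) := lintegral_prod _ hΦψ
    _ ≤ ∫⁻ x : ℝ, ∫⁻ y : ℝ, (∫⁻ t, K (ψ (x, t))) * ∫⁻ s, K (ψ (s, y)) := by
      refine lintegral_mono_ae ?_
      filter_upwards [hx] with x hx
      refine lintegral_mono_ae ?_
      filter_upwards [hy] with y hy
      rw [hΦW]
      exact mul_le_mul' (hx y) (hy x)
    _ = ∫⁻ x : ℝ, (∫⁻ t, K (ψ (x, t))) * ∫⁻ y : ℝ, ∫⁻ s, K (ψ (s, y)) := by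
      congr 1
      ext x
      exact lintegral_const_mul _ hA
    _ = (∫⁻ p, K (ψ p) ∂(volume.prod volume)) ^ 2 := by
      rw [lintegral_mul_const _ hA', sq]
      congr 1
      · exact (lintegral_prod _ hKψ.aemeasurable).symm
      · exact (lintegral_prod_symm _ hKψ.aemeasurable).symm

theorem le_exp_neg_of_succ_le_mul {m e : ℕ → ℝ} {D : ℝ} (hD : 0 < D) (hm : ∀ j, 0 ≤ m j)
    (he : ∀ j, 0 ≤ e j) (hs : Summable e)
    (hrec : ∀ j : ℕ, 1 ≤ j → m (j + 1) ≤ D * (j + 1) * e j * m j) (β : ℝ) :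
    ∃ C : ℝ, ∃ J : ℕ, ∀ n : ℕ, J ≤ n → m n ≤ C * exp (-β * n) := by
  obtain ⟨J, hJ1, hJ⟩ : ∃ J : ℕ, 1 ≤ J ∧ ∀ n, D * exp β * ∑ j ∈ Finset.Ico J n, e j ≤ 1 := by
    have h0 := (tendsto_sum_nat_add e).const_mul (D * exp β)
    rw [mul_zero] at h0
    obtain ⟨J, h1, h2⟩ := ((h0.eventually (gt_mem_nhds one_pos)).and (eventually_ge_atTop 1)).exists
    refine ⟨J, h2, fun n => le_trans ?_ h1.le⟩
    refine mul_le_mul_of_nonneg_left ?_ (by positivity)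
    rw [Finset.sum_Ico_eq_sum_range]
    simp only [add_comm J]
    exact ((summable_nat_add_iff J).2 hs).sum_le_tsum _ fun i _ => he _
  have hprod : ∀ n, J ≤ n → m n ≤ m J * ∏ j ∈ Finset.Ico J n, (D * (j + 1) * e j) := by
    intro n hn
    induction n, hn using Nat.le_induction with
    | base => simp
    | succ n hn ih =>
      rw [Finset.prod_Ico_succ_top hn]
      have h1 : 0 ≤ D * (n + 1) * e n := mul_nonneg (by positivity) (he n)
      calc m (n + 1) ≤ D * (n + 1) * e n * m n := hrec n (hJ1.trans hn)
        _ ≤ D * (n + 1) * e n * (m J * ∏ j ∈ Finset.Ico J n, (D * (j + 1) * e j)) := by gcongr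
        _ = _ := by ring
  refine ⟨m J * exp ((β + 1) * J), J, fun n hn => (hprod n hn).trans ?_⟩
  rw [mul_assoc, ← Real.exp_add]
  refine mul_le_mul_of_nonneg_left ?_ (hm J)
  calc ∏ j ∈ Finset.Ico J n, (D * (j + 1) * e j)
      ≤ ∏ j ∈ Finset.Ico J n, exp (D * exp β * n * e j - (β + 1)) := by
        refine Finset.prod_le_prod (fun j _ => mul_nonneg (by positivity) (he j)) fun j hj => ?_
        have hj : (j : ℝ) + 1 ≤ n := by exact_mod_cast (Finset.mem_Ico.1 hj).2
        have h1 : D * exp β * n * e j ≤ exp (D * exp β * n * e j - 1) := by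
          linarith [Real.add_one_le_exp (D * exp β * n * e j - 1)]
        calc D * (j + 1) * e j ≤ D * n * e j := by gcongr; exact he j
          _ = exp (-β) * (D * exp β * n * e j) := by rw [Real.exp_neg]; field_simp
          _ ≤ exp (-β) * exp (D * exp β * n * e j - 1) := by gcongr
          _ = _ := by rw [← Real.exp_add]; ring_nf
    _ = exp (n * (D * exp β * ∑ j ∈ Finset.Ico J n, e j) - (β + 1) * (n - J)) := by
        rw [← Real.exp_sum, Finset.sum_sub_distrib, ← Finset.mul_sum, Finset.sum_const,
          Nat.card_Ico, nsmul_eq_mul, Nat.cast_sub hn]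
        ring_nf
    _ ≤ _ := by
        apply Real.exp_le_exp.2
        have := mul_le_mul_of_nonneg_left (hJ n) (Nat.cast_nonneg (α := ℝ) n)
        linarith

theorem deriv_smoothTransition_eq_zero {s : ℝ} (hs : s ∉ Ioo (0 : ℝ) 1) :
    deriv Real.smoothTransition s = 0 := by
  rcases not_and_or.1 hs with h | h
  · refine IsLocalMin.deriv_eq_zero (Eventually.of_forall fun t => ?_)
    rw [Real.smoothTransition.zero_of_nonpos (not_lt.1 h)]
    exact Real.smoothTransition.nonneg t
  · refine IsLocalMax.deriv_eq_zero (Eventually.of_forall fun t => ?_)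
    rw [Real.smoothTransition.one_of_one_le (not_lt.1 h)]
    exact Real.smoothTransition.le_one t

theorem exists_abs_deriv_smoothTransition_le :
    ∃ M : ℝ, 0 < M ∧ ∀ s, |deriv Real.smoothTransition s| ≤ M := by
  have hc : Continuous (deriv Real.smoothTransition) :=
    (Real.smoothTransition.contDiff (n := 1)).continuous_deriv le_rfl
  obtain ⟨M, hM⟩ := isCompact_Icc.exists_bound_of_continuousOn (s := Icc (0 : ℝ) 1) hc.continuousOn
  refine ⟨max M 1, by positivity, fun s => ?_⟩
  by_cases hs : s ∈ Icc (0 : ℝ) 1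
  · exact (hM s hs).trans (le_max_left _ _)
  · rw [deriv_smoothTransition_eq_zero fun h => hs (Ioo_subset_Icc_self h)]
    simp

theorem sq_lintegral_mul_le {X : Type*} [MeasurableSpace X] {μ : Measure X} {f g : X → ENNReal}
    (hf : AEMeasurable f μ) (hg : AEMeasurable g μ) :
    (∫⁻ x, f x * g x ∂μ) ^ 2 ≤ (∫⁻ x, f x ^ 2 ∂μ) * ∫⁻ x, g x ^ 2 ∂μ := by
  have h := ENNReal.lintegral_mul_le_Lp_mul_Lq μ Real.HolderConjugate.two_two hf hg
  have hsq : ∀ a : ENNReal, (a ^ (1 / 2 : ℝ)) ^ 2 = a := by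
    intro a
    rw [← ENNReal.rpow_natCast, ← ENNReal.rpow_mul]
    norm_num
  have h2 := pow_le_pow_left₀ (zero_le (a := _)) h 2
  rw [mul_pow, hsq, hsq] at h2
  simpa using h2

theorem measurableSet_ball_inter_preimage {u : Pt → ℝ} (hu : ContinuousOn u B) {A : Set ℝ}
    (hA : MeasurableSet A) : MeasurableSet (B ∩ u ⁻¹' A) := by
  classical
  have hB : MeasurableSet B := measurableSet_ball
  have h : Measurable (B.piecewise u 0) := hu.measurable_piecewise continuousOn_const hB
  have : B ∩ u ⁻¹' A = B ∩ (B.piecewise u 0) ⁻¹' A := by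
    ext x
    simp only [mem_inter_iff, mem_preimage, and_congr_right_iff]
    intro hx
    rw [piecewise_eq_of_mem _ _ _ hx]
  rw [this]
  exact hB.inter (h hA)

/-- The part of the disc where `j ≤ u²`. -/
def superlevel (u : Pt → ℝ) (j : ℕ) : Set Pt := B ∩ u ⁻¹' {t | (j : ℝ) ≤ t ^ 2}

/-- The part of the disc where `j ≤ u² < j + 1`. -/
def band (u : Pt → ℝ) (j : ℕ) : Set Pt := B ∩ u ⁻¹' {t | (j : ℝ) ≤ t ^ 2 ∧ t ^ 2 < j + 1}

theorem measurableSet_superlevel {u : Pt → ℝ} (hu : ContinuousOn u B) (j : ℕ) :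
    MeasurableSet (superlevel u j) :=
  measurableSet_ball_inter_preimage hu (measurableSet_le (by fun_prop) (by fun_prop))

theorem measurableSet_band {u : Pt → ℝ} (hu : ContinuousOn u B) (j : ℕ) :
    MeasurableSet (band u j) :=
  measurableSet_ball_inter_preimage hu
    ((measurableSet_Ico (a := (j : ℝ)) (b := j + 1)).preimage
      (by fun_prop : Measurable fun t : ℝ => t ^ 2))

theorem band_subset_superlevel (u : Pt → ℝ) (j : ℕ) : band u j ⊆ superlevel u j :=
  fun _ hx => ⟨hx.1, hx.2.1⟩

theorem lintegral_superlevel_succ_le {M : ℝ} (hM0 : 0 < M)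
    (hM : ∀ s, |deriv Real.smoothTransition s| ≤ M) {u : Pt → ℝ} (hu : DifferentiableOn ℝ u B)
    (hfin : ∫⁻ x in B, ENNReal.ofReal (u x ^ 2 * dens x) ≠ ⊤) {j : ℕ} (hj : 1 ≤ j) :
    ∫⁻ x in superlevel u (j + 1), ENNReal.ofReal (dens x) ≤
      ENNReal.ofReal (4 * M ^ 2 * (j + 1)) *
        (∫⁻ x in band u j, ENNReal.ofReal (‖fderiv ℝ u x‖ ^ 2)) *
        ∫⁻ x in superlevel u j, ENNReal.ofReal (dens x) := by
  have hB : MeasurableSet B := measurableSet_ball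
  have hj' : (1 : ℝ) ≤ j := by exact_mod_cast hj
  have hdens : ∀ x, 0 ≤ dens x := fun x => sq_nonneg _
  have hρ : ∀ x ∈ B, 0 ≤ 2 / (1 - ‖x‖ ^ 2) := by
    intro x hx
    have : ‖x‖ < 1 := by simpa [B] using hx
    have : 0 < 1 - ‖x‖ ^ 2 := by nlinarith [norm_nonneg x]
    positivity
  set v : Pt → ℝ := fun x => Real.smoothTransition (u x ^ 2 - j) with hv
  have hvB : ∀ x ∈ B, HasFDerivAt v
      (deriv Real.smoothTransition (u x ^ 2 - j) • ((2 * u x) • fderiv ℝ u x)) x := by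
    intro x hx
    have h1 : HasFDerivAt u (fderiv ℝ u x) x :=
      (hu.differentiableAt (Metric.isOpen_ball.mem_nhds hx)).hasFDerivAt
    have h2 : HasFDerivAt (fun x => u x ^ 2 - j) ((2 * u x) • fderiv ℝ u x) x := by
      simpa using (h1.pow 2).sub_const (j : ℝ)
    have h3 : HasDerivAt Real.smoothTransition (deriv Real.smoothTransition (u x ^ 2 - j))
        (u x ^ 2 - j) :=
      ((Real.smoothTransition.contDiff (n := 1)).differentiable one_ne_zero _).hasDerivAt
    exact h3.comp_hasFDerivAt x h2
  have hvu : ∀ x, v x ^ 2 ≤ u x ^ 2 := by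
    intro x
    rcases le_total (u x ^ 2) j with h | h
    · simp only [hv]
      rw [Real.smoothTransition.zero_of_nonpos (by linarith)]
      nlinarith [sq_nonneg (u x)]
    · have h1 : v x ^ 2 ≤ 1 := by
        have := Real.smoothTransition.le_one (u x ^ 2 - j)
        have := Real.smoothTransition.nonneg (u x ^ 2 - j)
        simp only [hv]
        nlinarith
      linarith
  have hvfin : ∫⁻ x in B, ENNReal.ofReal (v x ^ 2 * dens x) ≠ ⊤ :=
    ne_top_of_le_ne_top hfin (lintegral_mono fun x =>
      ENNReal.ofReal_le_ofReal (mul_le_mul_of_nonneg_right (hvu x) (hdens x)))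
  have hsob := lintegral_sq_le_sq_lintegral_fderiv
    (fun x hx => (hvB x hx).differentiableAt.differentiableWithinAt) hvfin
  have hlow : ∫⁻ x in superlevel u (j + 1), ENNReal.ofReal (dens x) ≤
      ∫⁻ x in B, ENNReal.ofReal (v x ^ 2 * dens x) := by
    calc ∫⁻ x in superlevel u (j + 1), ENNReal.ofReal (dens x)
        ≤ ∫⁻ x in superlevel u (j + 1), ENNReal.ofReal (v x ^ 2 * dens x) := by
          refine setLIntegral_mono' (measurableSet_superlevel hu.continuousOn _) fun x hx => ?_
          have h1 : ((j + 1 : ℕ) : ℝ) ≤ u x ^ 2 := hx.2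
          push_cast at h1
          have : v x = 1 := Real.smoothTransition.one_of_one_le (by linarith)
          rw [this, one_pow, one_mul]
      _ ≤ _ := lintegral_mono_set inter_subset_left
  set c : ℝ := 2 * M * √(j + 1) with hc
  have hc0 : 0 ≤ c := by positivity
  have hup : ∫⁻ x in B, ENNReal.ofReal (2 / (1 - ‖x‖ ^ 2) * ‖fderiv ℝ v x‖) ≤
      ENNReal.ofReal c * ∫⁻ x in band u j,
        ENNReal.ofReal (2 / (1 - ‖x‖ ^ 2)) * ENNReal.ofReal ‖fderiv ℝ u x‖ := by
    rw [← lintegral_const_mul' _ _ ENNReal.ofReal_ne_top, ← lintegral_indicator hB,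
      ← lintegral_indicator (measurableSet_band hu.continuousOn j)]
    refine lintegral_mono fun x => ?_
    by_cases hx : x ∈ B
    swap
    · simp [indicator_of_notMem hx]
    rw [indicator_of_mem hx, (hvB x hx).fderiv, norm_smul, norm_smul, Real.norm_eq_abs,
      Real.norm_eq_abs]
    by_cases hxb : x ∈ band u j
    · rw [indicator_of_mem hxb, ← ENNReal.ofReal_mul (hρ x hx), ← ENNReal.ofReal_mul hc0]
      apply ENNReal.ofReal_le_ofReal
      have hux : |u x| ≤ √(j + 1) := by
        rw [← Real.sqrt_sq_eq_abs]
        exact Real.sqrt_le_sqrt hxb.2.2.le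
      have h1 : |2 * u x| ≤ 2 * √(j + 1) := by
        rw [abs_mul, abs_two]; gcongr
      have h2 : |deriv Real.smoothTransition (u x ^ 2 - j)| * (|2 * u x| * ‖fderiv ℝ u x‖) ≤
          M * (2 * √(j + 1) * ‖fderiv ℝ u x‖) := by
        gcongr
        exact hM _
      calc _ ≤ 2 / (1 - ‖x‖ ^ 2) * (M * (2 * √(j + 1) * ‖fderiv ℝ u x‖)) :=
            mul_le_mul_of_nonneg_left h2 (hρ x hx)
        _ = _ := by rw [hc]; ring
    · rw [deriv_smoothTransition_eq_zero]
      · simp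
      · intro h
        exact hxb ⟨hx, by linarith [h.1], by linarith [h.2]⟩
  have hband := measurableSet_band hu.continuousOn j
  have hcs := sq_lintegral_mul_le (μ := volume.restrict (band u j))
    (f := fun x : Pt => ENNReal.ofReal (2 / (1 - ‖x‖ ^ 2)))
    (g := fun x => ENNReal.ofReal ‖fderiv ℝ u x‖) (by fun_prop)
    ((measurable_fderiv ℝ u).norm.ennreal_ofReal.aemeasurable)
  have e1 : ∫⁻ x in band u j, ENNReal.ofReal (2 / (1 - ‖x‖ ^ 2)) ^ 2 ≤
      ∫⁻ x in superlevel u j, ENNReal.ofReal (dens x) := by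
    refine le_trans ?_ (lintegral_mono_set (band_subset_superlevel u j))
    refine setLIntegral_mono' hband fun x hx => ?_
    rw [← ENNReal.ofReal_pow (hρ x hx.1), dens]
  have e2 : ∫⁻ x in band u j, ENNReal.ofReal ‖fderiv ℝ u x‖ ^ 2 =
      ∫⁻ x in band u j, ENNReal.ofReal (‖fderiv ℝ u x‖ ^ 2) := by
    simp_rw [ENNReal.ofReal_pow (norm_nonneg _)]
  have hcsq : ENNReal.ofReal c ^ 2 = ENNReal.ofReal (4 * M ^ 2 * (j + 1)) := by
    rw [← ENNReal.ofReal_pow hc0, hc, mul_pow, mul_pow, Real.sq_sqrt (by positivity)]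
    norm_num
  calc _ ≤ _ := hlow.trans hsob
    _ ≤ (ENNReal.ofReal c * ∫⁻ x in band u j,
        ENNReal.ofReal (2 / (1 - ‖x‖ ^ 2)) * ENNReal.ofReal ‖fderiv ℝ u x‖) ^ 2 := by gcongr
    _ ≤ ENNReal.ofReal (4 * M ^ 2 * (j + 1)) *
        ((∫⁻ x in superlevel u j, ENNReal.ofReal (dens x)) *
          ∫⁻ x in band u j, ENNReal.ofReal (‖fderiv ℝ u x‖ ^ 2)) := by
        rw [mul_pow, hcsq, ← e2]
        gcongr
        exact hcs.trans (by gcongr)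
    _ = _ := by ring

theorem lintegral_sq_mul_dens_ne_top {u : Pt → ℝ} (hu : IsH1 u) :
    ∫⁻ x in B, ENNReal.ofReal (u x ^ 2 * dens x) ≠ ⊤ :=
  hu.2.2.lintegral_lt_top.ne

theorem tsum_lintegral_band_ne_top {u : Pt → ℝ} (hu : IsH1 u) :
    (∑' j, ∫⁻ x in band u j, ENNReal.ofReal (‖fderiv ℝ u x‖ ^ 2)) ≠ ⊤ := by
  have hdisj : Pairwise (Function.onFun Disjoint (band u)) := by
    intro i j hij
    refine Set.disjoint_left.2 fun x hi hj => hij ?_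
    have h1 : (i : ℝ) < j + 1 := hi.2.1.trans_lt hj.2.2
    have h2 : (j : ℝ) < i + 1 := hj.2.1.trans_lt hi.2.2
    have h3 : i < j + 1 := by exact_mod_cast h1
    have h4 : j < i + 1 := by exact_mod_cast h2
    omega
  rw [← lintegral_iUnion (measurableSet_band hu.1.continuousOn) hdisj]
  refine ne_top_of_le_ne_top ?_ (lintegral_mono_set (iUnion_subset fun j => inter_subset_left))
  have h := hu.2.1.lintegral_lt_top.ne
  simpa only [gradient, LinearIsometryEquiv.norm_map] using h

theorem lintegral_superlevel_ne_top {u : Pt → ℝ} (hu : IsH1 u) {j : ℕ} (hj : 1 ≤ j) :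
    ∫⁻ x in superlevel u j, ENNReal.ofReal (dens x) ≠ ⊤ := by
  refine ne_top_of_le_ne_top (lintegral_sq_mul_dens_ne_top hu) ?_
  refine le_trans (setLIntegral_mono' (measurableSet_superlevel hu.1.continuousOn j)
    fun x hx => ENNReal.ofReal_le_ofReal ?_) (lintegral_mono_set inter_subset_left)
  have h1 : (j : ℝ) ≤ u x ^ 2 := hx.2
  have h2 : (1 : ℝ) ≤ j := by exact_mod_cast hj
  exact le_mul_of_one_le_left (sq_nonneg _) (h2.trans h1)

/-- The superlevel sets of an `H¹` function have Gaussian decay of every order. -/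
theorem superlevel_gaussian_decay {u : Pt → ℝ} (hu : IsH1 u) (β : ℝ) :
    ∃ C : ℝ, ∃ J : ℕ, ∀ n : ℕ, J ≤ n →
      (∫⁻ x in superlevel u n, ENNReal.ofReal (dens x)).toReal ≤ C * exp (-β * n) := by
  obtain ⟨M, hM0, hM⟩ := exists_abs_deriv_smoothTransition_le
  have hsum := tsum_lintegral_band_ne_top hu
  refine le_exp_neg_of_succ_le_mul (D := 4 * M ^ 2) (by positivity)
    (fun _ => ENNReal.toReal_nonneg) (fun _ => ENNReal.toReal_nonneg)
    (ENNReal.summable_toReal hsum) (fun j hj => ?_) β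
  have h := lintegral_superlevel_succ_le hM0 hM hu.1 (lintegral_sq_mul_dens_ne_top hu) hj
  have h2 := ENNReal.toReal_mono (ENNReal.mul_ne_top (ENNReal.mul_ne_top ENNReal.ofReal_ne_top
    (ENNReal.ne_top_of_tsum_ne_top hsum j)) (lintegral_superlevel_ne_top hu hj)) h
  rwa [ENNReal.toReal_mul, ENNReal.toReal_mul, ENNReal.toReal_ofReal (by positivity)] at h2

/-- A Moser–Trudinger inequality: `exp (α u²)` is integrable where `1 ≤ u²`. -/
theorem lintegral_exp_sq_ne_top {u : Pt → ℝ} (hu : IsH1 u) {α : ℝ} (hα : 0 ≤ α) :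
    ∫⁻ x in superlevel u 1, ENNReal.ofReal (exp (α * u x ^ 2) * dens x) ≠ ⊤ := by
  set m : ℕ → ENNReal := fun n => ∫⁻ x in superlevel u n, ENNReal.ofReal (dens x) with hm
  have hcover : superlevel u 1 ⊆ ⋃ n : ℕ, band u (n + 1) := by
    intro x hx
    have h1 : ((1 : ℕ) : ℝ) ≤ u x ^ 2 := hx.2
    have h2 : 1 ≤ ⌊u x ^ 2⌋₊ := Nat.le_floor h1
    refine mem_iUnion.2 ⟨⌊u x ^ 2⌋₊ - 1, hx.1, ?_⟩
    rw [Nat.sub_add_cancel h2]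
    exact ⟨Nat.floor_le (sq_nonneg _), Nat.lt_floor_add_one _⟩
  have hband : ∀ n : ℕ, ∫⁻ x in band u (n + 1), ENNReal.ofReal (exp (α * u x ^ 2) * dens x) ≤
      ENNReal.ofReal (exp (α * (n + 2)) * (m (n + 1)).toReal) := by
    intro n
    rw [ENNReal.ofReal_mul (exp_nonneg _),
      ENNReal.ofReal_toReal (lintegral_superlevel_ne_top hu (by omega)),
      ← lintegral_const_mul' _ _ ENNReal.ofReal_ne_top]
    refine le_trans (setLIntegral_mono' (measurableSet_band hu.1.continuousOn _) fun x hx => ?_)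
      (lintegral_mono_set (band_subset_superlevel u _))
    rw [← ENNReal.ofReal_mul (exp_nonneg _)]
    apply ENNReal.ofReal_le_ofReal
    have h1 : u x ^ 2 < ((n + 1 : ℕ) : ℝ) + 1 := hx.2.2
    push_cast at h1
    refine mul_le_mul_of_nonneg_right (Real.exp_le_exp.2 ?_) (sq_nonneg _)
    exact mul_le_mul_of_nonneg_left (by linarith) hα
  have hsum : Summable fun n : ℕ => exp (α * (n + 2)) * (m (n + 1)).toReal := by
    obtain ⟨C, J, hC⟩ := superlevel_gaussian_decay hu (α + 1)
    refine Summable.of_norm_bounded_eventually_nat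
      (Real.summable_exp_neg_nat.mul_left (C * exp (α - 1))) ?_
    filter_upwards [eventually_ge_atTop J] with n hn
    have h1 := hC (n + 1) (by omega)
    rw [Real.norm_of_nonneg (mul_nonneg (exp_nonneg _) ENNReal.toReal_nonneg)]
    calc exp (α * (n + 2)) * (m (n + 1)).toReal
        ≤ exp (α * (n + 2)) * (C * exp (-(α + 1) * (n + 1 : ℕ))) := by gcongr
      _ = C * (exp (α * (n + 2)) * exp (-(α + 1) * (n + 1 : ℕ))) := by ring
      _ = C * (exp (α - 1) * exp (-n)) := by
        rw [← Real.exp_add, ← Real.exp_add]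
        push_cast
        ring_nf
      _ = _ := by ring
  refine ne_top_of_le_ne_top hsum.tsum_ofReal_ne_top ?_
  calc _ ≤ _ := lintegral_mono_set hcover
    _ ≤ _ := lintegral_iUnion_le _ _
    _ ≤ _ := ENNReal.tsum_le_tsum hband

theorem CriticalGrowth.abs_fn_abs {lam : ℝ} {h : Pt → ℝ → ℝ} (hf : CriticalGrowth lam h)
    {x : Pt} (hx : x ∈ B) (t : ℝ) : |fn lam h x (|t|)| = |fn lam h x t| := by
  rcases abs_choice t with ht | ht
  · rw [ht]
  · rw [ht, hf.f_odd x hx, abs_neg]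

theorem CriticalGrowth.exists_rpow_bound {lam : ℝ} {h : Pt → ℝ → ℝ} (hf : CriticalGrowth lam h)
    {p : ℝ} (hp : 1 ≤ p) :
    ∃ C α : ℝ, 0 ≤ C ∧ 0 ≤ α ∧ ∀ x ∈ B, ∀ t : ℝ, |fn lam h x t| ^ p ≤ C * t ^ 2 ∨
      (1 ≤ t ^ 2 ∧ |fn lam h x t| ^ p ≤ exp (α * t ^ 2)) := by
  have hlam := hf.lam_pos
  obtain ⟨T, hT⟩ := hf.h_sup 1 one_pos 1 one_pos
  set L := max T 1 with hL
  have hL0 : 0 < L := by positivity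
  obtain ⟨C₀, hC₀⟩ := hf.h_bdd L hL0
  set A := |C₀| * (lam * exp (lam * L ^ 2)) with hA
  have hA0 : 0 ≤ A := by positivity
  refine ⟨(A * L ^ 2) ^ p / L ^ 2, p * (1 + lam), by positivity, by positivity,
    fun x hx t => ?_⟩
  rcases le_total |t| L with ht | ht
  · left
    have htL : t ^ 2 ≤ L ^ 2 := by
      rw [← sq_abs t]; gcongr
    have hexp : |exp (lam * t ^ 2) - 1| ≤ lam * exp (lam * L ^ 2) * t ^ 2 := by
      have h0 : 0 ≤ lam * t ^ 2 := by positivity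
      rw [abs_of_nonneg (by linarith [Real.add_one_le_exp (lam * t ^ 2)])]
      have h1 : exp (lam * t ^ 2) - 1 ≤ lam * t ^ 2 * exp (lam * t ^ 2) := by
        have h2 := mul_le_mul_of_nonneg_left (Real.add_one_le_exp (-(lam * t ^ 2)))
          (exp_nonneg (lam * t ^ 2))
        rw [← Real.exp_add, add_neg_cancel, Real.exp_zero] at h2
        linarith
      calc _ ≤ lam * t ^ 2 * exp (lam * t ^ 2) := h1
        _ ≤ lam * t ^ 2 * exp (lam * L ^ 2) := by gcongr
        _ = _ := by ring
    have hs1 : t ^ 2 / L ^ 2 ≤ 1 := div_le_one_of_le₀ htL (by positivity)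
    calc |fn lam h x t| ^ p ≤ (A * L ^ 2 * (t ^ 2 / L ^ 2)) ^ p := by
          refine Real.rpow_le_rpow (abs_nonneg _) ?_ (by linarith)
          rw [fn, abs_mul, mul_assoc A, mul_div_cancel₀ _ (by positivity), hA, mul_assoc]
          exact mul_le_mul ((hC₀ x hx t ht).trans (le_abs_self _)) hexp (abs_nonneg _)
            (abs_nonneg _)
      _ = (A * L ^ 2) ^ p * (t ^ 2 / L ^ 2) ^ p :=
          Real.mul_rpow (by positivity) (by positivity)
      _ ≤ (A * L ^ 2) ^ p * (t ^ 2 / L ^ 2) := by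
          gcongr
          simpa using Real.rpow_le_rpow_of_exponent_ge' (by positivity) hs1 zero_le_one hp
      _ = _ := by ring
  · right
    have h1t : 1 ≤ |t| := (le_max_right _ _).trans ht
    refine ⟨by rw [← sq_abs]; nlinarith, ?_⟩
    have hpos := hf.f_pos x hx |t| (by linarith)
    have hsup := hT |t| ((le_max_left _ _).trans ht) x hx
    rw [sq_abs] at hsup
    have hh : h x |t| ≤ exp (t ^ 2) := by
      have h2 := mul_le_mul_of_nonneg_right hsup.le (exp_nonneg (t ^ 2))
      rw [mul_assoc, ← Real.exp_add] at h2
      simpa using h2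
    have hE : 0 ≤ exp (lam * t ^ 2) - 1 := by
      have : 0 ≤ lam * t ^ 2 := by positivity
      linarith [Real.add_one_le_exp (lam * t ^ 2)]
    have hbound : |fn lam h x t| ≤ exp ((1 + lam) * t ^ 2) := by
      rw [← hf.abs_fn_abs hx, abs_of_pos hpos, fn, sq_abs]
      calc h x |t| * (exp (lam * t ^ 2) - 1) ≤ exp (t ^ 2) * (exp (lam * t ^ 2) - 1) := by gcongr
        _ ≤ exp (t ^ 2) * exp (lam * t ^ 2) := by gcongr; linarith
        _ = _ := by rw [← Real.exp_add]; ring_nf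
    calc |fn lam h x t| ^ p ≤ exp ((1 + lam) * t ^ 2) ^ p :=
          Real.rpow_le_rpow (abs_nonneg _) hbound (by linarith)
      _ = _ := by rw [← Real.exp_mul]; ring_nf

/-- If `f` is a function of critical growth on `𝔹²` and `u ∈ H¹(𝔹²)`, then
`f(·, u(·)) ∈ Lᵖ(B, dv_g)` for every `p ∈ [1, ∞)`. -/
theorem stmt11 (lam : ℝ) (h : Pt → ℝ → ℝ) (hf : CriticalGrowth lam h)
    (u : Pt → ℝ) (hu : IsH1 u) :
    ∀ p : ℝ, 1 ≤ p → HIntegrable (fun x => |fn lam h x (u x)| ^ p) := by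
  intro p hp
  have hB : MeasurableSet B := measurableSet_ball
  have hdens : ∀ x, 0 ≤ dens x := fun x => sq_nonneg _
  have huc : ContinuousOn u B := hu.1.continuousOn
  obtain ⟨C, α, hC, hα, hbound⟩ := hf.exists_rpow_bound hp
  have hcont : ContinuousOn (fun x => |fn lam h x (u x)| ^ p * dens x) B := by
    have h1 : ContinuousOn (fun x => h x (u x)) B :=
      hf.h_C1.continuous.comp_continuousOn (continuousOn_id.prodMk huc)
    have h2 : ContinuousOn (fun x => fn lam h x (u x)) B := by
      exact h1.mul (by fun_prop)
    exact (h2.abs.rpow_const fun _ _ => Or.inr (by linarith)).mul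
      (continuousOn_conformalFactor.pow 2)
  refine ⟨hcont.aestronglyMeasurable hB, ?_⟩
  have hsup := measurableSet_superlevel huc 1
  rw [hasFiniteIntegral_iff_ofReal (Eventually.of_forall fun x =>
    mul_nonneg (Real.rpow_nonneg (abs_nonneg _) _) (hdens x))]
  have hle : ∫⁻ x in B, ENNReal.ofReal (|fn lam h x (u x)| ^ p * dens x) ≤
      ∫⁻ x in B, (ENNReal.ofReal C * ENNReal.ofReal (u x ^ 2 * dens x) +
        (superlevel u 1).indicator
          (fun x => ENNReal.ofReal (exp (α * u x ^ 2) * dens x)) x) := by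
    refine setLIntegral_mono' hB fun x hx => ?_
    rcases hbound x hx (u x) with h1 | ⟨h0, h1⟩
    · refine le_add_right ?_
      rw [← ENNReal.ofReal_mul hC, ← mul_assoc]
      exact ENNReal.ofReal_le_ofReal (mul_le_mul_of_nonneg_right h1 (hdens x))
    · refine le_add_left ?_
      have hmem : x ∈ superlevel u 1 := ⟨hx, by simpa using h0⟩
      rw [indicator_of_mem hmem]
      exact ENNReal.ofReal_le_ofReal (mul_le_mul_of_nonneg_right h1 (hdens x))
  refine hle.trans_lt ?_
  have hmeas : AEMeasurable (fun x => ENNReal.ofReal C * ENNReal.ofReal (u x ^ 2 * dens x))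
      (volume.restrict B) :=
    (((huc.pow 2).mul
      (continuousOn_conformalFactor.pow 2)).aemeasurable hB).ennreal_ofReal.const_mul _
  rw [lintegral_add_left' hmeas, lintegral_const_mul' _ _ ENNReal.ofReal_ne_top]
  refine ENNReal.add_lt_top.2 ⟨ENNReal.mul_lt_top ENNReal.ofReal_lt_top
    (lintegral_sq_mul_dens_ne_top hu).lt_top, ?_⟩
  refine lt_of_le_of_lt (setLIntegral_le_lintegral B _) ?_
  rw [lintegral_indicator hsup]
  exact (lintegral_exp_sq_ne_top hu hα).lt_top
end
end

section
/- Let f be a function of critical growth on 𝔹². Then: (a) for every H¹(𝔹²)-function u, I_λ(u) ≥ 0, and I_λ(u) = 0 if and only if u = 0 almost everywhere on B; (b) for every ε > 0 there exists a constant C₀(ε) > 0 such that for every H¹_R(𝔹²)-function u, ∫_B f(x,u(x))u(x) dv_g ≤ C₀(ε)(1 + I_λ(u)) + ε ‖u‖². -/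
open MeasureTheory Real Set Filter

noncomputable section

open scoped Topology

theorem tendsto_zero_of_integrable_deriv {c : ℝ} (hc : 0 < c) {f f' : ℝ → ℝ}
    (hd : ∀ x ∈ Ioo (-c) c, HasDerivAt f (f' x) x) (hi : IntegrableOn f' (Ioo (-c) c))
    (hw : IntegrableOn (fun x => f x * (2 / (c ^ 2 - x ^ 2))) (Ioo (-c) c)) :
    Tendsto f (𝓝[<] c) (𝓝 0) := by
  have hii : IntervalIntegrable f' volume 0 c := by
    rw [intervalIntegrable_iff_integrableOn_Ioo_of_le hc.le]
    exact hi.mono_set (Ioo_subset_Ioo_left (by linarith))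
  have hlim : Tendsto f (𝓝[<] c) (𝓝 (f 0 + ∫ t in (0:ℝ)..c, f' t)) := by
    have h1 : Tendsto (fun x => f 0 + ∫ t in (0:ℝ)..x, f' t) (𝓝[<] c)
        (𝓝 (f 0 + ∫ t in (0:ℝ)..c, f' t)) := by
      have h2 := intervalIntegral.continuousOn_primitive_interval
        (μ := volume) (f := f') (a := 0) (b := c) (by
          rwa [uIcc_of_le hc.le, integrableOn_Icc_iff_integrableOn_Ioc,
            ← intervalIntegrable_iff_integrableOn_Ioc_of_le hc.le])
      have h3 := (h2 c right_mem_uIcc).tendsto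
      refine Tendsto.const_add _ (h3.mono_left ?_)
      rw [uIcc_of_le hc.le]
      exact nhdsWithin_le_of_mem (Icc_mem_nhdsLT hc)
    refine h1.congr' ?_
    filter_upwards [Ioo_mem_nhdsLT hc] with x hx
    rw [intervalIntegral.integral_eq_sub_of_hasDerivAt]
    · ring
    · intro y hy
      rw [uIcc_of_le hx.1.le] at hy
      exact hd y ⟨by linarith [hy.1], by linarith [hy.2, hx.2]⟩
    · exact hii.mono_set (by rw [uIcc_of_le hx.1.le, uIcc_of_le hc.le]; exact Icc_subset_Icc_right hx.2.le)
  set L := f 0 + ∫ t in (0:ℝ)..c, f' t with hL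
  by_cases hL0 : L = 0
  · rwa [hL0] at hlim
  exfalso
  have hLp : 0 < |L| := abs_pos.mpr hL0
  have hev : ∀ᶠ x in 𝓝[<] c, |L| / 2 < |f x| :=
    (hlim.abs).eventually (lt_mem_nhds (by linarith))
  obtain ⟨a, ha, hsub⟩ := (mem_nhdsLT_iff_exists_Ioo_subset' hc).1
    (inter_mem hev (Ioo_mem_nhdsLT hc))
  have hac : a < c := ha
  set b := max a 0
  have hbc : b < c := max_lt hac hc
  have hint : IntegrableOn (fun x => (x - c)⁻¹) (Ioo b c) := by
    have h4 : IntegrableOn (fun x => f x * (2 / (c ^ 2 - x ^ 2))) (Ioo b c) :=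
      hw.mono_set (Ioo_subset_Ioo_left (by linarith [le_max_right a 0]))
    refine Integrable.mono' ((h4.norm).const_mul (2 * c / |L|)) ?_ ?_
    · exact (measurable_id.sub_const c).inv.aestronglyMeasurable
    · refine (ae_restrict_iff' measurableSet_Ioo).2 (ae_of_all _ fun x hx => ?_)
      have hx0 : 0 < x := lt_of_le_of_lt (le_max_right a 0) hx.1
      have hfx : |L| / 2 < |f x| := (hsub ⟨lt_of_le_of_lt (le_max_left a 0) hx.1, hx.2⟩).1
      have hcx : 0 < c - x := by linarith [hx.2]
      have hq : c ^ 2 - x ^ 2 = (c - x) * (c + x) := by ring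
      have hcx' : 0 < c + x := by linarith
      rw [norm_mul, Real.norm_eq_abs, Real.norm_eq_abs, Real.norm_eq_abs, abs_inv,
        abs_sub_comm, abs_of_pos hcx, hq, abs_of_pos (by positivity : 0 < 2 / ((c - x) * (c + x)))]
      calc (c - x)⁻¹ = 2 * c / |L| * (|L| / 2 * (1 / (c * (c - x)))) := by
            field_simp
        _ ≤ 2 * c / |L| * (|f x| * (2 / ((c - x) * (c + x)))) := by
            gcongr ?_ * (?_ * ?_)
            rw [div_le_div_iff₀ (by positivity) (by positivity)]
            nlinarith [mul_pos hc hcx, hx.2]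
  have : IntervalIntegrable (fun x => (x - c)⁻¹) volume b c :=
    (intervalIntegrable_iff_integrableOn_Ioo_of_le hbc.le).2 hint
  rw [intervalIntegrable_sub_inv_iff] at this
  rcases this with h | h
  · exact hbc.ne h
  · exact h right_mem_uIcc

theorem integral_deriv_eq_zero_and_bound {c : ℝ} (hc : 0 < c) {f f' : ℝ → ℝ}
    (hd : ∀ x ∈ Ioo (-c) c, HasDerivAt f (f' x) x) (hi : IntegrableOn f' (Ioo (-c) c))
    (hw : IntegrableOn (fun x => f x * (2 / (c ^ 2 - x ^ 2))) (Ioo (-c) c)) :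
    ∫ x in Ioo (-c) c, f' x = 0 ∧ ∀ x ∈ Ioo (-c) c, |f x| ≤ ∫ t in Ioo (-c) c, |f' t| := by
  have hr := tendsto_zero_of_integrable_deriv hc hd hi hw
  have hcc : -c < c := by linarith
  have hneg : ∀ x : ℝ, x ∈ Ioo (-c) c → -x ∈ Ioo (-c) c := fun x hx =>
    ⟨by linarith [hx.2], by linarith [hx.1]⟩
  have hpre : (Neg.neg : ℝ → ℝ) ⁻¹' Ioo (-c) c = Ioo (-c) c := by
    simp
  have hcomp : ∀ g : ℝ → ℝ, IntegrableOn g (Ioo (-c) c) →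
      IntegrableOn (fun x => g (-x)) (Ioo (-c) c) := fun g hg => by
    have := ((Measure.measurePreserving_neg (volume : Measure ℝ)).integrableOn_comp_preimage
      (Homeomorph.neg ℝ).measurableEmbedding (f := g) (s := Ioo (-c) c)).2 hg
    rwa [hpre] at this
  have hl' : Tendsto (fun x => f (-x)) (𝓝[<] c) (𝓝 0) := by
    refine tendsto_zero_of_integrable_deriv hc (f' := fun x => -f' (-x)) ?_ (hcomp f' hi).neg ?_
    · intro x hx
      simpa [Function.comp_def] using (hd (-x) (hneg x hx)).comp x (hasDerivAt_neg x)
    · simpa using hcomp _ hw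
  have hl : Tendsto f (𝓝[>] (-c)) (𝓝 0) := by
    have h5 : Tendsto (fun x : ℝ => -x) (𝓝[>] (-c)) (𝓝[<] c) := by
      simpa using tendsto_neg_nhdsGT (a := -c)
    simpa [Function.comp_def] using hl'.comp h5
  have hI : IntervalIntegrable f' volume (-c) c :=
    (intervalIntegrable_iff_integrableOn_Ioo_of_le hcc.le).2 hi
  constructor
  · have := intervalIntegral.integral_eq_sub_of_hasDerivAt_of_tendsto hcc hd hI hl hr
    rwa [intervalIntegral.integral_of_le hcc.le, integral_Ioc_eq_integral_Ioo, sub_zero] at this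
  · intro x hx
    have h1 : IntegrableOn f' (Ioo x c) := hi.mono_set (Ioo_subset_Ioo_left hx.1.le)
    have := intervalIntegral.integral_eq_sub_of_hasDerivAt_of_tendsto hx.2
      (fun y hy => hd y ⟨hx.1.trans hy.1, hy.2⟩)
      ((intervalIntegrable_iff_integrableOn_Ioo_of_le hx.2.le).2 h1)
      ((hd x hx).continuousAt.tendsto.mono_left nhdsWithin_le_nhds) hr
    rw [intervalIntegral.integral_of_le hx.2.le, integral_Ioc_eq_integral_Ioo, zero_sub] at this
    calc |f x| = |∫ t in Ioo x c, f' t| := by rw [this, abs_neg]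
      _ ≤ ∫ t in Ioo x c, |f' t| := abs_integral_le_integral_abs
      _ ≤ _ := setIntegral_mono_set hi.abs (ae_of_all _ fun _ => abs_nonneg _)
          (Ioo_subset_Ioo_left hx.1.le).eventuallyLE

/-- The open unit disc in the product coordinates of the plane. -/
def prodDisc : Set (ℝ × ℝ) := {z | z.1 ^ 2 + z.2 ^ 2 < 1}

theorem isOpen_prodDisc : IsOpen prodDisc :=
  isOpen_lt (by fun_prop) continuous_const

theorem prodDisc_indicator_slice (q : ℝ × ℝ → ℝ) (y : ℝ) :
    (fun s => prodDisc.indicator q (s, y)) =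
      (Ioo (-√(1 - y ^ 2)) (√(1 - y ^ 2))).indicator fun s => q (s, y) := by
  ext s
  have : (s, y) ∈ prodDisc ↔ s ∈ Ioo (-√(1 - y ^ 2)) (√(1 - y ^ 2)) := by
    rw [mem_Ioo, ← abs_lt, Real.lt_sqrt (abs_nonneg s), sq_abs]
    simp only [prodDisc, mem_ofPred_eq]
    constructor <;> intro h <;> linarith
  by_cases h : (s, y) ∈ prodDisc
  · rw [indicator_of_mem h, indicator_of_mem (this.1 h)]
  · rw [indicator_of_notMem h, indicator_of_notMem fun h' => h (this.2 h')]

theorem prodDisc_slice_fst {G p : ℝ × ℝ → ℝ}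
    (hd : ∀ z ∈ prodDisc, HasDerivAt (fun s => G (s, z.2)) (p z) z.1)
    (hp : IntegrableOn p prodDisc)
    (hw : IntegrableOn (fun z => G z * (2 / (1 - (z.1 ^ 2 + z.2 ^ 2)))) prodDisc) :
    ∫ z in prodDisc, p z = 0 ∧
      ∀ᵐ y : ℝ, ∀ x, (x, y) ∈ prodDisc →
        |G (x, y)| ≤ ∫ s, prodDisc.indicator (fun z => |p z|) (s, y) := by
  have hm := isOpen_prodDisc.measurableSet
  have hp' : Integrable (prodDisc.indicator p) (volume.prod volume) :=
    (integrable_indicator_iff hm).2 hp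
  have hw' : Integrable (prodDisc.indicator
      (fun z => G z * (2 / (1 - (z.1 ^ 2 + z.2 ^ 2))))) (volume.prod volume) :=
    (integrable_indicator_iff hm).2 hw
  have key : ∀ᵐ y : ℝ, ∫ s, prodDisc.indicator p (s, y) = 0 ∧ ∀ x, (x, y) ∈ prodDisc →
      |G (x, y)| ≤ ∫ s, prodDisc.indicator (fun z => |p z|) (s, y) := by
    filter_upwards [hp'.prod_left_ae, hw'.prod_left_ae] with y h1 h2
    rw [prodDisc_indicator_slice, integrable_indicator_iff measurableSet_Ioo] at h1 h2
    simp only [prodDisc_indicator_slice]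
    rw [integral_indicator measurableSet_Ioo, integral_indicator measurableSet_Ioo]
    set c := √(1 - y ^ 2) with hc
    have hmem : ∀ x, (x, y) ∈ prodDisc ↔ x ∈ Ioo (-c) c := fun x => by
      rw [mem_Ioo, ← abs_lt, Real.lt_sqrt (abs_nonneg x), sq_abs]
      simp only [prodDisc, mem_ofPred_eq]
      constructor <;> intro h <;> linarith
    rcases (Real.sqrt_nonneg (1 - y ^ 2)).eq_or_lt with h0 | h0
    · have hc0 : c = 0 := h0.symm
      simp [hmem, hc0]
    · have hy : 0 < 1 - y ^ 2 := Real.sqrt_pos.1 h0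
      have hcs : c ^ 2 = 1 - y ^ 2 := Real.sq_sqrt hy.le
      obtain ⟨h3, h4⟩ := integral_deriv_eq_zero_and_bound (c := c) h0
        (f := fun s => G (s, y)) (f' := fun s => p (s, y))
        (fun x hx => hd (x, y) ((hmem x).2 hx)) h1 (by
          refine h2.congr_fun (fun x _ => ?_) measurableSet_Ioo
          simp only [hcs]
          congr 2
          ring)
      exact ⟨h3, fun x hx => h4 x ((hmem x).1 hx)⟩
  refine ⟨?_, key.mono fun y hy => hy.2⟩
  rw [← integral_indicator hm, Measure.volume_eq_prod, integral_prod_symm _ hp']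
  rw [integral_congr_ae (key.mono fun y hy => hy.1)]
  simp

theorem prodDisc_slice_snd {G q : ℝ × ℝ → ℝ}
    (hd : ∀ z ∈ prodDisc, HasDerivAt (fun s => G (z.1, s)) (q z) z.2)
    (hq : IntegrableOn q prodDisc)
    (hw : IntegrableOn (fun z => G z * (2 / (1 - (z.1 ^ 2 + z.2 ^ 2)))) prodDisc) :
    ∫ z in prodDisc, q z = 0 ∧
      ∀ᵐ x : ℝ, ∀ y, (x, y) ∈ prodDisc →
        |G (x, y)| ≤ ∫ s, prodDisc.indicator (fun z => |q z|) (x, s) := by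
  have hpre : Prod.swap ⁻¹' prodDisc = prodDisc := by
    ext z
    simp [prodDisc, add_comm]
  have hmp : MeasurePreserving (Prod.swap : ℝ × ℝ → ℝ × ℝ) :=
    Measure.measurePreserving_swap
  have hme : MeasurableEmbedding (Prod.swap : ℝ × ℝ → ℝ × ℝ) :=
    MeasurableEquiv.prodComm.measurableEmbedding
  have hio : ∀ g : ℝ × ℝ → ℝ, IntegrableOn g prodDisc →
      IntegrableOn (g ∘ Prod.swap) prodDisc := fun g hg => by
    have := (hmp.integrableOn_comp_preimage hme (f := g) (s := prodDisc)).2 hg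
    rwa [hpre] at this
  have hsw : ∀ z : ℝ × ℝ, z.swap ∈ prodDisc ↔ z ∈ prodDisc := fun z => by
    rw [← mem_preimage, hpre]
  obtain ⟨h1, h2⟩ := prodDisc_slice_fst (G := G ∘ Prod.swap) (p := q ∘ Prod.swap)
    (fun z hz => hd z.swap ((hsw z).2 hz)) (hio q hq) (by
      simpa [Function.comp_def, add_comm] using hio _ hw)
  constructor
  · have := hmp.setIntegral_preimage_emb hme q prodDisc
    rw [hpre] at this
    exact this.symm.trans h1
  · filter_upwards [h2] with x hx y hy
    refine (hx y ((hsw (x, y)).2 hy)).trans_eq ?_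
    congr 1
    ext s
    have : (s, x) ∈ prodDisc ↔ (x, s) ∈ prodDisc := hsw (x, s)
    by_cases h : (x, s) ∈ prodDisc
    · rw [indicator_of_mem h, indicator_of_mem (this.2 h)]
      rfl
    · rw [indicator_of_notMem h, indicator_of_notMem fun h' => h (this.1 h')]

theorem prodDisc_integral_sq_le {G p q : ℝ × ℝ → ℝ}
    (hd : ∀ z ∈ prodDisc, HasDerivAt (fun s => G (s, z.2)) (p z) z.1)
    (hd' : ∀ z ∈ prodDisc, HasDerivAt (fun s => G (z.1, s)) (q z) z.2)
    (hp : IntegrableOn p prodDisc) (hq : IntegrableOn q prodDisc)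
    (hw : IntegrableOn (fun z => G z * (2 / (1 - (z.1 ^ 2 + z.2 ^ 2)))) prodDisc) :
    ∫ z in prodDisc, G z ^ 2 ≤ (∫ z in prodDisc, |p z|) * ∫ z in prodDisc, |q z| := by
  have hm := isOpen_prodDisc.measurableSet
  have h1 := (prodDisc_slice_fst hd hp hw).2
  have h2 := (prodDisc_slice_snd hd' hq hw).2
  have hp' : Integrable (prodDisc.indicator fun z => |p z|) (volume.prod volume) :=
    (integrable_indicator_iff hm).2 hp.abs
  have hq' : Integrable (prodDisc.indicator fun z => |q z|) (volume.prod volume) :=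
    (integrable_indicator_iff hm).2 hq.abs
  rw [← integral_indicator hm, ← integral_indicator hm, ← integral_indicator hm]
  rw [Measure.volume_eq_prod, integral_prod_symm _ hp', integral_prod _ hq', mul_comm,
    ← integral_prod_mul]
  refine integral_mono_of_nonneg (ae_of_all _ fun z => indicator_nonneg (fun _ _ => sq_nonneg _) z)
    (hq'.integral_prod_left.mul_prod hp'.integral_prod_right) ?_
  have h1' : ∀ᵐ z : ℝ × ℝ ∂(volume.prod volume), ∀ x, (x, z.2) ∈ prodDisc →
        |G (x, z.2)| ≤ ∫ s, prodDisc.indicator (fun z => |p z|) (s, z.2) :=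
    Measure.quasiMeasurePreserving_snd.ae h1
  have h2' : ∀ᵐ z : ℝ × ℝ ∂(volume.prod volume), ∀ y, (z.1, y) ∈ prodDisc →
        |G (z.1, y)| ≤ ∫ s, prodDisc.indicator (fun z => |q z|) (z.1, s) :=
    Measure.quasiMeasurePreserving_fst.ae h2
  filter_upwards [h1', h2'] with z hz1 hz2
  by_cases hz : z ∈ prodDisc
  · rw [indicator_of_mem hz, ← sq_abs, sq]
    exact mul_le_mul (hz2 z.2 hz) (hz1 z.1 hz) (abs_nonneg _) ((abs_nonneg _).trans (hz2 z.2 hz))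
  · rw [indicator_of_notMem hz]
    exact mul_nonneg (integral_nonneg fun s => indicator_nonneg (fun _ _ => abs_nonneg _) _)
      (integral_nonneg fun s => indicator_nonneg (fun _ _ => abs_nonneg _) _)

/-- The product coordinates of the plane. -/
def ofCoords (z : ℝ × ℝ) : Pt := !₂[z.1, z.2]

/-- The square root `2 / (1 - |x|²)` of the hyperbolic density. -/
def rho (x : Pt) : ℝ := 2 / (1 - ‖x‖ ^ 2)

theorem dens_eq_rho_sq (x : Pt) : dens x = rho x ^ 2 := rfl

theorem isOpen_B : IsOpen B := Metric.isOpen_ball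

theorem measurableSet_B : MeasurableSet B := isOpen_B.measurableSet

theorem norm_sq_lt_one {x : Pt} (hx : x ∈ B) : ‖x‖ ^ 2 < 1 := by
  have : ‖x‖ < 1 := by simpa [B] using hx
  nlinarith [norm_nonneg x]

theorem two_le_rho {x : Pt} (hx : x ∈ B) : 2 ≤ rho x := by
  have := norm_sq_lt_one hx
  rw [rho, le_div_iff₀ (by linarith)]
  nlinarith [sq_nonneg ‖x‖]

theorem rho_pos {x : Pt} (hx : x ∈ B) : 0 < rho x := by linarith [two_le_rho hx]

theorem dens_pos {x : Pt} (hx : x ∈ B) : 0 < dens x := by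
  rw [dens_eq_rho_sq]
  exact pow_pos (rho_pos hx) 2

theorem hasFDerivAt_rho {x : Pt} (hx : x ∈ B) :
    HasFDerivAt rho (rho x ^ 2 • innerSL ℝ x) x := by
  have h1 := norm_sq_lt_one hx
  have h2 : HasFDerivAt (fun y : Pt => 1 - ‖y‖ ^ 2) (-(2 • innerSL ℝ x)) x :=
    (hasStrictFDerivAt_norm_sq x).hasFDerivAt.const_sub 1
  have h3 := ((hasDerivAt_inv (by linarith : 1 - ‖x‖ ^ 2 ≠ 0)).comp_hasFDerivAt x h2).const_mul 2
  have h4 : rho = fun y => 2 * (Inv.inv ∘ fun y : Pt => 1 - ‖y‖ ^ 2) y := by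
    ext y
    simp [rho, div_eq_mul_inv]
  rw [h4]
  refine h3.congr_fderiv ?_
  ext v
  have : 1 - ‖x‖ ^ 2 ≠ 0 := by linarith
  simp
  field_simp

theorem differentiableOn_rho : DifferentiableOn ℝ rho B := fun _ hx =>
  (hasFDerivAt_rho hx).differentiableAt.differentiableWithinAt

theorem norm_fderiv_rho_le {x : Pt} (hx : x ∈ B) : ‖fderiv ℝ rho x‖ ≤ rho x ^ 2 := by
  rw [(hasFDerivAt_rho hx).fderiv, norm_smul, innerSL_apply_norm, Real.norm_eq_abs,
    abs_of_nonneg (sq_nonneg _)]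
  have : ‖x‖ ≤ 1 := by nlinarith [norm_sq_lt_one hx, norm_nonneg x]
  nlinarith [sq_nonneg (rho x)]

theorem norm_ofCoords_sq (z : ℝ × ℝ) : ‖ofCoords z‖ ^ 2 = z.1 ^ 2 + z.2 ^ 2 := by
  simp [ofCoords, EuclideanSpace.norm_sq_eq]

theorem measurePreserving_ofCoords : MeasurePreserving ofCoords :=
  ((EuclideanSpace.volume_preserving_symm_measurableEquiv_toLp (Fin 2)).symm).comp
    ((volume_preserving_finTwoArrow ℝ).symm)

theorem measurableEmbedding_ofCoords : MeasurableEmbedding ofCoords :=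
  (MeasurableEquiv.finTwoArrow.symm.trans
    (MeasurableEquiv.toLp 2 (Fin 2 → ℝ))).measurableEmbedding

theorem preimage_ofCoords_B : ofCoords ⁻¹' B = prodDisc := by
  ext z
  have h : ofCoords z ∈ B ↔ ‖ofCoords z‖ < 1 := by simp [B]
  rw [mem_preimage, h, ← sq_lt_one_iff₀ (norm_nonneg _), norm_ofCoords_sq]
  rfl

theorem integrableOn_comp_ofCoords {g : Pt → ℝ} (hg : IntegrableOn g B) :
    IntegrableOn (fun z => g (ofCoords z)) prodDisc := by
  have := (measurePreserving_ofCoords.integrableOn_comp_preimage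
    measurableEmbedding_ofCoords (f := g) (s := B)).2 hg
  rwa [preimage_ofCoords_B] at this

theorem setIntegral_comp_ofCoords (g : Pt → ℝ) :
    ∫ z in prodDisc, g (ofCoords z) = ∫ x in B, g x := by
  have := measurePreserving_ofCoords.setIntegral_preimage_emb measurableEmbedding_ofCoords g B
  rwa [preimage_ofCoords_B] at this

theorem hasDerivAt_ofCoords_fst (z : ℝ × ℝ) :
    HasDerivAt (fun s => ofCoords (s, z.2)) (EuclideanSpace.single 0 1) z.1 := by
  have h : (fun s : ℝ => ofCoords (s, z.2)) =
      fun s => s • EuclideanSpace.single (0 : Fin 2) (1 : ℝ) + ofCoords (0, z.2) := by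
    ext s i
    fin_cases i <;> simp [ofCoords]
  rw [h]
  simpa using ((hasDerivAt_id z.1).smul_const
    (EuclideanSpace.single (0 : Fin 2) (1 : ℝ))).add_const (ofCoords (0, z.2))

theorem hasDerivAt_ofCoords_snd (z : ℝ × ℝ) :
    HasDerivAt (fun s => ofCoords (z.1, s)) (EuclideanSpace.single 1 1) z.2 := by
  have h : (fun s : ℝ => ofCoords (z.1, s)) =
      fun s => s • EuclideanSpace.single (1 : Fin 2) (1 : ℝ) + ofCoords (z.1, 0) := by
    ext s i
    fin_cases i <;> simp [ofCoords]
  rw [h]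
  simpa using ((hasDerivAt_id z.2).smul_const
    (EuclideanSpace.single (1 : Fin 2) (1 : ℝ))).add_const (ofCoords (z.1, 0))

theorem integrableOn_fderiv_apply {G : Pt → ℝ}
    (hi : IntegrableOn (fun x => ‖fderiv ℝ G x‖) B) (i : Fin 2) :
    IntegrableOn (fun x => fderiv ℝ G x (EuclideanSpace.single i 1)) B := by
  refine hi.mono' (measurable_fderiv_apply_const ℝ G _).aestronglyMeasurable
    (ae_of_all _ fun x => ?_)
  simpa using (fderiv ℝ G x).le_opNorm (EuclideanSpace.single i 1)

theorem hasDerivAt_comp_ofCoords {G : Pt → ℝ} (hd : DifferentiableOn ℝ G B) :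
    (∀ z ∈ prodDisc, HasDerivAt (fun s => G (ofCoords (s, z.2)))
      (fderiv ℝ G (ofCoords z) (EuclideanSpace.single 0 1)) z.1) ∧
    ∀ z ∈ prodDisc, HasDerivAt (fun s => G (ofCoords (z.1, s)))
      (fderiv ℝ G (ofCoords z) (EuclideanSpace.single 1 1)) z.2 := by
  have hz' : ∀ z ∈ prodDisc, HasFDerivAt G (fderiv ℝ G (ofCoords z)) (ofCoords z) :=
    fun z hz => (hd.differentiableAt (isOpen_B.mem_nhds (by
      rwa [← mem_preimage, preimage_ofCoords_B]))).hasFDerivAt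
  exact ⟨fun z hz => (hz' z hz).comp_hasDerivAt z.1 (hasDerivAt_ofCoords_fst z),
    fun z hz => (hz' z hz).comp_hasDerivAt z.2 (hasDerivAt_ofCoords_snd z)⟩

theorem integral_fderiv_apply_eq_zero {G : Pt → ℝ} (hd : DifferentiableOn ℝ G B)
    (hi : IntegrableOn (fun x => ‖fderiv ℝ G x‖) B)
    (hw : IntegrableOn (fun x => G x * rho x) B) (i : Fin 2) :
    ∫ x in B, fderiv ℝ G x (EuclideanSpace.single i 1) = 0 := by
  have hw' := integrableOn_comp_ofCoords hw
  simp only [rho, norm_ofCoords_sq] at hw'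
  obtain ⟨h1, h2⟩ := hasDerivAt_comp_ofCoords hd
  rw [← setIntegral_comp_ofCoords]
  have hp := integrableOn_comp_ofCoords (integrableOn_fderiv_apply hi i)
  fin_cases i
  · exact (prodDisc_slice_fst (G := fun z => G (ofCoords z)) h1 hp hw').1
  · exact (prodDisc_slice_snd (G := fun z => G (ofCoords z)) h2 hp hw').1

theorem integral_sq_le_sq_integral_norm_fderiv {G : Pt → ℝ} (hd : DifferentiableOn ℝ G B)
    (hi : IntegrableOn (fun x => ‖fderiv ℝ G x‖) B)
    (hw : IntegrableOn (fun x => G x * rho x) B) :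
    ∫ x in B, G x ^ 2 ≤ (∫ x in B, ‖fderiv ℝ G x‖) ^ 2 := by
  have hw' := integrableOn_comp_ofCoords hw
  simp only [rho, norm_ofCoords_sq] at hw'
  obtain ⟨h1, h2⟩ := hasDerivAt_comp_ofCoords hd
  have hp := fun i => integrableOn_comp_ofCoords (integrableOn_fderiv_apply hi i)
  have h3 := prodDisc_integral_sq_le (G := fun z => G (ofCoords z)) h1 h2 (hp 0) (hp 1) hw'
  rw [setIntegral_comp_ofCoords fun x => G x ^ 2,
    setIntegral_comp_ofCoords fun x => |fderiv ℝ G x (EuclideanSpace.single 0 1)|,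
    setIntegral_comp_ofCoords fun x => |fderiv ℝ G x (EuclideanSpace.single 1 1)|] at h3
  have h4 : ∀ i : Fin 2, ∫ x in B, |fderiv ℝ G x (EuclideanSpace.single i 1)| ≤
      ∫ x in B, ‖fderiv ℝ G x‖ := fun i =>
    integral_mono (integrableOn_fderiv_apply hi i).abs hi fun x => by
      simpa using (fderiv ℝ G x).le_opNorm (EuclideanSpace.single i 1)
  rw [sq]
  exact h3.trans (mul_le_mul (h4 0) (h4 1) (integral_nonneg fun _ => abs_nonneg _)
    (integral_nonneg fun _ => norm_nonneg _))

theorem aestronglyMeasurable_of_differentiableOn {G : Pt → ℝ} (hd : DifferentiableOn ℝ G B) :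
    AEStronglyMeasurable G (volume.restrict B) :=
  hd.continuousOn.aestronglyMeasurable measurableSet_B

theorem aestronglyMeasurable_rho : AEStronglyMeasurable rho (volume.restrict B) :=
  aestronglyMeasurable_of_differentiableOn differentiableOn_rho

/-- An inhomogeneous Sobolev inequality `W^{1,1} → L²` on the hyperbolic disc. -/
theorem hyperbolic_sobolev {w : Pt → ℝ} (hd : DifferentiableOn ℝ w B)
    (hi : IntegrableOn (fun x => ‖fderiv ℝ w x‖ * rho x) B)
    (hw : IntegrableOn (fun x => |w x| * dens x) B) :
    ∫ x in B, w x ^ 2 * dens x ≤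
      ((∫ x in B, ‖fderiv ℝ w x‖ * rho x) + ∫ x in B, |w x| * dens x) ^ 2 := by
  have hdw : DifferentiableOn ℝ (fun x => w x * rho x) B := hd.mul differentiableOn_rho
  have hbd : ∀ x ∈ B, ‖fderiv ℝ (fun x => w x * rho x) x‖ ≤
      ‖fderiv ℝ w x‖ * rho x + |w x| * dens x := fun x hx => by
    have h1 := hd.differentiableAt (isOpen_B.mem_nhds hx)
    rw [(h1.hasFDerivAt.fun_mul (hasFDerivAt_rho hx)).fderiv,
      ← (hasFDerivAt_rho hx).fderiv]
    refine (norm_add_le _ _).trans ?_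
    rw [norm_smul, norm_smul, Real.norm_eq_abs, Real.norm_eq_abs, abs_of_pos (rho_pos hx),
      dens_eq_rho_sq, add_comm, mul_comm (rho x)]
    gcongr
    exact norm_fderiv_rho_le hx
  have hsum : IntegrableOn (fun x => ‖fderiv ℝ w x‖ * rho x + |w x| * dens x) B := hi.add hw
  have hae := (ae_restrict_iff' (μ := volume) measurableSet_B).2 (ae_of_all _ hbd)
  have hi' : IntegrableOn (fun x => ‖fderiv ℝ (fun x => w x * rho x) x‖) B := by
    refine hsum.mono' (measurable_fderiv ℝ _).norm.aestronglyMeasurable ?_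
    simpa using hae
  have h := integral_sq_le_sq_integral_norm_fderiv hdw hi' (by
    refine hw.mono' (hdw.continuousOn.mul
      differentiableOn_rho.continuousOn |>.aestronglyMeasurable measurableSet_B) ?_
    refine (ae_restrict_iff' measurableSet_B).2 (ae_of_all _ fun x hx => ?_)
    rw [norm_mul, norm_mul, Real.norm_eq_abs, Real.norm_eq_abs, abs_of_pos (rho_pos hx),
      dens_eq_rho_sq]
    exact le_of_eq (by ring))
  simp only [mul_pow, ← dens_eq_rho_sq] at h
  refine h.trans ?_
  rw [← integral_add hi hw]
  exact pow_le_pow_left₀ (integral_nonneg fun _ => norm_nonneg _)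
    (integral_mono_ae hi' hsum hae) 2

/-- The Poincaré inequality on the hyperbolic disc. -/
theorem hyperbolic_poincare {u : Pt → ℝ} (hd : DifferentiableOn ℝ u B)
    (hg : IntegrableOn (fun x => ‖fderiv ℝ u x‖ ^ 2) B)
    (hu : IntegrableOn (fun x => u x ^ 2 * dens x) B) :
    ∫ x in B, u x ^ 2 * dens x ≤ 4 * ∫ x in B, ‖fderiv ℝ u x‖ ^ 2 := by
  have hcoord : ∀ (i : Fin 2) (x : Pt),
      HasFDerivAt (fun y : Pt => y i) (EuclideanSpace.proj i : Pt →L[ℝ] ℝ) x := fun i x =>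
    (EuclideanSpace.proj i : Pt →L[ℝ] ℝ).hasFDerivAt
  set G : Fin 2 → Pt → ℝ := fun i x => u x ^ 2 * (rho x * x i) with hG
  have hGd : ∀ i, ∀ x ∈ B, HasFDerivAt (G i)
      (u x ^ 2 • (rho x • (EuclideanSpace.proj i : Pt →L[ℝ] ℝ) + x i • (rho x ^ 2 • innerSL ℝ x)) +
        (rho x * x i) • ((2 * u x) • fderiv ℝ u x)) x := fun i x hx => by
    have h1 := (hd.differentiableAt (isOpen_B.mem_nhds hx)).hasFDerivAt
    have h2 : HasFDerivAt (fun y => u y ^ 2) ((2 * u x) • fderiv ℝ u x) x := by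
      simpa [Function.comp_def] using (hasDerivAt_pow 2 (u x)).comp_hasFDerivAt x h1
    exact h2.fun_mul ((hasFDerivAt_rho hx).fun_mul (hcoord i x))
  have hdiff : ∀ i, DifferentiableOn ℝ (G i) B := fun i x hx =>
    (hGd i x hx).differentiableAt.differentiableWithinAt
  have hnorm : ∀ x ∈ B, ‖x‖ ≤ 1 := fun x hx => by
    nlinarith [norm_sq_lt_one hx, norm_nonneg x]
  have hbound : ∀ i, ∀ x ∈ B, ‖fderiv ℝ (G i) x‖ ≤
      3 * (u x ^ 2 * dens x) + ‖fderiv ℝ u x‖ ^ 2 := fun i x hx => by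
    rw [(hGd i x hx).fderiv]
    have hr := two_le_rho hx
    have hr0 := rho_pos hx
    have hxi : |x i| ≤ 1 := (PiLp.norm_apply_le x i).trans (hnorm x hx)
    have hpr : ‖(EuclideanSpace.proj i : Pt →L[ℝ] ℝ)‖ ≤ 1 :=
      ContinuousLinearMap.opNorm_le_bound _ zero_le_one fun y => by
        simpa using PiLp.norm_apply_le y i
    have h1 : ‖rho x • (EuclideanSpace.proj i : Pt →L[ℝ] ℝ)‖ ≤ rho x := by
      rw [norm_smul, Real.norm_eq_abs, abs_of_pos hr0]
      nlinarith
    have h2 : ‖x i • (rho x ^ 2 • innerSL ℝ x)‖ ≤ rho x ^ 2 := by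
      rw [norm_smul, norm_smul, innerSL_apply_norm, Real.norm_eq_abs, Real.norm_eq_abs,
        abs_of_nonneg (sq_nonneg (rho x))]
      have := mul_le_one₀ hxi (norm_nonneg x) (hnorm x hx)
      nlinarith [sq_nonneg (rho x)]
    have h3 : ‖(rho x * x i) • ((2 * u x) • fderiv ℝ u x)‖ ≤
        rho x * (2 * |u x|) * ‖fderiv ℝ u x‖ := by
      rw [norm_smul, norm_smul, Real.norm_eq_abs, Real.norm_eq_abs, abs_mul, abs_mul,
        abs_of_pos hr0, abs_two, ← mul_assoc]
      gcongr
      nlinarith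
    refine (norm_add_le _ _).trans ?_
    rw [norm_smul, Real.norm_eq_abs, abs_of_nonneg (sq_nonneg (u x)), dens_eq_rho_sq]
    have h4 := (norm_add_le _ _).trans (add_le_add h1 h2)
    have h5 : rho x + rho x ^ 2 ≤ 2 * rho x ^ 2 := by nlinarith
    have h6 := mul_le_mul_of_nonneg_left (h4.trans h5) (sq_nonneg (u x))
    have h7 := sq_nonneg (rho x * |u x| - ‖fderiv ℝ u x‖)
    have h8 : |u x| ^ 2 = u x ^ 2 := sq_abs _
    nlinarith
  have hdom : IntegrableOn (fun x => 3 * (u x ^ 2 * dens x) + ‖fderiv ℝ u x‖ ^ 2) B :=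
    (hu.const_mul 3).add hg
  have hGi : ∀ i, IntegrableOn (fun x => ‖fderiv ℝ (G i) x‖) B := fun i => by
    refine hdom.mono' (measurable_fderiv ℝ _).norm.aestronglyMeasurable
      ((ae_restrict_iff' measurableSet_B).2 (ae_of_all _ fun x hx => ?_))
    simpa using hbound i x hx
  have hGw : ∀ i, IntegrableOn (fun x => G i x * rho x) B := fun i => by
    refine hu.mono' ((hdiff i).continuousOn.mul differentiableOn_rho.continuousOn
      |>.aestronglyMeasurable measurableSet_B)
      ((ae_restrict_iff' measurableSet_B).2 (ae_of_all _ fun x hx => ?_))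
    have hxi : |x i| ≤ 1 := (PiLp.norm_apply_le x i).trans (hnorm x hx)
    rw [hG, norm_mul, norm_mul, norm_mul, Real.norm_eq_abs, Real.norm_eq_abs, Real.norm_eq_abs,
      abs_of_pos (rho_pos hx), abs_of_nonneg (sq_nonneg (u x)), dens_eq_rho_sq]
    nlinarith [mul_nonneg (sq_nonneg (u x)) (sq_nonneg (rho x))]
  have hzero : ∫ x in B, ∑ i, fderiv ℝ (G i) x (EuclideanSpace.single i 1) = 0 := by
    rw [integral_finsetSum _ fun i _ => integrableOn_fderiv_apply (hGi i) i]
    exact Finset.sum_eq_zero fun i _ => integral_fderiv_apply_eq_zero (hdiff i) (hGi i) (hGw i) i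
  have hsum : ∀ x ∈ B, u x ^ 2 * dens x - 4 * ‖fderiv ℝ u x‖ ^ 2 ≤
      2 * ∑ i, fderiv ℝ (G i) x (EuclideanSpace.single i 1) := fun x hx => by
    have hx2 : fderiv ℝ u x x = x 0 * fderiv ℝ u x (EuclideanSpace.single 0 1) +
        x 1 * fderiv ℝ u x (EuclideanSpace.single 1 1) := by
      have : x = x 0 • EuclideanSpace.single (0 : Fin 2) (1 : ℝ) +
          x 1 • EuclideanSpace.single (1 : Fin 2) (1 : ℝ) := by
        ext i
        fin_cases i <;> simp
      simpa using congrArg (fderiv ℝ u x) this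
    have hn : ‖x‖ ^ 2 = x 0 ^ 2 + x 1 ^ 2 := by simp [EuclideanSpace.norm_sq_eq]
    have hrel : rho x * (1 - ‖x‖ ^ 2) = 2 := by
      rw [rho, div_mul_cancel₀]
      linarith [norm_sq_lt_one hx]
    have hle : |fderiv ℝ u x x| ≤ ‖fderiv ℝ u x‖ := by
      have := (fderiv ℝ u x).le_opNorm x
      rw [Real.norm_eq_abs] at this
      nlinarith [hnorm x hx, norm_nonneg (fderiv ℝ u x)]
    have hs : ∑ i, fderiv ℝ (G i) x (EuclideanSpace.single i 1) =
        u x ^ 2 * rho x ^ 2 + 2 * (rho x * u x) * fderiv ℝ u x x := by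
      rw [Fin.sum_univ_two, (hGd 0 x hx).fderiv, (hGd 1 x hx).fderiv, hx2]
      simp [EuclideanSpace.inner_single_right]
      have : rho x ^ 2 * (1 - (x 0 ^ 2 + x 1 ^ 2)) = 2 * rho x := by
        rw [← hn, sq, mul_assoc, hrel, mul_comm]
      linear_combination (-u x ^ 2) * this
    rw [hs, dens_eq_rho_sq]
    have h9 : fderiv ℝ u x x ^ 2 ≤ ‖fderiv ℝ u x‖ ^ 2 := sq_le_sq' (by
      linarith [neg_abs_le (fderiv ℝ u x x)]) ((le_abs_self _).trans hle)
    nlinarith [sq_nonneg (rho x * u x + 2 * fderiv ℝ u x x)]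
  have hfin := setIntegral_mono_on (hu.sub (hg.const_mul 4))
    ((integrable_finsetSum Finset.univ
      fun i _ => integrableOn_fderiv_apply (hGi i) i).const_mul 2) measurableSet_B hsum
  rw [integral_const_mul, hzero, mul_zero] at hfin
  have h10 := integral_sub hu (hg.const_mul 4)
  rw [integral_const_mul] at h10
  simp only [Pi.sub_apply] at hfin
  linarith

/-- A `C¹` quadratic spline, `0` for `t ≤ 0` and `1` for `1 ≤ t`. -/
def spline (t : ℝ) : ℝ :=
  2 * (max t 0 ^ 2 - 2 * max (t - 1 / 2) 0 ^ 2 + max (t - 1) 0 ^ 2)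

/-- The derivative of `spline`. -/
def splineDeriv (t : ℝ) : ℝ :=
  4 * (max t 0 - 2 * max (t - 1 / 2) 0 + max (t - 1) 0)

theorem hasDerivAt_max_zero_sq (t : ℝ) :
    HasDerivAt (fun s : ℝ => max s 0 ^ 2) (2 * max t 0) t := by
  rcases lt_trichotomy t 0 with h | rfl | h
  · rw [max_eq_right h.le, mul_zero]
    refine (hasDerivAt_const t (0 : ℝ)).congr_of_eventuallyEq ?_
    filter_upwards [Iio_mem_nhds h] with s hs
    simp [max_eq_right (mem_Iio.1 hs).le]
  · rw [max_self, mul_zero]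
    refine HasDerivAt.of_isLittleO ?_
    simp only [max_self, sub_zero, smul_zero]
    refine Asymptotics.IsBigO.trans_isLittleO (g := fun s : ℝ => s ^ 2) ?_ ?_
    · refine Asymptotics.IsBigO.of_bound 1 (Eventually.of_forall fun s => ?_)
      rw [one_mul, Real.norm_eq_abs, Real.norm_eq_abs]
      rcases le_total s 0 with hs | hs
      · simpa [max_eq_right hs] using sq_nonneg s
      · simp [max_eq_left hs]
    · exact Asymptotics.isLittleO_pow_id one_lt_two
  · rw [max_eq_left h.le]
    have : HasDerivAt (fun s : ℝ => s ^ 2) (2 * t) t := by simpa using hasDerivAt_pow 2 t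
    refine this.congr_of_eventuallyEq ?_
    filter_upwards [Ioi_mem_nhds h] with s hs
    simp [max_eq_left (mem_Ioi.1 hs).le]

theorem hasDerivAt_spline (t : ℝ) : HasDerivAt spline (splineDeriv t) t := by
  have h1 := hasDerivAt_max_zero_sq t
  have h2 := (hasDerivAt_max_zero_sq (t - 1 / 2)).comp_sub_const t (1 / 2)
  have h3 := (hasDerivAt_max_zero_sq (t - 1)).comp_sub_const t 1
  refine (((h1.fun_sub (h2.const_mul 2)).fun_add h3).const_mul 2).congr_deriv ?_
  rw [splineDeriv]
  ring

theorem spline_of_nonpos {t : ℝ} (h : t ≤ 0) : spline t = 0 := by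
  rw [spline, max_eq_right h, max_eq_right (by linarith), max_eq_right (by linarith)]
  ring

theorem spline_of_one_le {t : ℝ} (h : 1 ≤ t) : spline t = 1 := by
  rw [spline, max_eq_left (by linarith), max_eq_left (by linarith), max_eq_left (by linarith)]
  ring

theorem splineDeriv_of_nonpos {t : ℝ} (h : t ≤ 0) : splineDeriv t = 0 := by
  rw [splineDeriv, max_eq_right h, max_eq_right (by linarith), max_eq_right (by linarith)]
  ring

theorem splineDeriv_of_one_le {t : ℝ} (h : 1 ≤ t) : splineDeriv t = 0 := by
  rw [splineDeriv, max_eq_left (by linarith), max_eq_left (by linarith),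
    max_eq_left (by linarith)]
  ring

theorem abs_spline_le (t : ℝ) : |spline t| ≤ 1 := by
  rcases le_total t 0 with h | h
  · simp [spline_of_nonpos h]
  rcases le_total 1 t with h' | h'
  · simp [spline_of_one_le h']
  rw [spline, max_eq_left h, max_eq_right (by linarith : t - 1 ≤ 0), abs_le]
  rcases le_total t (1 / 2) with h2 | h2
  · rw [max_eq_right (by linarith)]
    constructor <;> nlinarith
  · rw [max_eq_left (by linarith)]
    constructor <;> nlinarith

theorem abs_splineDeriv_le (t : ℝ) : |splineDeriv t| ≤ 2 := by
  rcases le_total t 0 with h | h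
  · simp [splineDeriv_of_nonpos h]
  rcases le_total 1 t with h' | h'
  · simp [splineDeriv_of_one_le h']
  rw [splineDeriv, max_eq_left h, max_eq_right (by linarith : t - 1 ≤ 0), abs_le]
  rcases le_total t (1 / 2) with h2 | h2
  · rw [max_eq_right (by linarith)]
    constructor <;> linarith
  · rw [max_eq_left (by linarith)]
    constructor <;> linarith

theorem sq_integral_mul_le {α : Type*} [MeasurableSpace α] {μ : Measure α} {f g : α → ℝ}
    (hf : Integrable (fun x => f x ^ 2) μ) (hg : Integrable (fun x => g x ^ 2) μ)
    (hfg : Integrable (fun x => f x * g x) μ) :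
    (∫ x, f x * g x ∂μ) ^ 2 ≤ (∫ x, f x ^ 2 ∂μ) * ∫ x, g x ^ 2 ∂μ := by
  have key : ∀ t : ℝ, 0 ≤ (∫ x, f x ^ 2 ∂μ) * (t * t) + (2 * ∫ x, f x * g x ∂μ) * t +
      ∫ x, g x ^ 2 ∂μ := fun t => by
    have h1 : 0 ≤ ∫ x, (t * f x + g x) ^ 2 ∂μ := integral_nonneg fun x => sq_nonneg _
    have h2 : (fun x => (t * f x + g x) ^ 2) =
        fun x => (t ^ 2 * f x ^ 2 + 2 * t * (f x * g x)) + g x ^ 2 := by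
      ext x
      ring
    have h3 : Integrable (fun x => t ^ 2 * f x ^ 2 + 2 * t * (f x * g x)) μ :=
      (hf.const_mul _).add (hfg.const_mul _)
    rw [h2, integral_add h3 hg, integral_add (hf.const_mul _) (hfg.const_mul _),
      integral_const_mul, integral_const_mul] at h1
    linarith
  have := discrim_le_zero key
  rw [discrim] at this
  linarith

theorem measurableSet_superlevel_s12 {v : Pt → ℝ} (hd : DifferentiableOn ℝ v B) (t : ℝ) :
    MeasurableSet (B ∩ {x | t < v x}) :=
  (hd.continuousOn.isOpen_inter_preimage isOpen_B isOpen_Ioi).measurableSet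

/-- The hyperbolic volume of a superlevel set. -/
def superlevelVolume (v : Pt → ℝ) (t : ℝ) : ℝ := ∫ x in B ∩ {x | t < v x}, dens x

/-- The Dirichlet energy on a superlevel set. -/
def superlevelEnergy (v : Pt → ℝ) (t : ℝ) : ℝ :=
  ∫ x in B ∩ {x | t < v x}, ‖fderiv ℝ v x‖ ^ 2

theorem superlevelVolume_nonneg (v : Pt → ℝ) (t : ℝ) : 0 ≤ superlevelVolume v t :=
  integral_nonneg fun _ => sq_nonneg _

theorem superlevelEnergy_nonneg (v : Pt → ℝ) (t : ℝ) : 0 ≤ superlevelEnergy v t :=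
  integral_nonneg fun _ => sq_nonneg _

theorem superlevel_antitone (v : Pt → ℝ) {s t : ℝ} (h : s ≤ t) :
    B ∩ {x | t < v x} ⊆ B ∩ {x | s < v x} :=
  fun _ hx => ⟨hx.1, h.trans_lt hx.2⟩

theorem superlevelVolume_antitone {v : Pt → ℝ} {s t : ℝ} (h : s ≤ t)
    (hi : IntegrableOn dens (B ∩ {x | s < v x})) :
    superlevelVolume v t ≤ superlevelVolume v s :=
  setIntegral_mono_set hi (ae_of_all _ fun _ => sq_nonneg _)
    (superlevel_antitone v h).eventuallyLE

theorem superlevelVolume_step {v : Pt → ℝ} (hd : DifferentiableOn ℝ v B)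
    (hg : IntegrableOn (fun x => ‖fderiv ℝ v x‖ ^ 2) B) {s h : ℝ} (hh : 0 < h)
    (hi : IntegrableOn dens (B ∩ {x | s < v x})) :
    superlevelVolume v (s + h) ≤
      (8 * (superlevelEnergy v s - superlevelEnergy v (s + h)) / h ^ 2 +
        2 * superlevelVolume v s) * superlevelVolume v s := by
  set U := B ∩ {x | s < v x} with hU
  set V := B ∩ {x | s + h < v x} with hV
  have hUm : MeasurableSet U := measurableSet_superlevel_s12 hd s
  have hVm : MeasurableSet V := measurableSet_superlevel_s12 hd (s + h)
  have hVU : V ⊆ U := superlevel_antitone v (by linarith)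
  have hUB : U ⊆ B := inter_subset_left
  have hAm : MeasurableSet (U \ V) := hUm.diff hVm
  set w : Pt → ℝ := fun x => spline ((v x - s) / h) with hw
  have hwd : ∀ x ∈ B, HasFDerivAt w ((splineDeriv ((v x - s) / h) / h) • fderiv ℝ v x) x :=
    fun x hx => by
      have h1 := (hd.differentiableAt (isOpen_B.mem_nhds hx)).hasFDerivAt
      have h2 : HasDerivAt (fun t => spline ((t - s) / h))
          (splineDeriv ((v x - s) / h) / h) (v x) := by
        simpa [Function.comp_def, div_eq_mul_inv] using
          (hasDerivAt_spline ((v x - s) / h)).comp (v x)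
          (((hasDerivAt_id (v x)).sub_const s).div_const h)
      exact h2.comp_hasFDerivAt x h1
  have hwdiff : DifferentiableOn ℝ w B := fun x hx =>
    (hwd x hx).differentiableAt.differentiableWithinAt
  have hgrad : ∀ x ∈ B, ‖fderiv ℝ w x‖ * rho x ≤
      (U \ V).indicator (fun x => 2 / h * (‖fderiv ℝ v x‖ * rho x)) x := fun x hx => by
    rw [(hwd x hx).fderiv, norm_smul, Real.norm_eq_abs, abs_div, abs_of_pos hh]
    by_cases hxA : x ∈ U \ V
    · rw [indicator_of_mem hxA, ← mul_assoc]
      have := rho_pos hx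
      gcongr
      exact abs_splineDeriv_le _
    · rw [indicator_of_notMem hxA]
      have : splineDeriv ((v x - s) / h) = 0 := by
        by_cases hsx : s < v x
        · have hxV : x ∈ V := by
            by_contra hcon
            exact hxA ⟨⟨hx, hsx⟩, hcon⟩
          refine splineDeriv_of_one_le ((one_le_div hh).2 ?_)
          have : s + h < v x := hxV.2
          linarith
        · exact splineDeriv_of_nonpos (div_nonpos_of_nonpos_of_nonneg (by linarith) hh.le)
      simp [this]
  have hwle : ∀ x ∈ B, |w x| * dens x ≤ U.indicator dens x := fun x hx => by
    by_cases hxU : x ∈ U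
    · rw [indicator_of_mem hxU]
      have := abs_spline_le ((v x - s) / h)
      nlinarith [dens_pos hx]
    · rw [indicator_of_notMem hxU]
      have : ¬ s < v x := fun hc => hxU ⟨hx, hc⟩
      simp [hw, spline_of_nonpos (div_nonpos_of_nonpos_of_nonneg (by linarith : v x - s ≤ 0) hh.le)]
  have hgA : IntegrableOn (fun x => ‖fderiv ℝ v x‖ ^ 2) (U \ V) :=
    hg.mono_set (sdiff_subset.trans hUB)
  have hdA : IntegrableOn (fun x => rho x ^ 2) (U \ V) := hi.mono_set sdiff_subset
  have hrm : AEStronglyMeasurable rho (volume.restrict B) := aestronglyMeasurable_rho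
  have hgr : IntegrableOn (fun x => ‖fderiv ℝ v x‖ * rho x) (U \ V) := by
    refine (hgA.add hdA).mono' ((measurable_fderiv ℝ v).norm.aestronglyMeasurable.mul
      (hrm.mono_measure (Measure.restrict_mono_set _ (sdiff_subset.trans hUB)))) ?_
    refine ae_of_all _ fun x => ?_
    rw [Real.norm_eq_abs, abs_mul, abs_norm, Pi.add_apply]
    nlinarith [sq_nonneg (‖fderiv ℝ v x‖ - |rho x|), sq_abs (rho x), sq_nonneg ‖fderiv ℝ v x‖,
      sq_nonneg (rho x)]
  have hUind : IntegrableOn (U.indicator dens) B :=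
    ((integrable_indicator_iff hUm).2 hi).integrableOn
  have hAind : IntegrableOn
      ((U \ V).indicator (fun x => 2 / h * (‖fderiv ℝ v x‖ * rho x))) B :=
    ((integrable_indicator_iff hAm).2 (hgr.const_mul _)).integrableOn
  have hI1 : IntegrableOn (fun x => ‖fderiv ℝ w x‖ * rho x) B := by
    refine hAind.mono' ((measurable_fderiv ℝ w).norm.aestronglyMeasurable.mul hrm)
      ((ae_restrict_iff' measurableSet_B).2 (ae_of_all _ fun x hx => ?_))
    rw [Real.norm_eq_abs, abs_of_nonneg (mul_nonneg (norm_nonneg _) (rho_pos hx).le)]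
    exact hgrad x hx
  have hI2 : IntegrableOn (fun x => |w x| * dens x) B := by
    refine hUind.mono' ((hwdiff.continuousOn.abs.mul
      (differentiableOn_rho.continuousOn.pow 2)).aestronglyMeasurable measurableSet_B)
      ((ae_restrict_iff' measurableSet_B).2 (ae_of_all _ fun x hx => ?_))
    rw [Real.norm_eq_abs, abs_of_nonneg (mul_nonneg (abs_nonneg _) (dens_pos hx).le)]
    exact hwle x hx
  have hsob := hyperbolic_sobolev hwdiff hI1 hI2
  have hJ1 : ∫ x in B, ‖fderiv ℝ w x‖ * rho x ≤
      2 / h * ∫ x in U \ V, ‖fderiv ℝ v x‖ * rho x := by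
    refine (setIntegral_mono_on hI1 hAind measurableSet_B hgrad).trans_eq ?_
    rw [setIntegral_indicator hAm, inter_eq_right.2 (sdiff_subset.trans hUB), integral_const_mul]
  have hJ2 : ∫ x in B, |w x| * dens x ≤ superlevelVolume v s := by
    refine (setIntegral_mono_on hI2 hUind measurableSet_B hwle).trans_eq ?_
    rw [setIntegral_indicator hUm, inter_eq_right.2 hUB]
    rfl
  have hCS := sq_integral_mul_le hgA hdA hgr
  have hdm : ∫ x in U \ V, rho x ^ 2 ≤ superlevelVolume v s :=
    setIntegral_mono_set hi (ae_of_all _ fun _ => sq_nonneg _) sdiff_subset.eventuallyLE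
  have hE : ∫ x in U \ V, ‖fderiv ℝ v x‖ ^ 2 =
      superlevelEnergy v s - superlevelEnergy v (s + h) :=
    setIntegral_sdiff hVm (hg.mono_set hUB) hVU
  have hlow : superlevelVolume v (s + h) ≤ ∫ x in B, w x ^ 2 * dens x := by
    have hI3 : IntegrableOn (fun x => w x ^ 2 * dens x) B := by
      refine hI2.mono' (((hwdiff.continuousOn.pow 2).mul
        (differentiableOn_rho.continuousOn.pow 2)).aestronglyMeasurable measurableSet_B)
        ((ae_restrict_iff' measurableSet_B).2 (ae_of_all _ fun x hx => ?_))
      rw [Real.norm_eq_abs, abs_of_nonneg (mul_nonneg (sq_nonneg _) (dens_pos hx).le)]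
      refine mul_le_mul_of_nonneg_right ?_ (dens_pos hx).le
      rw [← sq_abs]
      have := abs_spline_le ((v x - s) / h)
      nlinarith [abs_nonneg (w x)]
    calc superlevelVolume v (s + h) = ∫ x in V, w x ^ 2 * dens x := by
          refine setIntegral_congr_fun hVm fun x hx => ?_
          have h1 : s + h < v x := hx.2
          simp [hw, spline_of_one_le ((one_le_div hh).2 (by linarith : h ≤ v x - s))]
      _ ≤ _ := setIntegral_mono_set hI3
          ((ae_restrict_iff' measurableSet_B).2 (ae_of_all _ fun x hx =>
            mul_nonneg (sq_nonneg _) (dens_pos hx).le))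
          (hVU.trans hUB).eventuallyLE
  set m := superlevelVolume v s with hm
  set E := superlevelEnergy v s - superlevelEnergy v (s + h) with hEdef
  set C := ∫ x in U \ V, ‖fderiv ℝ v x‖ * rho x with hC
  have hm0 : 0 ≤ m := superlevelVolume_nonneg v s
  have hE0 : 0 ≤ E := hE ▸ integral_nonneg fun _ => sq_nonneg _
  have hC2 : C ^ 2 ≤ E * m := by
    rw [hE] at hCS
    exact hCS.trans (mul_le_mul_of_nonneg_left hdm hE0)
  have hJ0 : 0 ≤ (∫ x in B, ‖fderiv ℝ w x‖ * rho x) + ∫ x in B, |w x| * dens x :=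
    add_nonneg (setIntegral_nonneg measurableSet_B fun x hx =>
      mul_nonneg (norm_nonneg _) (rho_pos hx).le)
      (setIntegral_nonneg measurableSet_B fun x hx =>
        mul_nonneg (abs_nonneg _) (dens_pos hx).le)
  calc superlevelVolume v (s + h) ≤ (2 / h * C + m) ^ 2 :=
        (hlow.trans hsob).trans (pow_le_pow_left₀ hJ0 (add_le_add hJ1 hJ2) 2)
    _ ≤ 2 * (2 / h * C) ^ 2 + 2 * m ^ 2 := by nlinarith [sq_nonneg (2 / h * C - m)]
    _ = 8 / h ^ 2 * C ^ 2 + 2 * m ^ 2 := by ring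
    _ ≤ 8 / h ^ 2 * (E * m) + 2 * m ^ 2 := by gcongr
    _ = (8 * E / h ^ 2 + 2 * m) * m := by ring

theorem superlevelVolume_iterate {v : Pt → ℝ} (hd : DifferentiableOn ℝ v B)
    (hg : IntegrableOn (fun x => ‖fderiv ℝ v x‖ ^ 2) B) {s h : ℝ} (hh : 0 < h)
    (hi : IntegrableOn dens (B ∩ {x | s < v x})) (hs : superlevelVolume v s ≤ 1 / 4) (N : ℕ) :
    superlevelVolume v (s + N * h) ≤
      exp (8 * (superlevelEnergy v s - superlevelEnergy v (s + N * h)) / h ^ 2 - N / 2) *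
        superlevelVolume v s := by
  induction N with
  | zero => simp
  | succ N ih =>
    have hle : s ≤ s + N * h := by
      have : 0 ≤ N * h := by positivity
      linarith
    have hi' := hi.mono_set (superlevel_antitone v hle)
    have h1 := superlevelVolume_step hd hg hh hi'
    have h2 : superlevelVolume v (s + N * h) ≤ 1 / 4 := (superlevelVolume_antitone hle hi).trans hs
    have e : s + (N + 1 : ℕ) * h = s + N * h + h := by push_cast; ring
    rw [e]
    set E₀ := superlevelEnergy v s
    set E₁ := superlevelEnergy v (s + N * h)
    set E₂ := superlevelEnergy v (s + N * h + h)
    have h3 : 8 * (E₁ - E₂) / h ^ 2 + 2 * superlevelVolume v (s + N * h) ≤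
        exp (8 * (E₁ - E₂) / h ^ 2 - 1 / 2) := by
      have := add_one_le_exp (8 * (E₁ - E₂) / h ^ 2 - 1 / 2)
      linarith
    calc _ ≤ _ := h1
      _ ≤ exp (8 * (E₁ - E₂) / h ^ 2 - 1 / 2) * superlevelVolume v (s + N * h) :=
          mul_le_mul_of_nonneg_right h3 (superlevelVolume_nonneg _ _)
      _ ≤ exp (8 * (E₁ - E₂) / h ^ 2 - 1 / 2) *
          (exp (8 * (E₀ - E₁) / h ^ 2 - N / 2) * superlevelVolume v s) := by gcongr
      _ = _ := by
          rw [← mul_assoc, ← exp_add]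
          congr 2
          push_cast
          ring

theorem superlevelVolume_gaussian_decay {v : Pt → ℝ} (hd : DifferentiableOn ℝ v B)
    (hg : IntegrableOn (fun x => ‖fderiv ℝ v x‖ ^ 2) B) {s : ℝ}
    (hi : IntegrableOn dens (B ∩ {x | s < v x})) (hs : superlevelVolume v s ≤ 1 / 4) {M : ℕ}
    (hM : 0 < M) (hE : superlevelEnergy v s ≤ 1 / (32 * M)) (n : ℕ) :
    superlevelVolume v (s + n) ≤ exp (-(M * n ^ 2 / 4)) * superlevelVolume v s := by
  rcases n.eq_zero_or_pos with rfl | hn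
  · simp
  have hM' : (0 : ℝ) < M := by exact_mod_cast hM
  have hn' : (0 : ℝ) < n := by exact_mod_cast hn
  have h1 := superlevelVolume_iterate hd hg (h := 1 / (M * n)) (by positivity) hi hs (M * n ^ 2)
  have e : ((M * n ^ 2 : ℕ) : ℝ) * (1 / (M * n)) = n := by
    push_cast
    field_simp
  rw [e] at h1
  refine h1.trans (mul_le_mul_of_nonneg_right (exp_le_exp.2 ?_) (superlevelVolume_nonneg _ _))
  have h2 := superlevelEnergy_nonneg v (s + n)
  have h3 : 8 * (superlevelEnergy v s - superlevelEnergy v (s + n)) / (1 / ((M : ℝ) * n)) ^ 2 =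
      8 * (superlevelEnergy v s - superlevelEnergy v (s + n)) * (M ^ 2 * n ^ 2) := by
    field_simp
  have h4 : 8 * (superlevelEnergy v s - superlevelEnergy v (s + n)) * ((M : ℝ) ^ 2 * n ^ 2) ≤
      8 * (1 / (32 * M)) * ((M : ℝ) ^ 2 * n ^ 2) := by
    gcongr
    linarith
  have h5 : 8 * (1 / (32 * (M : ℝ))) * ((M : ℝ) ^ 2 * n ^ 2) = M * n ^ 2 / 4 := by
    field_simp
    norm_num
  rw [h3]
  push_cast
  linarith

theorem tendsto_integral_superlevel {v g : Pt → ℝ} (hd : DifferentiableOn ℝ v B) {t₀ : ℝ}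
    (hg : IntegrableOn g (B ∩ {x | t₀ < v x})) :
    Tendsto (fun n : ℕ => ∫ x in B ∩ {x | (n : ℝ) < v x}, g x) atTop (𝓝 0) := by
  have h := tendsto_setIntegral_of_antitone (μ := volume) (f := g)
    (s := fun n : ℕ => B ∩ {x | (n : ℝ) < v x}) (fun n => measurableSet_superlevel_s12 hd n)
    (fun m n hmn => superlevel_antitone v (by exact_mod_cast hmn)) (by
      obtain ⟨n, hn⟩ := exists_nat_ge t₀
      exact ⟨n, hg.mono_set (superlevel_antitone v hn)⟩)
  have hempty : ⋂ n : ℕ, B ∩ {x | (n : ℝ) < v x} = ∅ := by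
    refine eq_empty_of_forall_notMem fun x hx => ?_
    obtain ⟨n, hn⟩ := exists_nat_ge (v x)
    have h1 : (n : ℝ) < v x := (mem_iInter.1 hx n).2
    linarith
  rwa [hempty, setIntegral_empty] at h

theorem exists_integrableOn_exp_sq_superlevel {v : Pt → ℝ} (hd : DifferentiableOn ℝ v B)
    (hg : IntegrableOn (fun x => ‖fderiv ℝ v x‖ ^ 2) B) {t₀ : ℝ}
    (hi : IntegrableOn dens (B ∩ {x | t₀ < v x})) {α : ℝ} (hα : 0 ≤ α) (L : ℝ) :
    ∃ k : ℝ, L ≤ k ∧ IntegrableOn (fun x => exp (α * v x ^ 2) * dens x) (B ∩ {x | k < v x}) := by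
  obtain ⟨M, hM⟩ := exists_nat_ge (4 * (2 * α + 1))
  have hMpos : (0 : ℝ) < M := by linarith
  have hv := tendsto_integral_superlevel hd hi
  have hE := tendsto_integral_superlevel (t₀ := 0) hd (hg.mono_set inter_subset_left)
  obtain ⟨K, ⟨hK1, hK2⟩, hK3⟩ := (((hv.eventually_le_const (by norm_num : (0 : ℝ) < 1 / 4)).and
    (hE.eventually_le_const (by positivity : (0 : ℝ) < 1 / (32 * M)))).and
    (eventually_ge_atTop (max ⌈L⌉₊ ⌈t₀⌉₊))).exists
  have hLK : L ≤ K := (Nat.le_ceil L).trans (by exact_mod_cast (le_max_left _ _).trans hK3)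
  have htK : t₀ ≤ K := (Nat.le_ceil t₀).trans (by exact_mod_cast (le_max_right _ _).trans hK3)
  have hiK := hi.mono_set (superlevel_antitone v htK)
  refine ⟨K, hLK, ?_⟩
  set S : ℕ → Set Pt := fun n => (B ∩ {x | (K : ℝ) + n < v x}) \ (B ∩ {x | (K : ℝ) + n + 1 < v x})
  have hSm : ∀ n, MeasurableSet (S n) := fun n =>
    (measurableSet_superlevel_s12 hd _).diff (measurableSet_superlevel_s12 hd _)
  have hSsub : ∀ n, S n ⊆ B ∩ {x | (K : ℝ) + n < v x} := fun n => sdiff_subset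
  have hSB : ∀ n, S n ⊆ B := fun n => (hSsub n).trans inter_subset_left
  have hSi : ∀ n, IntegrableOn dens (S n) := fun n =>
    hiK.mono_set ((hSsub n).trans (superlevel_antitone v (by
      have : (0 : ℝ) ≤ n := n.cast_nonneg
      linarith)))
  have hle : ∀ n, ∀ x ∈ S n, ‖exp (α * v x ^ 2) * dens x‖ ≤
      exp (α * (K + n + 1) ^ 2) * dens x := fun n x hx => by
    have hxB := hSB n hx
    have h1 : (K : ℝ) + n < v x := (hSsub n hx).2
    have h2 : v x ≤ K + n + 1 := by
      by_contra hcon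
      exact hx.2 ⟨hxB, not_le.1 hcon⟩
    have h3 : 0 ≤ v x := by
      have : (0 : ℝ) ≤ K + n := by positivity
      linarith
    rw [norm_mul, Real.norm_eq_abs, Real.norm_eq_abs, abs_of_pos (exp_pos _),
      abs_of_pos (dens_pos hxB)]
    have := dens_pos hxB
    gcongr
  have hfi : ∀ n, IntegrableOn (fun x => exp (α * v x ^ 2) * dens x) (S n) := fun n => by
    refine ((hSi n).const_mul (exp (α * (K + n + 1) ^ 2))).mono' ?_
      ((ae_restrict_iff' (hSm n)).2 (ae_of_all _ (hle n)))
    have : ContinuousOn (fun x => exp (α * v x ^ 2) * dens x) B :=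
      (continuous_exp.comp_continuousOn ((hd.continuousOn.pow 2).const_smul α)).mul
        (differentiableOn_rho.continuousOn.pow 2)
    exact (this.mono (hSB n)).aestronglyMeasurable (hSm n)
  have hUnion : B ∩ {x | (K : ℝ) < v x} ⊆ ⋃ n, S n := fun x hx => by
    have hx2 : (K : ℝ) < v x := hx.2
    obtain ⟨n, hn⟩ : ∃ n : ℕ, ⌈v x - K⌉₊ = n + 1 := by
      refine Nat.exists_eq_succ_of_ne_zero ?_
      exact (Nat.ceil_pos.2 (by linarith)).ne'
    have h1 : v x - K ≤ n + 1 := by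
      have := Nat.le_ceil (v x - K)
      rw [hn] at this
      exact_mod_cast this
    have h2 : (n : ℝ) < v x - K := Nat.lt_ceil.1 (by omega)
    refine mem_iUnion.2 ⟨n, ⟨hx.1, ?_⟩, fun hc => ?_⟩
    · change (K : ℝ) + n < v x
      linarith
    · have : (K : ℝ) + n + 1 < v x := hc.2
      linarith
  refine (integrableOn_iUnion_of_summable_integral_norm hfi ?_).mono_set hUnion
  have hsum : Summable fun n : ℕ => exp (2 * α * (K + 1) ^ 2) * superlevelVolume v K * exp (-n) :=
    Real.summable_exp_neg_nat.mul_left _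
  refine Summable.of_nonneg_of_le (fun n => integral_nonneg fun _ => norm_nonneg _) (fun n => ?_)
    hsum
  have hdec := superlevelVolume_gaussian_decay hd hg hiK hK1 (by exact_mod_cast hMpos) hK2 n
  calc ∫ x in S n, ‖exp (α * v x ^ 2) * dens x‖
      ≤ ∫ x in S n, exp (α * (K + n + 1) ^ 2) * dens x :=
        setIntegral_mono_on (hfi n).norm ((hSi n).const_mul _) (hSm n) (hle n)
    _ = exp (α * (K + n + 1) ^ 2) * ∫ x in S n, dens x := integral_const_mul _ _
    _ ≤ exp (α * (K + n + 1) ^ 2) * superlevelVolume v (K + n) := by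
        gcongr
        exact setIntegral_mono_set (hiK.mono_set (superlevel_antitone v (by
          have : (0 : ℝ) ≤ n := n.cast_nonneg
          linarith))) (ae_of_all _ fun _ => sq_nonneg _) (hSsub n).eventuallyLE
    _ ≤ exp (2 * α * (K + 1) ^ 2 + 2 * α * n ^ 2) *
          (exp (-(M * n ^ 2 / 4)) * superlevelVolume v K) := by
        have hvn := superlevelVolume_nonneg v ((K : ℝ) + n)
        gcongr
        nlinarith [mul_nonneg hα (sq_nonneg ((K : ℝ) + 1 - n))]
    _ = exp (2 * α * (K + 1) ^ 2) * superlevelVolume v K *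
          exp (2 * α * n ^ 2 - M * n ^ 2 / 4) := by
        rw [exp_add, sub_eq_add_neg, exp_add]
        ring
    _ ≤ _ := by
        have hv0 := superlevelVolume_nonneg v K
        gcongr
        have h1 : (n : ℝ) ≤ n ^ 2 := by exact_mod_cast Nat.le_self_pow two_ne_zero n
        nlinarith [mul_le_mul_of_nonneg_right hM (sq_nonneg (n : ℝ))]

/-- Exponential integrability in `H¹(𝔹²)`. -/
theorem exists_integrableOn_exp_sq {u : Pt → ℝ} (hd : DifferentiableOn ℝ u B)
    (hg : IntegrableOn (fun x => ‖fderiv ℝ u x‖ ^ 2) B)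
    (hu : IntegrableOn (fun x => u x ^ 2 * dens x) B) {α : ℝ} (hα : 0 ≤ α) (L : ℝ) :
    ∃ k : ℝ, L ≤ k ∧ ∃ S : Set Pt, S ⊆ B ∧ MeasurableSet S ∧ (∀ x ∈ B, k < |u x| → x ∈ S) ∧
      IntegrableOn (fun x => exp (α * u x ^ 2) * dens x) S := by
  set v : Pt → ℝ := fun x => √(1 + u x ^ 2) with hv
  have hpos : ∀ x, 0 < 1 + u x ^ 2 := fun x => by positivity
  have hvsq : ∀ x, v x ^ 2 = 1 + u x ^ 2 := fun x => Real.sq_sqrt (hpos x).le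
  have hvpos : ∀ x, 0 < v x := fun x => Real.sqrt_pos.2 (hpos x)
  have habs : ∀ x, |u x| ≤ v x := fun x => Real.abs_le_sqrt (by linarith)
  have hvd : ∀ x ∈ B, HasFDerivAt v ((u x / v x) • fderiv ℝ u x) x := fun x hx => by
    have h1 := (hd.differentiableAt (isOpen_B.mem_nhds hx)).hasFDerivAt
    have h2 : HasDerivAt (fun t : ℝ => √(1 + t ^ 2)) (u x / v x) (u x) := by
      have h3 : HasDerivAt (fun t : ℝ => 1 + t ^ 2) (2 * u x) (u x) := by
        simpa using (hasDerivAt_pow 2 (u x)).const_add 1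
      refine (h3.sqrt (hpos _).ne').congr_deriv ?_
      rw [mul_div_mul_left _ _ two_ne_zero]
    exact h2.comp_hasFDerivAt x h1
  have hvdiff : DifferentiableOn ℝ v B := fun x hx =>
    (hvd x hx).differentiableAt.differentiableWithinAt
  have hvg : IntegrableOn (fun x => ‖fderiv ℝ v x‖ ^ 2) B := by
    refine hg.mono' ((measurable_fderiv ℝ v).norm.pow_const 2).aestronglyMeasurable
      ((ae_restrict_iff' measurableSet_B).2 (ae_of_all _ fun x hx => ?_))
    rw [norm_pow, norm_norm, (hvd x hx).fderiv, norm_smul, Real.norm_eq_abs, abs_div,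
      abs_of_pos (hvpos x)]
    refine pow_le_pow_left₀ (by positivity) ?_ 2
    exact mul_le_of_le_one_left (norm_nonneg _) ((div_le_one (hvpos x)).2 (habs x))
  have hvi : IntegrableOn dens (B ∩ {x | 2 < v x}) := by
    refine (hu.mono_set inter_subset_left).mono'
      ((differentiableOn_rho.continuousOn.pow 2).mono inter_subset_left
        |>.aestronglyMeasurable (measurableSet_superlevel_s12 hvdiff 2))
      ((ae_restrict_iff' (measurableSet_superlevel_s12 hvdiff 2)).2 (ae_of_all _ fun x hx => ?_))
    have h1 : 2 < v x := hx.2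
    rw [Real.norm_eq_abs, abs_of_pos (dens_pos hx.1)]
    exact le_mul_of_one_le_left (dens_pos hx.1).le (by nlinarith [hvsq x])
  obtain ⟨k, hk, hki⟩ := exists_integrableOn_exp_sq_superlevel hvdiff hvg hvi hα L
  have hm := measurableSet_superlevel_s12 hvdiff k
  refine ⟨k, hk, B ∩ {x | k < v x}, inter_subset_left, hm, fun x hx hkx =>
    ⟨hx, hkx.trans_le (habs x)⟩, hki.mono' ?_ ((ae_restrict_iff' hm).2 (ae_of_all _ fun x hx => ?_))⟩
  · have : ContinuousOn (fun x => exp (α * u x ^ 2) * dens x) B :=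
      (continuous_exp.comp_continuousOn ((hd.continuousOn.pow 2).const_smul α)).mul
        (differentiableOn_rho.continuousOn.pow 2)
    exact (this.mono inter_subset_left).aestronglyMeasurable hm
  · have h1 := dens_pos hx.1
    rw [Real.norm_eq_abs, abs_of_nonneg (mul_nonneg (exp_pos _).le h1.le), hvsq]
    gcongr
    linarith

theorem norm_gradient_eq (u : Pt → ℝ) (x : Pt) : ‖gradient u x‖ = ‖fderiv ℝ u x‖ := by
  simp [gradient]

theorem enormSq_eq (u : Pt → ℝ) : enormSq u = ∫ x in B, ‖fderiv ℝ u x‖ ^ 2 := by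
  simp only [enormSq, norm_gradient_eq]

theorem IsH1.integrableOn_fderiv {u : Pt → ℝ} (hu : IsH1 u) :
    IntegrableOn (fun x => ‖fderiv ℝ u x‖ ^ 2) B := by
  simpa only [norm_gradient_eq] using hu.2.1

namespace CriticalGrowth

variable {lam : ℝ} {h : Pt → ℝ → ℝ}

theorem continuous_uncurry_fn (hf : CriticalGrowth lam h) :
    Continuous (Function.uncurry (fn lam h)) := by
  have h1 := hf.h_C1.continuous
  have h2 : Continuous fun p : Pt × ℝ => Real.exp (lam * p.2 ^ 2) - 1 := by fun_prop
  exact h1.mul h2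

theorem continuous_fn (hf : CriticalGrowth lam h) (x : Pt) : Continuous (fn lam h x) :=
  hf.continuous_uncurry_fn.comp (Continuous.prodMk_right x)

theorem continuous_uncurry_Fn (hf : CriticalGrowth lam h) :
    Continuous (Function.uncurry (Fn lam h)) := by
  have h1 : Continuous (Function.uncurry fun (p : Pt × ℝ) (s : ℝ) => fn lam h p.1 s) :=
    hf.continuous_uncurry_fn.comp
      ((continuous_fst.comp continuous_fst).prodMk continuous_snd)
  exact intervalIntegral.continuous_parametric_intervalIntegral_of_continuous h1 continuous_snd

theorem differentiable_fn (hf : CriticalGrowth lam h) (x : Pt) :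
    Differentiable ℝ (fn lam h x) := by
  have h1 : Differentiable ℝ (h x) :=
    (hf.h_C1.differentiable one_ne_zero).comp
      ((differentiable_const x).prodMk differentiable_id)
  have h2 : Differentiable ℝ fun t : ℝ => Real.exp (lam * t ^ 2) - 1 := by fun_prop
  exact h1.mul h2

theorem fn_zero (x : Pt) : fn lam h x 0 = 0 := by simp [fn]

theorem Fn_zero (x : Pt) : Fn lam h x 0 = 0 := by simp [Fn]

theorem fn_mul_abs (hf : CriticalGrowth lam h) {x : Pt} (hx : x ∈ B) (t : ℝ) :
    fn lam h x t * t = fn lam h x |t| * |t| := by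
  rcases abs_choice t with ht | ht <;> rw [ht]
  rw [hf.f_odd x hx, neg_mul_neg]

theorem Fn_abs (hf : CriticalGrowth lam h) {x : Pt} (hx : x ∈ B) (t : ℝ) :
    Fn lam h x t = Fn lam h x |t| := by
  rcases abs_choice t with ht | ht <;> rw [ht]
  have h1 := intervalIntegral.integral_comp_neg (a := 0) (b := t) (fn lam h x)
  simp only [hf.f_odd x hx, intervalIntegral.integral_neg, neg_zero] at h1
  rw [Fn, Fn, intervalIntegral.integral_symm (-t) 0, ← h1, neg_neg]

theorem strictMonoOn_fn_div (hf : CriticalGrowth lam h) {x : Pt} (hx : x ∈ B) :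
    StrictMonoOn (fun t => fn lam h x t / t) (Ioi 0) := by
  have hd : ∀ t : ℝ, 0 < t → HasDerivAt (fun t => fn lam h x t / t)
      ((deriv (fn lam h x) t * t - fn lam h x t * 1) / t ^ 2) t := fun t ht =>
    (hf.differentiable_fn x t).hasDerivAt.div (hasDerivAt_id t) ht.ne'
  refine strictMonoOn_of_deriv_pos (convex_Ioi 0)
    (fun t ht => (hd t ht).continuousAt.continuousWithinAt) fun t ht => ?_
  rw [interior_Ioi] at ht
  have ht0 : 0 < t := ht
  rw [(hd t ht0).deriv]
  have h1 := (div_lt_iff₀ ht0).1 (hf.f_super x hx t ht0)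
  refine div_pos ?_ (by positivity)
  rw [mul_one]
  exact sub_pos.2 h1

theorem intervalIntegral_fn_le (hf : CriticalGrowth lam h) {x : Pt} (hx : x ∈ B) {a b : ℝ}
    (ha : 0 ≤ a) (hab : a ≤ b) (hb : 0 < b) :
    ∫ s in a..b, fn lam h x s ≤ fn lam h x b / b * ((b ^ 2 - a ^ 2) / 2) := by
  have h1 : ∫ s in a..b, fn lam h x s ≤ ∫ s in a..b, fn lam h x b / b * s := by
    refine intervalIntegral.integral_mono_on hab
      ((hf.continuous_fn x).intervalIntegrable _ _)
      (Continuous.intervalIntegrable (by fun_prop) _ _) fun s hs => ?_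
    rcases (ha.trans hs.1).eq_or_lt with h0 | h0
    · simp [← h0, fn_zero]
    · exact (div_le_iff₀ h0).1 ((hf.strictMonoOn_fn_div hx).monotoneOn h0 hb hs.2)
  rwa [intervalIntegral.integral_const_mul, integral_id] at h1

theorem Fn_nonneg (hf : CriticalGrowth lam h) {x : Pt} (hx : x ∈ B) (t : ℝ) :
    0 ≤ Fn lam h x t := by
  rw [hf.Fn_abs hx]
  refine intervalIntegral.integral_nonneg (abs_nonneg t) fun s hs => ?_
  rcases hs.1.eq_or_lt with h0 | h0
  · rw [← h0, fn_zero]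
  · exact (hf.f_pos x hx s h0).le

theorem fn_mul_self_nonneg (hf : CriticalGrowth lam h) {x : Pt} (hx : x ∈ B) (t : ℝ) :
    0 ≤ fn lam h x t * t := by
  rw [hf.fn_mul_abs hx]
  rcases (abs_nonneg t).eq_or_lt with h0 | h0
  · simp [← h0]
  · exact mul_nonneg (hf.f_pos x hx _ h0).le h0.le

/-- Lower bound for the integrand of `I_λ` by the growth of `f(x,t)/t`. -/
theorem sub_mul_sq_le (hf : CriticalGrowth lam h) {x : Pt} (hx : x ∈ B) {s t : ℝ}
    (hs : 0 < s) (hst : s ≤ t) :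
    (fn lam h x t / t - fn lam h x s / s) * (s ^ 2 / 2) ≤
      fn lam h x t * t / 2 - Fn lam h x t := by
  have ht := hs.trans_le hst
  have h1 := hf.intervalIntegral_fn_le hx le_rfl hs.le hs
  have h2 := hf.intervalIntegral_fn_le hx hs.le hst ht
  have h3 : Fn lam h x t = (∫ r in (0 : ℝ)..s, fn lam h x r) + ∫ r in s..t, fn lam h x r :=
    (intervalIntegral.integral_add_adjacent_intervals
      ((hf.continuous_fn x).intervalIntegrable _ _)
      ((hf.continuous_fn x).intervalIntegrable _ _)).symm
  have h4 : fn lam h x t * t = fn lam h x t / t * t ^ 2 := by field_simp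
  rw [h3, h4]
  linarith

theorem Fn_lt (hf : CriticalGrowth lam h) {x : Pt} (hx : x ∈ B) {t : ℝ} (ht : t ≠ 0) :
    Fn lam h x t < fn lam h x t * t / 2 := by
  rw [hf.Fn_abs hx, hf.fn_mul_abs hx]
  have ht0 : 0 < |t| := abs_pos.2 ht
  have h1 := hf.sub_mul_sq_le hx (half_pos ht0) (half_le_self ht0.le)
  have h2 := hf.strictMonoOn_fn_div hx (half_pos ht0) ht0 (half_lt_self ht0)
  have h3 := mul_pos (sub_pos.2 h2) (show 0 < (|t| / 2) ^ 2 / 2 by positivity)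
  exact sub_pos.1 (h3.trans_le h1)

theorem Fn_le (hf : CriticalGrowth lam h) {x : Pt} (hx : x ∈ B) (t : ℝ) :
    Fn lam h x t ≤ fn lam h x t * t / 2 := by
  rcases eq_or_ne t 0 with rfl | ht
  · simp [Fn_zero]
  · exact (hf.Fn_lt hx ht).le

theorem exists_fn_le_mul_sq (hf : CriticalGrowth lam h) {L : ℝ} (hL : 0 < L) :
    ∃ K : ℝ, 0 < K ∧ ∀ x ∈ B, ∀ t : ℝ, 0 < t → t ≤ L → fn lam h x t ≤ K * t ^ 2 := by
  obtain ⟨C, hC⟩ := hf.h_bdd L hL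
  have hlam := hf.lam_pos
  refine ⟨(|C| + 1) * (lam * exp (lam * L ^ 2)), by positivity, fun x hx t ht htL => ?_⟩
  have h1 := (le_abs_self _).trans (hC x hx t (by rwa [abs_of_pos ht]))
  have h2 : exp (lam * t ^ 2) - 1 ≤ lam * t ^ 2 * exp (lam * t ^ 2) := by
    have h3 := mul_le_mul_of_nonneg_right (add_one_le_exp (-(lam * t ^ 2)))
      (exp_pos (lam * t ^ 2)).le
    rw [← exp_add, neg_add_cancel, exp_zero] at h3
    linarith
  have h0 : 0 ≤ exp (lam * t ^ 2) - 1 := sub_nonneg.2 (one_le_exp (by positivity))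
  calc h x t * (exp (lam * t ^ 2) - 1)
      ≤ (|C| + 1) * (exp (lam * t ^ 2) - 1) :=
        mul_le_mul_of_nonneg_right (by linarith [le_abs_self C]) h0
    _ ≤ (|C| + 1) * (lam * t ^ 2 * exp (lam * t ^ 2)) := by gcongr
    _ ≤ (|C| + 1) * (lam * t ^ 2 * exp (lam * L ^ 2)) := by gcongr
    _ = _ := by ring

theorem exists_fn_mul_le_exp (hf : CriticalGrowth lam h) :
    ∃ T : ℝ, 0 < T ∧ ∀ x ∈ B, ∀ t : ℝ, T ≤ t →
      fn lam h x t * t ≤ exp ((lam + 2) * t ^ 2) := by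
  obtain ⟨T, hT⟩ := hf.h_sup 1 one_pos 1 one_pos
  have hlam := hf.lam_pos
  refine ⟨max T 1, by positivity, fun x hx t ht => ?_⟩
  have ht1 : 1 ≤ t := (le_max_right _ _).trans ht
  have h1 : h x t ≤ exp (t ^ 2) := by
    have h2 := mul_le_mul_of_nonneg_right (hT t ((le_max_left _ _).trans ht) x hx).le
      (exp_pos (t ^ 2)).le
    rw [mul_assoc, ← exp_add] at h2
    simpa using h2
  have h0 : 0 ≤ exp (lam * t ^ 2) - 1 := sub_nonneg.2 (one_le_exp (by positivity))
  have h3 : t ≤ exp (t ^ 2) := by nlinarith [add_one_le_exp (t ^ 2)]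
  calc h x t * (exp (lam * t ^ 2) - 1) * t
      ≤ exp (t ^ 2) * exp (lam * t ^ 2) * exp (t ^ 2) := by
        have h4 : h x t * (exp (lam * t ^ 2) - 1) ≤ exp (t ^ 2) * exp (lam * t ^ 2) :=
          (mul_le_mul_of_nonneg_right h1 h0).trans
            (mul_le_mul_of_nonneg_left (by linarith) (exp_pos _).le)
        exact mul_le_mul h4 h3 (by linarith) (by positivity)
    _ = _ := by
        rw [← exp_add, ← exp_add]
        ring_nf

theorem hIntegrable_fn (hf : CriticalGrowth lam h) {u : Pt → ℝ} (hu : IsH1 u) :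
    HIntegrable fun x => fn lam h x (u x) * u x := by
  obtain ⟨T, hT, hexp⟩ := hf.exists_fn_mul_le_exp
  have hlam := hf.lam_pos
  obtain ⟨k, hk, S, hSB, hSm, hS, hSi⟩ := exists_integrableOn_exp_sq hu.1
    hu.integrableOn_fderiv hu.2.2 (α := lam + 2) (by linarith) T
  have hk0 : 0 < k := hT.trans_le hk
  obtain ⟨K, hK, hquad⟩ := hf.exists_fn_le_mul_sq hk0
  have hint : IntegrableOn (S.indicator fun x => exp ((lam + 2) * u x ^ 2) * dens x) B :=
    ((integrable_indicator_iff hSm).2 hSi).integrableOn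
  refine (((hu.2.2).const_mul (K * k)).add hint).mono' ?_
    ((ae_restrict_iff' measurableSet_B).2 (ae_of_all _ fun x hx => ?_))
  · have h1 : ContinuousOn (fun x => fn lam h x (u x)) B :=
      hf.continuous_uncurry_fn.comp_continuousOn (continuousOn_id.prodMk hu.1.continuousOn)
    exact ((h1.mul hu.1.continuousOn).mul
      (differentiableOn_rho.continuousOn.pow 2)).aestronglyMeasurable measurableSet_B
  · have hdx := dens_pos hx
    have hnn := hf.fn_mul_self_nonneg hx (u x)
    rw [Real.norm_eq_abs, abs_of_nonneg (mul_nonneg hnn hdx.le)]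
    have hind : 0 ≤ S.indicator (fun x => exp ((lam + 2) * u x ^ 2) * dens x) x :=
      indicator_nonneg (fun _ _ => mul_nonneg (exp_pos _).le (sq_nonneg _)) x
    rw [hf.fn_mul_abs hx]
    change _ ≤ K * k * (u x ^ 2 * dens x) + S.indicator _ x
    rcases le_or_gt |u x| k with hux | hux
    · refine le_add_of_le_of_nonneg ?_ hind
      rw [← mul_assoc]
      refine mul_le_mul_of_nonneg_right ?_ hdx.le
      rcases (abs_nonneg (u x)).eq_or_lt with h0 | h0
      · rw [← h0, mul_zero]
        positivity
      · calc fn lam h x |u x| * |u x| ≤ K * |u x| ^ 2 * k :=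
              mul_le_mul (hquad x hx _ h0 hux) hux h0.le (by positivity)
          _ = _ := by rw [sq_abs]; ring
    · refine le_add_of_nonneg_of_le (by positivity) ?_
      rw [indicator_of_mem (hS x hx hux), ← sq_abs (u x)]
      exact mul_le_mul_of_nonneg_right (hexp x hx _ (hk.trans hux.le)) hdx.le

theorem hIntegrable_Fn (hf : CriticalGrowth lam h) {u : Pt → ℝ} (hu : IsH1 u) :
    HIntegrable fun x => Fn lam h x (u x) := by
  have h1 : ContinuousOn (fun x => Fn lam h x (u x)) B :=
    hf.continuous_uncurry_Fn.comp_continuousOn (continuousOn_id.prodMk hu.1.continuousOn)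
  refine (hf.hIntegrable_fn hu).mono' ((h1.mul
      (differentiableOn_rho.continuousOn.pow 2)).aestronglyMeasurable measurableSet_B)
    ((ae_restrict_iff' measurableSet_B).2 (ae_of_all _ fun x hx => ?_))
  have hdx := dens_pos hx
  rw [Real.norm_eq_abs, abs_of_nonneg (mul_nonneg (hf.Fn_nonneg hx _) hdx.le)]
  refine mul_le_mul_of_nonneg_right ?_ hdx.le
  linarith [hf.Fn_le hx (u x), hf.fn_mul_self_nonneg hx (u x)]

theorem hIntegrable_fn_sub_Fn (hf : CriticalGrowth lam h) {u : Pt → ℝ} (hu : IsH1 u) :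
    HIntegrable fun x => fn lam h x (u x) * u x / 2 - Fn lam h x (u x) := by
  refine (((hf.hIntegrable_fn hu).const_mul (1 / 2)).sub (hf.hIntegrable_Fn hu)).congr
    (ae_of_all _ fun x => ?_)
  simp only [Pi.sub_apply]
  ring

theorem Ilam_eq (hf : CriticalGrowth lam h) {u : Pt → ℝ} (hu : IsH1 u) :
    Ilam lam h u = hInt fun x => fn lam h x (u x) * u x / 2 - Fn lam h x (u x) := by
  rw [Ilam, hInt, hInt, hInt, ← integral_const_mul,
    ← integral_sub ((hf.hIntegrable_fn hu).const_mul _) (hf.hIntegrable_Fn hu)]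
  congr 1 with x
  ring

theorem ae_integrand_nonneg (hf : CriticalGrowth lam h) (u : Pt → ℝ) :
    0 ≤ᵐ[volume.restrict B]
      fun x => (fn lam h x (u x) * u x / 2 - Fn lam h x (u x)) * dens x :=
  (ae_restrict_iff' measurableSet_B).2 (ae_of_all _ fun _ hx =>
    mul_nonneg (sub_nonneg.2 (hf.Fn_le hx _)) (dens_pos hx).le)

theorem Ilam_nonneg (hf : CriticalGrowth lam h) {u : Pt → ℝ} (hu : IsH1 u) :
    0 ≤ Ilam lam h u := by
  rw [hf.Ilam_eq hu]
  exact integral_nonneg_of_ae (hf.ae_integrand_nonneg u)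

theorem Ilam_eq_zero_iff (hf : CriticalGrowth lam h) {u : Pt → ℝ} (hu : IsH1 u) :
    Ilam lam h u = 0 ↔ ∀ᵐ x ∂(volume.restrict B), u x = 0 := by
  rw [hf.Ilam_eq hu, hInt, integral_eq_zero_iff_of_nonneg_ae (hf.ae_integrand_nonneg u)
    (hf.hIntegrable_fn_sub_Fn hu)]
  have hB : ∀ᵐ x ∂(volume.restrict B), x ∈ B := ae_restrict_mem measurableSet_B
  refine eventually_congr (hB.mono fun x hx => ?_)
  simp only [Pi.zero_apply, mul_eq_zero, (dens_pos hx).ne', or_false]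
  refine ⟨fun h0 => ?_, fun h0 => by simp [h0, Fn_zero]⟩
  by_contra hne
  exact (sub_pos.2 (hf.Fn_lt hx hne)).ne' h0

/-- Pointwise control of `f(x,t)t` by the integrand of `I_λ`. -/
theorem exists_fn_mul_le (hf : CriticalGrowth lam h) {ε : ℝ} (hε : 0 < ε) :
    ∃ C : ℝ, 0 < C ∧ ∃ g : Pt → ℝ, (∀ x, 0 ≤ g x) ∧ HIntegrable g ∧ ∀ x ∈ B, ∀ t : ℝ,
      fn lam h x t * t ≤ C * (fn lam h x t * t / 2 - Fn lam h x t + g x) + ε * t ^ 2 := by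
  obtain ⟨M, hM, g, hg0, hgi, hMg⟩ := hf.F_bound
  obtain ⟨K, hK, hquad⟩ := hf.exists_fn_le_mul_sq one_pos
  set s : ℝ := min 1 (ε / (2 * K)) with hs
  have hs0 : 0 < s := lt_min one_pos (by positivity)
  have hqs : ∀ x ∈ B, fn lam h x s / s ≤ ε / 2 := fun x hx => by
    rw [div_le_iff₀ hs0]
    refine (hquad x hx s hs0 (min_le_left _ _)).trans ?_
    have h1 : s * (2 * K) ≤ ε := (le_div_iff₀ (by positivity)).1 (min_le_right _ _)
    nlinarith
  set D : ℝ := 4 * (4 * M) ^ 2 / s ^ 2 with hD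
  have hD0 : 0 < D := by positivity
  refine ⟨4 + 4 * M + D, by positivity, g, hg0, hgi, fun x hx t => ?_⟩
  have hJ : 0 ≤ fn lam h x |t| * |t| / 2 - Fn lam h x |t| := sub_nonneg.2 (hf.Fn_le hx _)
  rw [hf.fn_mul_abs hx, hf.Fn_abs hx, ← sq_abs t]
  have hgx := hg0 x
  have ht0 := abs_nonneg t
  generalize |t| = r at *
  set J := fn lam h x r * r / 2 - Fn lam h x r with hJdef
  have hmain : fn lam h x r * r ≤ 4 * J + 4 * M * g x ∨ fn lam h x r * r ≤ D * J ∨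
      fn lam h x r * r ≤ ε * r ^ 2 := by
    rcases ht0.eq_or_lt with h0 | h0
    · right; right
      simp [← h0]
    have hfr := hf.f_pos x hx r h0
    rcases le_or_gt (4 * M) r with hr | hr
    · left
      have h1 := hMg x hx r h0
      have h2 := mul_le_mul_of_nonneg_right hr hfr.le
      rw [hJdef]
      nlinarith
    right
    have hfq : fn lam h x r * r = fn lam h x r / r * r ^ 2 := by field_simp
    rcases le_or_gt (fn lam h x r / r) ε with hq | hq
    · right
      rw [hfq]
      gcongr
    left
    have hsr : s ≤ r := by
      by_contra! hlt
      linarith [(hf.strictMonoOn_fn_div hx).monotoneOn h0 hs0 hlt.le, hqs x hx]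
    have h1 := hf.sub_mul_sq_le hx hs0 hsr
    have h2 : fn lam h x r / r * (s ^ 2 / 4) ≤ J := by
      refine le_trans ?_ h1
      nlinarith [hqs x hx, sq_nonneg s]
    calc fn lam h x r * r = fn lam h x r / r * r ^ 2 := hfq
      _ ≤ fn lam h x r / r * (4 * M) ^ 2 := by
        have := hε.trans hq
        gcongr
      _ = D * (fn lam h x r / r * (s ^ 2 / 4)) := by
        rw [hD]
        field_simp
      _ ≤ D * J := by gcongr
  have e1 : 0 ≤ ε * r ^ 2 := by positivity
  have e2 : 0 ≤ M * J := mul_nonneg hM.le hJ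
  have e3 : 0 ≤ D * J := mul_nonneg hD0.le hJ
  have e4 : 0 ≤ M * g x := mul_nonneg hM.le hgx
  have e5 : 0 ≤ D * g x := mul_nonneg hD0.le hgx
  rcases hmain with h1 | h1 | h1 <;> linarith

theorem exists_hInt_fn_le (hf : CriticalGrowth lam h) {ε : ℝ} (hε : 0 < ε) :
    ∃ C₀ : ℝ, 0 < C₀ ∧ ∀ u : Pt → ℝ, IsH1 u →
      hInt (fun x => fn lam h x (u x) * u x) ≤
        C₀ * (1 + Ilam lam h u) + ε * enormSq u := by
  obtain ⟨C, hC, g, hg0, hgi, hle⟩ := hf.exists_fn_mul_le (show 0 < ε / 4 by positivity)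
  have hG : 0 ≤ hInt g := integral_nonneg fun x => mul_nonneg (hg0 x) (sq_nonneg _)
  refine ⟨C * (1 + hInt g), by positivity, fun u hu => ?_⟩
  have hI := hf.Ilam_nonneg hu
  have hP : hInt (fun x => u x ^ 2) ≤ 4 * enormSq u := by
    rw [enormSq_eq]
    exact hyperbolic_poincare hu.1 hu.integrableOn_fderiv hu.2.2
  have hJi := hf.hIntegrable_fn_sub_Fn hu
  have hbound : hInt (fun x => fn lam h x (u x) * u x) ≤
      C * (Ilam lam h u + hInt g) + ε / 4 * hInt (fun x => u x ^ 2) := by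
    have hA : IntegrableOn (fun x => C * ((fn lam h x (u x) * u x / 2 - Fn lam h x (u x)) * dens x +
        g x * dens x)) B := (hJi.add hgi).const_mul C
    have hP' : IntegrableOn (fun x => ε / 4 * (u x ^ 2 * dens x)) B := hu.2.2.const_mul _
    rw [hf.Ilam_eq hu, hInt, hInt, hInt, hInt, ← integral_add hJi hgi, ← integral_const_mul,
      ← integral_const_mul, ← integral_add hA hP']
    refine setIntegral_mono_on (hf.hIntegrable_fn hu) (hA.add hP') measurableSet_B fun x hx => ?_
    have h1 := mul_le_mul_of_nonneg_right (hle x hx (u x)) (dens_pos hx).le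
    linarith
  have e1 := mul_nonneg (mul_nonneg hC.le hG) hI
  have e2 := mul_le_mul_of_nonneg_left hP (show 0 ≤ ε / 4 by positivity)
  nlinarith

end CriticalGrowth

/-- (a) For every `u ∈ H¹(𝔹²)`, `I_λ(u) ≥ 0`, with equality iff `u = 0` a.e.
on `B`; (b) for every `ε > 0` there is `C₀(ε) > 0` such that for all
`u ∈ H¹_R(𝔹²)`, `∫_B f(x,u)u dv_g ≤ C₀(ε)(1 + I_λ(u)) + ε‖u‖²`. -/
theorem stmt12 (lam : ℝ) (h : Pt → ℝ → ℝ) (hf : CriticalGrowth lam h) :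
    (∀ u : Pt → ℝ, IsH1 u →
      0 ≤ Ilam lam h u ∧
      (Ilam lam h u = 0 ↔ ∀ᵐ x ∂(volume.restrict B), u x = 0)) ∧
    (∀ ε : ℝ, 0 < ε → ∃ C₀ : ℝ, 0 < C₀ ∧ ∀ u : Pt → ℝ, IsH1R u →
      hInt (fun x => fn lam h x (u x) * u x) ≤
        C₀ * (1 + Ilam lam h u) + ε * enormSq u) := by
  refine ⟨fun u hu => ⟨hf.Ilam_nonneg hu, hf.Ilam_eq_zero_iff hu⟩, fun ε hε => ?_⟩
  obtain ⟨C₀, hC₀, hle⟩ := hf.exists_hInt_fn_le hε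
  exact ⟨C₀, hC₀, fun u hu => hle u hu.1⟩
end
end
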